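/- Let H be a non-semisimple Hopf algebra of dimension 4p over an algebraically closed field k of characteristic zero, where p is an odd prime. Then H is pointed if and only if the group G(H) of group-like elements of H has order greater than 2. -/

import Mathlib

open scoped TensorProduct

/-- An element of a coalgebra (with comultiplication `Δ`) is group-like if it is
nonzero and `Δ a = a ⊗ a`. -/
def IsGroupLikeOf {k H : Type} [CommRing k] [AddCommGroup H] [Module k H]
    (Δ : H →ₗ[k] H ⊗[k] H) (a : H) : Prop :=
  a ≠ 0 ∧ Δ a = a ⊗ₜ[k] a

/-- A `k`-subspace `C` of a coalgebra with comultiplication `Δ` is a subcoalgebra if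
`Δ C ⊆ C ⊗ C`. -/
def IsSubcoalgebraOf {k H : Type} [CommRing k] [AddCommGroup H] [Module k H]
    (Δ : H →ₗ[k] H ⊗[k] H) (C : Submodule k H) : Prop :=
  ∀ c ∈ C, Δ c ∈ LinearMap.range (TensorProduct.map C.subtype C.subtype)

/-- A subcoalgebra is simple if it is nonzero and has no proper nonzero subcoalgebras. -/
def IsSimpleSubcoalgebraOf {k H : Type} [CommRing k] [AddCommGroup H] [Module k H]
    (Δ : H →ₗ[k] H ⊗[k] H) (C : Submodule k H) : Prop :=
  IsSubcoalgebraOf Δ C ∧ C ≠ ⊥ ∧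
    ∀ D : Submodule k H, IsSubcoalgebraOf Δ D → D ≤ C → D = ⊥ ∨ D = C

/-- A coalgebra is pointed if every simple subcoalgebra is one-dimensional. -/
def IsPointedOf {k H : Type} [CommRing k] [AddCommGroup H] [Module k H]
    (Δ : H →ₗ[k] H ⊗[k] H) : Prop :=
  ∀ C : Submodule k H, IsSimpleSubcoalgebraOf Δ C → Module.finrank k C = 1

set_option linter.unusedSectionVars false

namespace Hopf4p

open Coalgebra HopfAlgebra WithConv

section Sweedler

/-- Linearity of a plain function, in a form suited to `fun_prop`. -/
@[fun_prop]
structure Lin (k : Type) {M N : Type} [CommRing k] [AddCommGroup M] [AddCommGroup N]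
    [Module k M] [Module k N] (f : M → N) : Prop where
  map_add : ∀ x y, f (x + y) = f x + f y
  map_smul : ∀ (c : k) x, f (c • x) = c • f x

variable {k : Type} [CommRing k] {M N P Q : Type} [AddCommGroup M] [AddCommGroup N]
  [AddCommGroup P] [AddCommGroup Q] [Module k M] [Module k N] [Module k P] [Module k Q]

namespace Lin

@[fun_prop]
theorem id : Lin k (fun x : M => x) := ⟨fun _ _ => rfl, fun _ _ => rfl⟩

@[fun_prop]
theorem comp {g : N → P} {f : M → N} (hg : Lin k g) (hf : Lin k f) : Lin k (fun x => g (f x)) :=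
  ⟨fun x y => by rw [hf.map_add, hg.map_add], fun c x => by rw [hf.map_smul, hg.map_smul]⟩

@[fun_prop]
theorem linearMap_apply (g : N →ₗ[k] P) {f : M → N} (hf : Lin k f) : Lin k (fun x => g (f x)) :=
  ⟨fun x y => by rw [hf.map_add, _root_.map_add], fun c x => by rw [hf.map_smul, _root_.map_smul]⟩

@[fun_prop]
theorem algHom_apply {R S : Type} [Ring R] [Ring S] [Algebra k R] [Algebra k S]
    (g : R →ₐ[k] S) {f : M → R} (hf : Lin k f) : Lin k (fun x => g (f x)) :=
  ⟨fun x y => by rw [hf.map_add, _root_.map_add], fun c x => by rw [hf.map_smul, _root_.map_smul]⟩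

@[fun_prop]
theorem map_apply {f : M → (N →ₗ[k] P)} (hf : Lin k f) (n : N) : Lin k (fun x => f x n) :=
  ⟨fun x y => by rw [hf.map_add]; rfl, fun c x => by rw [hf.map_smul]; rfl⟩

@[fun_prop]
theorem smul_const {f : M → k} (hf : Lin k f) (n : N) : Lin k (fun x => f x • n) :=
  ⟨fun x y => by rw [hf.map_add, add_smul], fun c x => by rw [hf.map_smul, smul_assoc]⟩

@[fun_prop]
theorem const_smul {f : M → N} (hf : Lin k f) (c : k) : Lin k (fun x => c • f x) :=
  ⟨fun x y => by rw [hf.map_add, smul_add], fun d x => by rw [hf.map_smul, smul_comm]⟩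

@[fun_prop]
theorem mul_const {R : Type} [Ring R] [Algebra k R] {f : M → R} (hf : Lin k f) (n : R) :
    Lin k (fun x => f x * n) :=
  ⟨fun x y => by rw [hf.map_add, add_mul], fun c x => by rw [hf.map_smul, smul_mul_assoc]⟩

@[fun_prop]
theorem const_mul {R : Type} [Ring R] [Algebra k R] {f : M → R} (hf : Lin k f) (n : R) :
    Lin k (fun x => n * f x) :=
  ⟨fun x y => by rw [hf.map_add, mul_add], fun c x => by rw [hf.map_smul, mul_smul_comm]⟩

@[fun_prop]
theorem tmul_const {f : M → N} (hf : Lin k f) (n : P) : Lin k (fun x => f x ⊗ₜ[k] n) :=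
  ⟨fun x y => by rw [hf.map_add, TensorProduct.add_tmul],
   fun c x => by rw [hf.map_smul, TensorProduct.smul_tmul']⟩

@[fun_prop]
theorem const_tmul {f : M → N} (hf : Lin k f) (n : P) : Lin k (fun x => n ⊗ₜ[k] f x) :=
  ⟨fun x y => by rw [hf.map_add, TensorProduct.tmul_add],
   fun c x => by rw [hf.map_smul, TensorProduct.tmul_smul]⟩

theorem map_sum {ι : Type} {f : M → N} (hf : Lin k f) (s : Finset ι) (g : ι → M) :
    f (∑ i ∈ s, g i) = ∑ i ∈ s, f (g i) := by
  let F : M →ₗ[k] N := ⟨⟨f, hf.map_add⟩, hf.map_smul⟩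
  exact _root_.map_sum F g s

theorem map_zero {f : M → N} (hf : Lin k f) : f 0 = 0 := by
  simpa using hf.map_smul 0 0

/-- The bundled linear map. -/
def toMap {f : M → N} (hf : Lin k f) : M →ₗ[k] N := ⟨⟨f, hf.map_add⟩, hf.map_smul⟩

@[simp] theorem toMap_apply {f : M → N} (hf : Lin k f) (x : M) : hf.toMap x = f x := rfl

@[fun_prop]
theorem linearMap (g : N →ₗ[k] P) : Lin k (fun x => g x) := linearMap_apply g id

@[fun_prop]
theorem algHom {R S : Type} [Ring R] [Ring S] [Algebra k R] [Algebra k S]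
    (g : R →ₐ[k] S) : Lin k (fun x => g x) := algHom_apply g id

end Lin

variable {H : Type} [Ring H] [HopfAlgebra k H]

/-- The Sweedler sum `sw x f` of the `f x₁ x₂`. -/
noncomputable def sw (k : Type) [CommRing k] {H : Type} [Ring H] [HopfAlgebra k H] {M : Type}
    [AddCommGroup M] (x : H) (f : H → H → M) : M :=
  ∑ i ∈ (Coalgebra.Repr.arbitrary k x).index,
    f ((Coalgebra.Repr.arbitrary k x).left i) ((Coalgebra.Repr.arbitrary k x).right i)

/-- Bilinearity of a plain function. -/
def Bil (k : Type) [CommRing k] {M N P : Type} [AddCommGroup M] [AddCommGroup N]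
    [AddCommGroup P] [Module k M] [Module k N] [Module k P] (f : M → N → P) : Prop :=
  (∀ y, Lin k (fun x => f x y)) ∧ ∀ x, Lin k (fun y => f x y)

/-- The linear map out of the tensor product attached to a bilinear function. -/
noncomputable def Bil.lift {f : M → N → P} (hf : Bil k f) : M ⊗[k] N →ₗ[k] P :=
  TensorProduct.lift (LinearMap.mk₂ k f (fun a b c => (hf.1 c).map_add a b)
    (fun c a b => (hf.1 b).map_smul c a) (fun a => (hf.2 a).map_add)
    (fun c a => (hf.2 a).map_smul c))

@[simp] theorem Bil.lift_tmul {f : M → N → P} (hf : Bil k f) (x : M) (y : N) :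
    hf.lift (x ⊗ₜ y) = f x y := rfl

theorem sw_eq_lift {f : H → H → M} (hf : Bil k f) (x : H) : sw k x f = hf.lift (comul (R := k) x) := by
  rw [← (Coalgebra.Repr.arbitrary k x).eq]
  simp [sw]

omit [Module k M] in
theorem sw_congr {x : H} {f g : H → H → M} (h : ∀ a b, f a b = g a b) : sw k x f = sw k x g :=
  Finset.sum_congr rfl fun _ _ => h _ _

theorem sw_eq_of_comul {f : H → H → M} (hf : Bil k f) {x a b : H}
    (h : comul (R := k) x = a ⊗ₜ[k] b) : sw k x f = f a b := by
  rw [sw_eq_lift hf, h]; rfl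

@[fun_prop]
theorem Lin.sw_param {f : M → H → H → N} (h : ∀ a b, Lin k (fun z => f z a b)) (x : H) :
    Lin k (fun z => sw k x (f z)) :=
  ⟨fun z w => by simp only [sw, (h _ _).map_add, Finset.sum_add_distrib],
   fun c z => by simp only [sw, (h _ _).map_smul, Finset.smul_sum]⟩

@[fun_prop]
theorem Lin.sw_arg {f : H → H → N} (h1 : ∀ b, Lin k (fun a => f a b)) (h2 : ∀ a, Lin k (f a))
    {g : M → H} (hg : Lin k g) :
    Lin k (fun z => sw k (g z) f) := by
  have h : Bil k f := ⟨h1, h2⟩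
  simp only [sw_eq_lift h]
  fun_prop

theorem map_sw {f : H → H → M} {g : M → N} (hg : Lin k g) (x : H) :
    g (sw k x f) = sw k x (fun a b => g (f a b)) := hg.map_sum _ _

theorem linearMap_sw (g : M →ₗ[k] N) (x : H) (f : H → H → M) :
    g (sw k x f) = sw k x (fun a b => g (f a b)) := map_sw (Lin.linearMap g) x

theorem smul_sw (c : k) (x : H) (f : H → H → M) :
    c • sw k x f = sw k x (fun a b => c • f a b) := Finset.smul_sum

theorem sw_smul (x : H) (f : H → H → k) (m : M) :
    sw k x f • m = sw k x (fun a b => f a b • m) := Finset.sum_smul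

theorem mul_sw {R : Type} [Ring R] (c : R) (x : H) (f : H → H → R) :
    c * sw k x f = sw k x (fun a b => c * f a b) := Finset.mul_sum _ _ _

theorem sw_mul_const {R : Type} [Ring R] (c : R) (x : H) (f : H → H → R) :
    sw k x f * c = sw k x (fun a b => f a b * c) := Finset.sum_mul _ _ _

omit [Module k M] in
theorem sw_comm (x y : H) (f : H → H → H → H → M) :
    sw k x (fun a b => sw k y (fun c d => f a b c d)) =
      sw k y (fun c d => sw k x (fun a b => f a b c d)) := Finset.sum_comm

/-- Trilinearity of a plain function. -/
def Tri (k : Type) [CommRing k] {H M : Type} [AddCommGroup M] [AddCommGroup H]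
    [Module k M] [Module k H] (f : H → H → H → M) : Prop :=
  (∀ y z, Lin k (fun x => f x y z)) ∧ (∀ x z, Lin k (fun y => f x y z)) ∧
    ∀ x y, Lin k (fun z => f x y z)

theorem sw_assoc {f : H → H → H → M} (hf : Tri k f) (x : H) :
    sw k x (fun a c => sw k a (fun a b => f a b c)) =
      sw k x (fun a b => sw k b (fun b c => f a b c)) := by
  obtain ⟨h1, h2, h3⟩ := hf
  have hg : ∀ a, Bil k (f a) := fun a => ⟨fun c => h2 a c, fun b => h3 a b⟩
  have hG : Bil k (fun a t => (hg a).lift t) := by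
    refine ⟨fun t => ?_, fun a => Lin.linearMap _⟩
    induction t using TensorProduct.induction_on with
    | zero => simpa using ⟨by simp, by simp⟩
    | tmul y z => exact h1 y z
    | add s t hs ht =>
      constructor
      · intro x y
        have := hs.map_add x y
        have := ht.map_add x y
        simp_all; abel
      · intro c x
        have := hs.map_smul c x
        have := ht.map_smul c x
        simp_all
  have hk : ∀ c, Bil k (fun a b => f a b c) := fun c => ⟨fun b => h1 b c, fun a => h2 a c⟩
  have key := congrArg hG.lift (Coalgebra.coassoc_apply (R := k) x)
  have h4 : ∀ c a, hG.lift (TensorProduct.assoc k H H H (comul (R := k) a ⊗ₜ[k] c)) =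
      sw k a (fun a b => f a b c) := by
    intro c a
    rw [sw_eq_lift (hk c)]
    induction comul (R := k) a using TensorProduct.induction_on with
    | zero => simp
    | tmul y z => rfl
    | add s t hs ht => simp only [TensorProduct.add_tmul, _root_.map_add, hs, ht]
  have h5 : ∀ a b, hG.lift (a ⊗ₜ[k] comul (R := k) b) = sw k b (fun b c => f a b c) := by
    intro a b
    rw [sw_eq_lift (hg a)]; rfl
  rw [← (Coalgebra.Repr.arbitrary k x).eq] at key
  simp only [_root_.map_sum, LinearMap.rTensor_tmul, LinearMap.lTensor_tmul, h4, h5] at key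
  exact key

theorem sw_counit_left {f : H → M} (hf : Lin k f) (x : H) :
    sw k x (fun a b => counit (R := k) a • f b) = f x := by
  conv_rhs => rw [← Coalgebra.sum_counit_smul (Coalgebra.Repr.arbitrary k x), hf.map_sum]
  exact Finset.sum_congr rfl fun _ _ => (hf.map_smul _ _).symm

theorem sw_counit_right {f : H → M} (hf : Lin k f) (x : H) :
    sw k x (fun a b => counit (R := k) b • f a) = f x := by
  have h := congrArg (TensorProduct.rid k H)
    (Coalgebra.lTensor_counit_comul (R := k) x)
  rw [← (Coalgebra.Repr.arbitrary k x).eq] at h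
  simp only [map_sum, LinearMap.lTensor_tmul, TensorProduct.rid_tmul, one_smul] at h
  conv_rhs => rw [← h, hf.map_sum]
  exact Finset.sum_congr rfl fun _ _ => (hf.map_smul _ _).symm

theorem sw_mul {f : H → H → M} (hf : Bil k f) (x y : H) :
    sw k (x * y) f = sw k x (fun a b => sw k y (fun c d => f (a * c) (b * d))) := by
  rw [sw_eq_lift hf, Bialgebra.comul_mul, ← (Coalgebra.Repr.arbitrary k x).eq,
    ← (Coalgebra.Repr.arbitrary k y).eq]
  simp [Finset.sum_mul_sum, sw]

theorem sw_one {f : H → H → M} (hf : Bil k f) : sw k 1 f = f 1 1 :=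
  sw_eq_of_comul hf (by simp [Algebra.TensorProduct.one_def])

theorem sw_antipode_mul (x : H) :
    sw k x (fun a b => antipode k a * b) = counit (R := k) x • (1 : H) :=
  sum_antipode_mul_eq_smul _

theorem sw_mul_antipode (x : H) :
    sw k x (fun a b => a * antipode k b) = counit (R := k) x • (1 : H) :=
  sum_mul_antipode_eq_smul _

end Sweedler

section Operators

variable {k : Type} [Field k] {H : Type} [Ring H] [HopfAlgebra k H] {M : Type} [AddCommGroup M]
  [Module k M]

theorem sw_antipode {f : H → H → M} (hf : Bil k f) (x : H) :
    sw k (antipode k x) f = sw k x (fun a b => f (antipode k b) (antipode k a)) := by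
  have hT : Bil k (fun a b : H => antipode k b ⊗ₜ[k] antipode k a) :=
    ⟨fun _ => by fun_prop, fun _ => by fun_prop⟩
  have h1 : toConv (hT.lift ∘ₗ comul) * toConv (comul (R := k) (A := H)) = 1 := by
    ext x
    have : (toConv (hT.lift ∘ₗ comul) * toConv (comul (R := k) (A := H))) x =
        sw k x (fun a b => sw k a (fun c d => sw k b (fun e f =>
          (antipode k d * e) ⊗ₜ[k] (antipode k c * f)))) := by
      rw [(Coalgebra.Repr.arbitrary k x).convMul_apply]
      refine Finset.sum_congr rfl fun i _ => ?_
      change hT.lift (comul (R := k) _) * comul (R := k) _ = _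
      rw [← sw_eq_lift hT, ← (Coalgebra.Repr.arbitrary k
        ((Coalgebra.Repr.arbitrary k x).right i)).eq]
      simp [sw, Finset.sum_mul_sum]
    rw [this, sw_assoc]
    swap
    · refine ⟨?_, ?_, ?_⟩ <;> intros <;> fun_prop
    have h2 : ∀ c y : H, sw k y (fun d b => sw k b (fun e f =>
        (antipode k d * e) ⊗ₜ[k] (antipode k c * f))) = 1 ⊗ₜ[k] (antipode k c * y) := by
      intro c y
      rw [← sw_assoc (f := fun d e f => (antipode k d * e) ⊗ₜ[k] (antipode k c * f))]
      swap
      · refine ⟨?_, ?_, ?_⟩ <;> intros <;> fun_prop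
      rw [← sw_counit_left (f := fun f => 1 ⊗ₜ[k] (antipode k c * f)) (by fun_prop)]
      refine sw_congr fun z f => ?_
      rw [← map_sw (g := fun t => t ⊗ₜ[k] (antipode k c * f)) (by fun_prop), sw_antipode_mul,
        TensorProduct.smul_tmul']
    simp only [h2]
    rw [← map_sw (g := fun t => (1 : H) ⊗ₜ[k] t) (by fun_prop), sw_antipode_mul]
    simp [Algebra.TensorProduct.one_def, Algebra.algebraMap_eq_smul_one]
  have h2 := left_inv_eq_right_inv h1 LinearMap.comul_right_inv
  have h3 : hT.lift (comul x) = comul (R := k) (antipode k x) :=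
    LinearMap.congr_fun (congrArg WithConv.ofConv h2) x
  rw [sw_eq_lift hf, ← h3, ← sw_eq_lift hT, linearMap_sw]
  rfl

/-- The square of the antipode. -/
noncomputable def antipodeSq (k H : Type) [Field k] [Ring H] [HopfAlgebra k H] : H →ₐ[k] H :=
  AlgHom.ofLinearMap (antipode k ∘ₗ antipode k) (by simp)
    (fun a b => by simp [antipode_mul_antidistrib])

theorem antipodeSq_apply (x : H) : antipodeSq k H x = antipode k (antipode k x) := rfl

theorem sw_antipodeSq {f : H → H → M} (hf : Bil k f) (x : H) :
    sw k (antipodeSq k H x) f = sw k x (fun a b => f (antipodeSq k H a) (antipodeSq k H b)) := by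
  obtain ⟨h1, h2⟩ := id hf
  rw [antipodeSq_apply, sw_antipode hf, sw_antipode]
  · rfl
  · constructor <;> intro <;> fun_prop

theorem counit_antipodeSq (x : H) : counit (R := k) (antipodeSq k H x) = counit (R := k) x := by
  simp [antipodeSq_apply]

/-- The dual algebra. -/
abbrev Du (k H : Type) [Field k] [Ring H] [HopfAlgebra k H] := WithConv (H →ₗ[k] k)

theorem du_ext {f g : Du k H} (h : ∀ x, f x = g x) : f = g :=
  WithConv.ext (LinearMap.ext h)

theorem du_mul_apply (f g : Du k H) (x : H) : (f * g) x = sw k x (fun a b => f a * g b) :=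
  (Coalgebra.Repr.arbitrary k x).convMul_apply f g

theorem du_one_apply (x : H) : (1 : Du k H) x = counit (R := k) x := rfl

@[simp] theorem du_add_apply (f g : Du k H) (x : H) : (f + g) x = f x + g x := rfl
@[simp] theorem du_sub_apply (f g : Du k H) (x : H) : (f - g) x = f x - g x := rfl
@[simp] theorem du_neg_apply (f : Du k H) (x : H) : (-f) x = - f x := rfl
@[simp] theorem du_smul_apply (c : k) (f : Du k H) (x : H) : (c • f) x = c * f x := rfl
@[simp] theorem du_zero_apply (x : H) : (0 : Du k H) x = 0 := rfl
theorem du_sum_apply {ι : Type} (s : Finset ι) (f : ι → Du k H) (x : H) :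
    (∑ i ∈ s, f i) x = ∑ i ∈ s, f i x := by
  simp

@[fun_prop]
theorem Lin.du_apply {f : M → Du k H} (hf : Lin k f) (x : H) : Lin k (fun z => f z x) :=
  ⟨fun y z => by rw [hf.map_add]; rfl, fun c y => by rw [hf.map_smul]; rfl⟩

/-- The operator sending `x` to the sum of the `f x₁ • x₂`. -/
noncomputable def lact (f : Du k H) : Module.End k H :=
  Lin.toMap (f := fun x => sw k x (fun a b => f a • b)) (by fun_prop)

/-- The operator sending `x` to the sum of the `f x₂ • x₁`. -/
noncomputable def ract (f : Du k H) : Module.End k H :=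
  Lin.toMap (f := fun x => sw k x (fun a b => f b • a)) (by fun_prop)

theorem lact_apply (f : Du k H) (x : H) : lact f x = sw k x (fun a b => f a • b) := rfl

theorem ract_apply (f : Du k H) (x : H) : ract f x = sw k x (fun a b => f b • a) := rfl

@[fun_prop]
theorem Lin.lact_apply {f : M → Du k H} (hf : Lin k f) (x : H) : Lin k (fun z => lact (f z) x) := by
  simp only [Hopf4p.lact_apply]
  fun_prop

@[fun_prop]
theorem Lin.ract_apply {f : M → Du k H} (hf : Lin k f) (x : H) : Lin k (fun z => ract (f z) x) := by
  simp only [Hopf4p.ract_apply]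
  fun_prop

theorem sw_lact {F : H → H → M} (hF : Bil k F) (f : Du k H) (x : H) :
    sw k (lact f x) F = sw k x (fun a y => f a • sw k y (fun b c => F b c)) := by
  obtain ⟨h1, h2⟩ := id hF
  rw [lact_apply, map_sw (g := fun z => sw k z F) (by fun_prop)]
  refine sw_congr fun a b => ?_
  rw [(show Lin k (fun z => sw k z F) by fun_prop).map_smul]

theorem sw_ract {F : H → H → M} (hF : Bil k F) (f : Du k H) (x : H) :
    sw k (ract f x) F = sw k x (fun a b => f b • sw k a (fun c d => F c d)) := by
  obtain ⟨h1, h2⟩ := id hF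
  rw [ract_apply, map_sw (g := fun z => sw k z F) (by fun_prop)]
  refine sw_congr fun a b => ?_
  rw [(show Lin k (fun z => sw k z F) by fun_prop).map_smul]

/-- `Δ (l_f x) = l_f x₁ ⊗ x₂`. -/
theorem sw_lact' {F : H → H → M} (hF : Bil k F) (f : Du k H) (x : H) :
    sw k (lact f x) F = sw k x (fun a b => F (lact f a) b) := by
  obtain ⟨h1, h2⟩ := id hF
  rw [sw_lact hF]
  simp only [lact_apply]
  have : ∀ a b, F (sw k a (fun c d => f c • d)) b = sw k a (fun c d => f c • F d b) := by
    intro a b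
    rw [map_sw (g := fun z => F z b) (by fun_prop)]
    exact sw_congr fun c d => (h1 b).map_smul _ _
  simp only [this]
  rw [sw_assoc]
  · refine sw_congr fun a y => ?_
    rw [smul_sw]
  · refine ⟨?_, ?_, ?_⟩ <;> intros <;> fun_prop

/-- `Δ (r_f x) = x₁ ⊗ r_f x₂`. -/
theorem sw_ract' {F : H → H → M} (hF : Bil k F) (f : Du k H) (x : H) :
    sw k (ract f x) F = sw k x (fun a b => F a (ract f b)) := by
  obtain ⟨h1, h2⟩ := id hF
  rw [sw_ract hF]
  simp only [ract_apply]
  have : ∀ a b, F a (sw k b (fun c d => f d • c)) = sw k b (fun c d => f d • F a c) := by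
    intro a b
    rw [map_sw (g := fun z => F a z) (by fun_prop)]
    exact sw_congr fun c d => (h2 a).map_smul _ _
  simp only [this]
  rw [← sw_assoc (f := fun a c d => f d • F a c)]
  · refine sw_congr fun a y => ?_
    rw [smul_sw]
  · refine ⟨?_, ?_, ?_⟩ <;> intros <;> fun_prop

theorem lact_mul (f g : Du k H) : lact (f * g) = lact g * lact f := by
  ext x
  rw [Module.End.mul_apply, lact_apply g, sw_lact (by constructor <;> intro <;> fun_prop),
    lact_apply]
  simp only [du_mul_apply]
  have : ∀ a b : H, (sw k a (fun c d => f c * g d)) • b = sw k a (fun c d => (f c * g d) • b) := by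
    intro a b
    rw [map_sw (g := fun z : k => z • b) (by fun_prop)]
  simp only [this]
  rw [sw_assoc]
  · refine sw_congr fun a y => ?_
    rw [smul_sw]
    simp [mul_smul]
  · refine ⟨?_, ?_, ?_⟩ <;> intros <;> fun_prop

theorem ract_mul (f g : Du k H) : ract (f * g) = ract f * ract g := by
  ext x
  rw [Module.End.mul_apply, ract_apply f, sw_ract (by constructor <;> intro <;> fun_prop),
    ract_apply]
  simp only [du_mul_apply]
  have : ∀ a b : H, (sw k b (fun c d => f c * g d)) • a = sw k b (fun c d => (f c * g d) • a) := by
    intro a b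
    rw [map_sw (g := fun z : k => z • a) (by fun_prop)]
  simp only [this]
  rw [← sw_assoc (f := fun a c d => (f c * g d) • a)]
  · refine sw_congr fun a y => ?_
    rw [smul_sw]
    exact sw_congr fun c d => by rw [smul_smul, mul_comm]
  · refine ⟨?_, ?_, ?_⟩ <;> intros <;> fun_prop

theorem lact_one : lact (1 : Du k H) = 1 := by
  ext x
  exact sw_counit_left (f := fun b => b) (by fun_prop) x

theorem ract_one : ract (1 : Du k H) = 1 := by
  ext x
  exact sw_counit_right (f := fun b => b) (by fun_prop) x

theorem lact_ract_comm (f g : Du k H) : lact f * ract g = ract g * lact f := by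
  ext x
  rw [Module.End.mul_apply, Module.End.mul_apply, lact_apply,
    sw_ract' (by constructor <;> intro <;> fun_prop), lact_apply, linearMap_sw]
  exact sw_congr fun a b => (map_smul _ _ _).symm

theorem apply_ract (f g : Du k H) (x : H) : f (ract g x) = (f * g) x := by
  rw [du_mul_apply, ract_apply, linearMap_sw]
  exact sw_congr fun a b => by simp [mul_comm]

theorem apply_lact (f g : Du k H) (x : H) : g (lact f x) = (f * g) x := by
  rw [du_mul_apply, lact_apply, linearMap_sw]
  exact sw_congr fun a b => by simp

theorem counit_lact (f : Du k H) (x : H) : counit (R := k) (lact f x) = f x := by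
  rw [← du_one_apply, apply_lact, mul_one]

theorem counit_ract (f : Du k H) (x : H) : counit (R := k) (ract f x) = f x := by
  rw [← du_one_apply, apply_ract, one_mul]

end Operators

section RootsOfUnity

open Polynomial

variable {k : Type} [Field k] [CharZero k]

theorem exists_exponents {m : ℕ} [NeZero m] {ζ : k} (hζ : IsPrimitiveRoot ζ m) (R : Multiset k)
    (hR : ∀ r ∈ R, r ^ m = 1) : ∃ A : Multiset ℕ, A.map (fun a => ζ ^ a) = R := by
  classical
  have h : ∀ r : k, ∃ a : ℕ, r ^ m = 1 → ζ ^ a = r := by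
    intro r
    by_cases hr : r ^ m = 1
    · obtain ⟨i, _, hi⟩ := hζ.eq_pow_of_pow_eq_one hr
      exact ⟨i, fun _ => hi⟩
    · exact ⟨0, fun h => absurd h hr⟩
  choose f hf using h
  refine ⟨R.map f, ?_⟩
  rw [Multiset.map_map]
  conv_rhs => rw [← Multiset.map_id R]
  exact Multiset.map_congr rfl fun r hr => hf r (hR r hr)

theorem aeval_sum_X_pow {K : Type} [Field K] (ζ : K) (A : Multiset ℕ) :
    aeval ζ (A.map (fun a => (X : ℤ[X]) ^ a)).sum = (A.map (fun a => ζ ^ a)).sum := by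
  rw [map_multiset_sum, Multiset.map_map]
  simp

/-- Roots of unity adding up to their number are all trivial. -/
theorem eq_one_of_sum_eq_card [IsAlgClosed k] {m : ℕ} (hm : 0 < m) (R : Multiset k)
    (hR : ∀ r ∈ R, r ^ m = 1) (hs : R.sum = R.card) : ∀ r ∈ R, r = 1 := by
  have : NeZero m := ⟨hm.ne'⟩
  have : NeZero (m : k) := ⟨by exact_mod_cast hm.ne'⟩
  obtain ⟨ζ, hζ⟩ := HasEnoughRootsOfUnity.exists_primitiveRoot k m
  obtain ⟨A, rfl⟩ := exists_exponents hζ R hR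
  have hq : cyclotomic m ℤ ∣ (A.map (fun a => (X : ℤ[X]) ^ a)).sum - C (A.card : ℤ) := by
    rw [cyclotomic_eq_minpoly hζ hm]
    refine minpoly.isIntegrallyClosed_dvd (hζ.isIntegral hm) ?_
    rw [map_sub, aeval_sum_X_pow, hs]
    simp
  have hζ' := Complex.isPrimitiveRoot_exp m hm.ne'
  set ξ := Complex.exp (2 * Real.pi * Complex.I / m)
  have h0 : aeval ξ ((A.map (fun a => (X : ℤ[X]) ^ a)).sum - C (A.card : ℤ)) = 0 := by
    obtain ⟨s, hs⟩ := hq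
    rw [hs, map_mul, cyclotomic_eq_minpoly hζ' hm, minpoly.aeval, zero_mul]
  rw [map_sub, aeval_sum_X_pow, sub_eq_zero] at h0
  have h1 : ∀ a, ‖ξ ^ a‖ = 1 := fun a => by
    rw [norm_pow, hζ'.norm'_eq_one hm.ne', one_pow]
  have h2 : (A.map (fun a => 1 - (ξ ^ a).re)).sum = 0 := by
    have := congrArg Complex.re h0
    rw [← Complex.coe_reAddGroupHom, map_multiset_sum, Multiset.map_map] at this
    rw [Multiset.sum_map_sub]
    simp only [Multiset.map_const', Multiset.sum_replicate, nsmul_eq_mul, mul_one]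
    simp at this
    rw [sub_eq_zero, ← this]
  have h3 : ∀ x ∈ A.map (fun a => 1 - (ξ ^ a).re), 0 ≤ x := by
    intro x hx
    obtain ⟨a, _, rfl⟩ := Multiset.mem_map.1 hx
    have := Complex.re_le_norm (ξ ^ a)
    rw [h1] at this
    linarith
  intro r hr
  obtain ⟨a, ha, rfl⟩ := Multiset.mem_map.1 hr
  have h4 : 1 - (ξ ^ a).re = 0 :=
    Multiset.all_zero_of_le_zero_le_of_sum_eq_zero h3 h2 _ (Multiset.mem_map_of_mem _ ha)
  have h5 : ξ ^ a = 1 := by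
    have h6 : (ξ ^ a).re = 1 := by linarith
    have h7 := Complex.sq_norm (ξ ^ a)
    rw [h1, Complex.normSq_apply, h6] at h7
    have h8 : (ξ ^ a).im = 0 := by nlinarith
    exact Complex.ext (by simp [h6]) (by simp [h8])
  rw [hζ.pow_eq_one_iff_dvd]
  exact (hζ'.pow_eq_one_iff_dvd a).1 h5

/-- An odd number of roots of unity of 2-power order has nonzero sum. -/
theorem sum_ne_zero_of_odd [IsAlgClosed k] {n : ℕ} (R : Multiset k)
    (hR : ∀ r ∈ R, r ^ (2 ^ n) = 1) (hs : Odd R.card) : R.sum ≠ 0 := by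
  intro h0
  have hR' : ∀ r ∈ R, r ^ (2 ^ (n + 1)) = 1 := fun r hr => by
    rw [pow_succ, pow_mul, hR r hr, one_pow]
  have hm : 0 < 2 ^ (n + 1) := by positivity
  have : NeZero ((2 ^ (n + 1) : ℕ) : k) := ⟨by exact_mod_cast hm.ne'⟩
  obtain ⟨ζ, hζ⟩ := HasEnoughRootsOfUnity.exists_primitiveRoot k (2 ^ (n + 1))
  obtain ⟨A, rfl⟩ := exists_exponents hζ R hR'
  have hq : cyclotomic (2 ^ (n + 1)) ℤ ∣ (A.map (fun a => (X : ℤ[X]) ^ a)).sum := by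
    rw [cyclotomic_eq_minpoly hζ hm]
    refine minpoly.isIntegrallyClosed_dvd (hζ.isIntegral hm) ?_
    rw [aeval_sum_X_pow, h0]
  have h1 := eval_dvd (x := 1) hq
  have : Fact (Nat.Prime 2) := ⟨Nat.prime_two⟩
  rw [eval_one_cyclotomic_prime_pow, ← coe_evalRingHom, map_multiset_sum, Multiset.map_map] at h1
  simp only [Function.comp_apply, coe_evalRingHom, eval_pow, eval_X, one_pow, Multiset.map_const',
    Multiset.sum_replicate, nsmul_eq_mul, mul_one] at h1
  rw [Multiset.card_map] at hs
  have : 2 ∣ A.card := by exact_mod_cast h1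
  exact (Nat.not_even_iff_odd.2 hs) (even_iff_two_dvd.2 this)

variable {V : Type} [AddCommGroup V] [Module k V] [FiniteDimensional k V]

theorem pow_eq_one_of_mem_roots_charpoly {T : Module.End k V} {m : ℕ} (hT : T ^ m = 1) {r : k}
    (hr : r ∈ T.charpoly.roots) : r ^ m = 1 := by
  have h1 := (T.hasEigenvalue_iff_isRoot_charpoly r).2 (isRoot_of_mem_roots hr)
  obtain ⟨v, hv⟩ := h1.exists_hasEigenvector
  have h2 := hv.pow_apply m
  rw [hT, Module.End.one_apply] at h2
  have h3 : (r ^ m - 1) • v = 0 := by rw [sub_smul, ← h2, one_smul, sub_self]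
  exact sub_eq_zero.1 ((smul_eq_zero.1 h3).resolve_right hv.2)

theorem card_roots_charpoly [IsAlgClosed k] (T : Module.End k V) :
    T.charpoly.roots.card = Module.finrank k V := by
  rw [← (IsAlgClosed.splits T.charpoly).natDegree_eq_card_roots, LinearMap.charpoly_natDegree]

theorem eq_one_of_trace_eq_finrank [IsAlgClosed k] {T : Module.End k V} {m : ℕ} (hm : 0 < m)
    (hT : T ^ m = 1) (htr : LinearMap.trace k V T = Module.finrank k V) : T = 1 := by
  have h1 : ∀ r ∈ T.charpoly.roots, r = 1 := by
    refine eq_one_of_sum_eq_card hm _ (fun r hr => pow_eq_one_of_mem_roots_charpoly hT hr) ?_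
    rw [← Module.End.trace_eq_sum_roots_charpoly_of_splits (IsAlgClosed.splits _), htr,
      card_roots_charpoly]
  have h2 : T.IsSemisimple := by
    refine Module.End.isSemisimple_of_squarefree_aeval_eq_zero (p := X ^ m - 1) ?_ (by simp [hT])
    have : NeZero (m : k) := ⟨by exact_mod_cast hm.ne'⟩
    exact (X_pow_sub_one_separable_iff.2 (NeZero.ne _)).squarefree
  have h3 := h2.isFinitelySemisimple.iSup_maxGenEigenspace_eq_top_iff.1
    (Module.End.iSup_maxGenEigenspace_eq_top T)
  have h4 : T.eigenspace 1 = ⊤ := by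
    rw [eq_top_iff, ← h3]
    refine iSup_le fun μ => ?_
    by_cases hμ : T.HasEigenvalue μ
    · have : μ ∈ T.charpoly.roots := by
        rw [mem_roots (LinearMap.charpoly_monic T).ne_zero]
        exact (T.hasEigenvalue_iff_isRoot_charpoly μ).1 hμ
      rw [h1 μ this]
    · rw [Module.End.hasEigenvalue_iff, not_not] at hμ
      rw [hμ]
      exact bot_le
  ext v
  have : v ∈ T.eigenspace 1 := h4 ▸ Submodule.mem_top
  simpa using Module.End.mem_eigenspace_iff.1 this

theorem trace_ne_zero_of_odd [IsAlgClosed k] {T : Module.End k V} {n : ℕ}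
    (hT : T ^ (2 ^ n) = 1) (hV : Odd (Module.finrank k V)) : LinearMap.trace k V T ≠ 0 := by
  rw [Module.End.trace_eq_sum_roots_charpoly_of_splits (IsAlgClosed.splits _)]
  exact sum_ne_zero_of_odd _ (fun r hr => pow_eq_one_of_mem_roots_charpoly hT hr)
    (by rwa [card_roots_charpoly])

/-- A representation whose nontrivial elements have trace zero has invariants of the expected
dimension. -/
theorem finrank_eq_card_mul_invariants {G : Type} [Group G] [Finite G] (ρ : Representation k G V)
    (h : ∀ g ≠ 1, LinearMap.trace k V (ρ g) = 0) :
    Module.finrank k V = Nat.card G * Module.finrank k ρ.invariants := by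
  have := Fintype.ofFinite G
  have hG : (Nat.card G : k) ≠ 0 := by exact_mod_cast Nat.card_pos.ne'
  have : Invertible (Nat.card G : k) := invertibleOfNonzero hG
  have h1 := ρ.card_inv_mul_sum_char_eq_finrank
  rw [show ∑ g : G, ρ.character g = ρ.character 1 from
    Finset.sum_eq_single 1 (fun g _ hg => h g hg) (by simp)] at h1
  simp only [Representation.char_one] at h1
  have h2 : (Module.finrank k V : k) = Nat.card G * Module.finrank k ρ.invariants := by
    rw [← h1]; field_simp
  exact_mod_cast h2

end RootsOfUnity

section NicholsZoeller

variable {k : Type} [Field k] [CharZero k] [IsAlgClosed k] {H : Type} [Ring H] [HopfAlgebra k H]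
  [FiniteDimensional k H]

/-- The map `h ⊗ x ↦ h x₁ ⊗ x₂`. -/
noncomputable def canon (k H : Type) [Field k] [Ring H] [HopfAlgebra k H] :
    H ⊗[k] H →ₗ[k] H ⊗[k] H :=
  (show Bil k (fun h x : H => sw k x (fun a b => (h * a) ⊗ₜ[k] b)) from
    ⟨fun _ => by fun_prop, fun _ => by fun_prop⟩).lift

theorem canon_tmul (h x : H) :
    canon k H (h ⊗ₜ[k] x) = sw k x (fun a b => (h * a) ⊗ₜ[k] b) := rfl

theorem canon_injective : Function.Injective (canon k H) := by
  have hb : Bil k (fun h x : H => sw k x (fun a b => (h * antipode k a) ⊗ₜ[k] b)) :=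
    ⟨fun _ => by fun_prop, fun _ => by fun_prop⟩
  have : hb.lift ∘ₗ canon k H = LinearMap.id := by
    ext h x
    simp only [TensorProduct.AlgebraTensorModule.curry_apply, LinearMap.restrictScalars_self,
      TensorProduct.curry_apply, LinearMap.coe_comp, Function.comp_apply, LinearMap.id_apply]
    rw [canon_tmul, linearMap_sw]
    simp only [Bil.lift_tmul]
    rw [← sw_assoc (f := fun a c d => (h * a * antipode k c) ⊗ₜ[k] d)]
    · rw [← sw_counit_left (f := fun d => h ⊗ₜ[k] d) (by fun_prop)]
      refine sw_congr fun y d => ?_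
      have := map_sw (f := fun a c => a * antipode k c) (g := fun t => (h * t) ⊗ₜ[k] d)
        (by fun_prop) y
      simp only [← mul_assoc] at this
      rw [← this, sw_mul_antipode]
      simp [TensorProduct.smul_tmul]
    · refine ⟨?_, ?_, ?_⟩ <;> intros <;> fun_prop
  exact Function.LeftInverse.injective (g := hb.lift) fun t => LinearMap.congr_fun this t

theorem trace_eq_of_comp {V : Type} [AddCommGroup V] [Module k V] [FiniteDimensional k V]
    {F S T : Module.End k V} (hF : Function.Injective F) (h : S * F = F * T) :
    LinearMap.trace k V S = LinearMap.trace k V T := by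
  let e := LinearEquiv.ofInjectiveEndo F hF
  have h1 : S = e.conj T := by
    ext v
    obtain ⟨w, rfl⟩ := e.surjective v
    rw [LinearEquiv.conj_apply_apply, LinearEquiv.symm_apply_apply]
    exact LinearMap.congr_fun h w
  rw [h1, LinearMap.trace_conj']

theorem trace_mulRight_mul_trace {M : Type} [AddCommGroup M] [Module k M] [FiniteDimensional k M]
    (ι : M →ₗ[k] H) (hι : Function.Injective ι) (δ : M →ₗ[k] H ⊗[k] M)
    (hδ : ∀ m, ι.lTensor H (δ m) = comul (R := k) (ι m)) {g : H} (hg : IsGroupLikeElem k g)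
    (r : Module.End k M) (hr : ∀ m, ι (r m) = ι m * g) :
    LinearMap.trace k H (LinearMap.mulRight k g) * LinearMap.trace k M r =
      Module.finrank k H * LinearMap.trace k M r := by
  have hb : Bil k (fun (h : H) (m : M) => (LinearMap.mulLeft k h).rTensor M (δ m)) := by
    refine ⟨fun m => ?_, fun _ => by fun_prop⟩
    change Lin k (fun h => (LinearMap.mulLeft k h).rTensor M (δ m))
    generalize δ m = t
    induction t using TensorProduct.induction_on with
    | zero => exact ⟨fun _ _ => by simp, fun _ _ => by simp⟩
    | tmul x y =>
      exact ⟨fun a b => by simp [add_mul, TensorProduct.add_tmul],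
        fun c a => by simp [TensorProduct.smul_tmul']⟩
    | add s t hs ht =>
      exact ⟨fun x y => by
          have := hs.map_add x y
          have := ht.map_add x y
          simp only [map_add] at *
          simp_all only
          abel,
        fun c x => by
          have := hs.map_smul c x
          have := ht.map_smul c x
          simp only [map_add] at *
          simp_all⟩
  have hinj : Function.Injective (ι.lTensor H) := Module.Flat.lTensor_preserves_injective_linearMap _ hι
  have key : ∀ h m, ι.lTensor H (hb.lift (h ⊗ₜ m)) = canon k H (h ⊗ₜ ι m) := by
    intro h m
    rw [Bil.lift_tmul, ← LinearMap.comp_apply, LinearMap.lTensor_comp_rTensor,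
      ← LinearMap.rTensor_comp_lTensor, LinearMap.comp_apply, hδ, canon_tmul,
      ← (Coalgebra.Repr.arbitrary k (ι m)).eq]
    simp [sw]
  have key' : ι.lTensor H ∘ₗ hb.lift = canon k H ∘ₗ ι.lTensor H := by
    ext h m
    simpa using key h m
  have hFi : Function.Injective hb.lift := by
    have : Function.Injective (ι.lTensor H ∘ₗ hb.lift) := by
      rw [key']
      exact canon_injective.comp hinj
    exact Function.Injective.of_comp this
  have h1 : (TensorProduct.map (LinearMap.mulRight k g) r : Module.End k (H ⊗[k] M)) *
      hb.lift = hb.lift * TensorProduct.map 1 r := by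
    apply LinearMap.ext fun t => hinj ?_
    induction t using TensorProduct.induction_on with
    | zero => simp
    | add s t hs ht => simp only [map_add, hs, ht]
    | tmul h m =>
      have h2 : ι.lTensor H ∘ₗ TensorProduct.map (LinearMap.mulRight k g) r =
          TensorProduct.map (LinearMap.mulRight k g) (LinearMap.mulRight k g) ∘ₗ ι.lTensor H := by
        ext h m
        simp [hr]
      rw [Module.End.mul_apply, ← LinearMap.comp_apply (ι.lTensor H), h2, LinearMap.comp_apply, key,
        Module.End.mul_apply, TensorProduct.map_tmul, key, Module.End.one_apply, hr, canon_tmul,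
        canon_tmul, sw_mul (by constructor <;> intro <;> fun_prop), linearMap_sw]
      refine sw_congr fun a b => ?_
      rw [sw_eq_of_comul (by constructor <;> intro <;> fun_prop) hg.comul_eq_tmul_self]
      simp [mul_assoc]
  have h3 := trace_eq_of_comp hFi h1
  rw [LinearMap.trace_tensorProduct', LinearMap.trace_tensorProduct'] at h3
  rw [h3, LinearMap.trace_one]

instance : Finite (GroupLike k H) :=
  (linearIndep_groupLikeVal (R := k) (A := H)).finite

theorem mulRight_pow_card (g : GroupLike k H) :
    (LinearMap.mulRight k g.val) ^ (Nat.card (GroupLike k H)) = 1 := by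
  rw [LinearMap.pow_mulRight, ← GroupLike.val_pow, pow_card_eq_one']
  ext; simp

theorem finrank_pos_of_hopf : 0 < Module.finrank k H := by
  have : Nontrivial H := ⟨1, 0, fun h => by
    have := congrArg (counit (R := k)) h
    simp at this⟩
  exact Module.finrank_pos

theorem trace_mulRight_eq_zero {g : GroupLike k H} (hg : g ≠ 1) :
    LinearMap.trace k H (LinearMap.mulRight k g.val) = 0 := by
  have h := trace_mulRight_mul_trace (k := k) (LinearMap.id (M := H)) Function.injective_id
    (comul (R := k)) (by simp) g.2 (LinearMap.mulRight k g.val) (by simp)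
  by_contra h0
  have h1 := mul_right_cancel₀ h0 h
  have h2 := eq_one_of_trace_eq_finrank Nat.card_pos (mulRight_pow_card g) h1
  apply hg
  ext
  simpa using LinearMap.congr_fun h2 1

theorem trace_eq_zero_of_coideal {M : Type} [AddCommGroup M] [Module k M] [FiniteDimensional k M]
    (ι : M →ₗ[k] H) (hι : Function.Injective ι) (δ : M →ₗ[k] H ⊗[k] M)
    (hδ : ∀ m, ι.lTensor H (δ m) = comul (R := k) (ι m)) {g : GroupLike k H} (hg : g ≠ 1)
    (r : Module.End k M) (hr : ∀ m, ι (r m) = ι m * g) : LinearMap.trace k M r = 0 := by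
  have h := trace_mulRight_mul_trace ι hι δ hδ g.2 r hr
  rw [trace_mulRight_eq_zero hg, zero_mul, eq_comm, mul_eq_zero] at h
  refine h.resolve_left ?_
  exact_mod_cast (finrank_pos_of_hopf (k := k) (H := H)).ne'

/-- Right translations by group-likes, as a representation. -/
noncomputable def rightRep (k H : Type) [Field k] [Ring H] [HopfAlgebra k H] :
    Representation k (GroupLike k H) H where
  toFun g := LinearMap.mulRight k (g⁻¹).val
  map_one' := by ext; simp [-GroupLike.val_inv]
  map_mul' g h := by ext; simp [-GroupLike.val_inv, mul_assoc, mul_inv_rev]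

theorem rightRep_apply (g : GroupLike k H) (x : H) : rightRep k H g x = x * (g⁻¹).val := rfl

theorem finrank_eq_card_mul_fixed : Module.finrank k H =
    Nat.card (GroupLike k H) * Module.finrank k (rightRep k H).invariants :=
  finrank_eq_card_mul_invariants _ fun _ hg => trace_mulRight_eq_zero (inv_ne_one.2 hg)

/-- The restriction of the translation representation to a stable subspace. -/
noncomputable def subRep (M : Submodule k H)
    (hM : ∀ g : GroupLike k H, ∀ x ∈ M, x * g.val ∈ M) : Representation k (GroupLike k H) M where
  toFun g := (rightRep k H g).restrict fun x hx => hM g⁻¹ x hx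
  map_one' := by ext; simp [LinearMap.restrict_apply]
  map_mul' g h := by ext x; exact LinearMap.congr_fun (map_mul (rightRep k H) g h) x.1

theorem card_dvd_finrank (M : Submodule k H) (hM : ∀ g : GroupLike k H, ∀ x ∈ M, x * g.val ∈ M)
    (hc : ∀ x ∈ M, comul (R := k) x ∈ LinearMap.range (TensorProduct.map M.subtype M.subtype)) :
    Nat.card (GroupLike k H) ∣ Module.finrank k M := by
  refine ⟨_, finrank_eq_card_mul_invariants (subRep M hM) fun g hg => ?_⟩
  have hinj : Function.Injective (M.subtype.lTensor H) :=
    Module.Flat.lTensor_preserves_injective_linearMap _ M.subtype_injective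
  have h1 : ∀ x : M, comul (R := k) x.1 ∈ LinearMap.range (M.subtype.lTensor H) := by
    intro x
    obtain ⟨t, ht⟩ := hc x.1 x.2
    refine ⟨M.subtype.rTensor M t, ?_⟩
    rw [← LinearMap.comp_apply, LinearMap.lTensor_comp_rTensor, ht]
  let δ : M →ₗ[k] H ⊗[k] M := (LinearEquiv.ofInjective _ hinj).symm.toLinearMap ∘ₗ
    (comul (R := k) ∘ₗ M.subtype).codRestrict _ h1
  refine trace_eq_zero_of_coideal M.subtype M.subtype_injective δ (fun m => ?_) (inv_ne_one.2 hg) _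
    fun m => rfl
  have := LinearEquiv.apply_symm_apply (LinearEquiv.ofInjective _ hinj)
    ((comul (R := k) ∘ₗ M.subtype).codRestrict _ h1 m)
  exact congrArg Subtype.val this

end NicholsZoeller

section Characters

variable {k : Type} [Field k] {H : Type} [Ring H] [HopfAlgebra k H]

/-- A functional that is an algebra map. -/
def IsChar (f : Du k H) : Prop := f 1 = 1 ∧ ∀ x y, f (x * y) = f x * f y

theorem IsChar.mul {f g : Du k H} (hf : IsChar f) (hg : IsChar g) : IsChar (f * g) := by
  refine ⟨?_, fun x y => ?_⟩
  · rw [du_mul_apply, sw_one (by constructor <;> intro <;> fun_prop), hf.1, hg.1, one_mul]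
  · simp only [du_mul_apply]
    rw [sw_mul (by constructor <;> intro <;> fun_prop), sw_mul_const]
    refine sw_congr fun a b => ?_
    rw [mul_sw]
    refine sw_congr fun c d => ?_
    rw [hf.2, hg.2]; ring

theorem isChar_one : IsChar (1 : Du k H) := ⟨by simp, by simp⟩

/-- The transpose of the antipode. -/
noncomputable def antiDual (f : Du k H) : Du k H := toConv (f.ofConv ∘ₗ antipode k)

theorem antiDual_apply (f : Du k H) (x : H) : antiDual f x = f (antipode k x) := rfl

theorem IsChar.mul_antiDual {f : Du k H} (hf : IsChar f) : f * antiDual f = 1 := by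
  refine du_ext fun x => ?_
  rw [du_mul_apply]
  simp only [antiDual_apply, ← hf.2]
  rw [← map_sw (g := fun z => f z) (by fun_prop), sw_mul_antipode, map_smul, hf.1, du_one_apply]
  simp

theorem IsChar.antiDual_mul {f : Du k H} (hf : IsChar f) : antiDual f * f = 1 := by
  refine du_ext fun x => ?_
  rw [du_mul_apply]
  simp only [antiDual_apply, ← hf.2]
  rw [← map_sw (g := fun z => f z) (by fun_prop), sw_antipode_mul, map_smul, hf.1, du_one_apply]
  simp

theorem IsChar.antiDual {f : Du k H} (hf : IsChar f) : IsChar (antiDual f) :=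
  ⟨by simp [antiDual_apply, hf.1],
    fun x y => by simp [antiDual_apply, antipode_mul_antidistrib, hf.2, mul_comm]⟩

/-- The group of algebra maps to the base field. -/
noncomputable def charGroup (k H : Type) [Field k] [Ring H] [HopfAlgebra k H] :
    Subgroup (Du k H)ˣ where
  carrier := {u | IsChar u.val}
  one_mem' := isChar_one
  mul_mem' := fun hu hv => hu.mul hv
  inv_mem' := by
    intro u hu
    have : (u⁻¹).val = Hopf4p.antiDual u.val := by
      rw [Units.inv_eq_of_mul_eq_one_right (IsChar.mul_antiDual hu)]
    simpa [this] using IsChar.antiDual hu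

theorem lact_mul_of_isChar {f : Du k H} (hf : IsChar f) (x y : H) :
    lact f (x * y) = lact f x * lact f y := by
  simp only [lact_apply]
  rw [sw_mul (by constructor <;> intro <;> fun_prop), sw_mul_const]
  refine sw_congr fun a b => ?_
  rw [mul_sw]
  refine sw_congr fun c d => ?_
  rw [hf.2, smul_mul_smul_comm]

theorem ract_mul_of_isChar {f : Du k H} (hf : IsChar f) (x y : H) :
    ract f (x * y) = ract f x * ract f y := by
  simp only [ract_apply]
  rw [sw_mul (by constructor <;> intro <;> fun_prop), sw_mul_const]
  refine sw_congr fun a b => ?_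
  rw [mul_sw]
  refine sw_congr fun c d => ?_
  rw [hf.2, smul_mul_smul_comm]

theorem lact_groupLike (β : Du k H) (g : GroupLike k H) : lact β g.val = β g.val • g.val := by
  rw [lact_apply]
  exact sw_eq_of_comul (f := fun a b => β a • b) (by constructor <;> intro <;> fun_prop)
    g.2.comul_eq_tmul_self

theorem ract_groupLike (β : Du k H) (g : GroupLike k H) : ract β g.val = β g.val • g.val := by
  rw [ract_apply]
  exact sw_eq_of_comul (f := fun a b => β b • a) (by constructor <;> intro <;> fun_prop)
    g.2.comul_eq_tmul_self

theorem lact_injective {f g : Du k H} (h : lact f = lact g) : f = g :=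
  du_ext fun x => by rw [← counit_lact, h, counit_lact]

theorem lact_pow (f : Du k H) (n : ℕ) : lact (f ^ n) = lact f ^ n := by
  induction n with
  | zero => simp [lact_one]
  | succ n ih => rw [pow_succ, lact_mul, ih, pow_succ']

theorem ract_pow (f : Du k H) (n : ℕ) : ract (f ^ n) = ract f ^ n := by
  induction n with
  | zero => simp [ract_one]
  | succ n ih => rw [pow_succ, ract_mul, ih, pow_succ]

variable [CharZero k] [IsAlgClosed k] [FiniteDimensional k H]

instance : Finite (charGroup k H) := by
  let φ : charGroup k H → (H →* k) := fun u => ⟨⟨fun x => u.1.val x, u.2.1⟩, u.2.2⟩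
  have hφ : Function.Injective φ := by
    intro u v h
    refine Subtype.ext (Units.ext (du_ext fun x => ?_))
    exact DFunLike.congr_fun h x
  have h1 := (linearIndependent_monoidHom H k).comp φ hφ
  let F : Du k H →ₗ[k] (H → k) :=
    ⟨⟨fun f x => f x, fun _ _ => rfl⟩, fun _ _ => rfl⟩
  have h2 : LinearIndependent k (fun u : charGroup k H => u.1.val) :=
    LinearIndependent.of_comp F h1
  have : FiniteDimensional k (Du k H) := (WithConv.linearEquiv k (H →ₗ[k] k)).symm.finiteDimensional
  exact h2.finite

theorem trace_lact_mul_trace {f : Du k H} (hf : IsChar f) :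
    LinearMap.trace k H (lact f) * LinearMap.trace k H (lact f) =
      Module.finrank k H * LinearMap.trace k H (lact f) := by
  have h1 : (TensorProduct.map (lact f) 1 : Module.End k (H ⊗[k] H)) * canon k H =
      canon k H * TensorProduct.map (lact f) (lact f) := by
    refine TensorProduct.ext' fun h x => ?_
    rw [Module.End.mul_apply, Module.End.mul_apply, TensorProduct.map_tmul, canon_tmul, canon_tmul,
      linearMap_sw, sw_lact' (by constructor <;> intro <;> fun_prop)]
    exact sw_congr fun a b => by simp [lact_mul_of_isChar hf]
  have h3 := trace_eq_of_comp canon_injective h1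
  rw [LinearMap.trace_tensorProduct', LinearMap.trace_tensorProduct', LinearMap.trace_one] at h3
  rw [← h3, mul_comm]

theorem trace_lact_eq_zero {u : charGroup k H} (hu : u ≠ 1) :
    LinearMap.trace k H (lact u.1.val) = 0 := by
  by_contra h0
  have h1 := mul_right_cancel₀ h0 (trace_lact_mul_trace u.2)
  have h2 : lact u.1.val = 1 := by
    refine eq_one_of_trace_eq_finrank (m := Nat.card (charGroup k H)) Nat.card_pos ?_ h1
    rw [← lact_pow, ← Units.val_pow_eq_pow_val, ← SubmonoidClass.coe_pow, pow_card_eq_one']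
    exact lact_one
  apply hu
  exact Subtype.ext (Units.ext (lact_injective (h2.trans lact_one.symm)))

/-- The left translations by a group of characters, as a representation. -/
noncomputable def charRep (L : Subgroup (charGroup k H)) : Representation k L H where
  toFun u := lact (u⁻¹).1.1.val
  map_one' := by simp [lact_one]
  map_mul' u v := by simp [mul_inv_rev, lact_mul]

theorem charRep_apply (L : Subgroup (charGroup k H)) (u : L) : charRep L u = lact (u⁻¹).1.1.val :=
  rfl

theorem finrank_eq_card_mul_charRep (L : Subgroup (charGroup k H)) :
    Module.finrank k H = Nat.card L * Module.finrank k (charRep L).invariants :=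
  finrank_eq_card_mul_invariants _ fun u hu => trace_lact_eq_zero (by simpa using hu)

end Characters

section Integrals

variable {k : Type} [Field k] {H : Type} [Ring H] [HopfAlgebra k H]

theorem sw_lin_antipode_mul {M : Type} [AddCommGroup M] [Module k M] {Φ : H → M} (hΦ : Lin k Φ)
    (x : H) : sw k x (fun a b => Φ (antipode k a * b)) = counit (R := k) x • Φ 1 := by
  rw [← map_sw hΦ, sw_antipode_mul, hΦ.map_smul]

theorem sw_lin_mul_antipode {M : Type} [AddCommGroup M] [Module k M] {Φ : H → M} (hΦ : Lin k Φ)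
    (x : H) : sw k x (fun a b => Φ (a * antipode k b)) = counit (R := k) x • Φ 1 := by
  rw [← map_sw hΦ, sw_mul_antipode, hΦ.map_smul]

/-- `Λ` is a left integral of `H`. -/
def IsLeftInt (k : Type) [Field k] {H : Type} [Ring H] [HopfAlgebra k H] (Λ : H) : Prop :=
  ∀ y : H, y * Λ = counit (R := k) y • Λ

/-- `f` is a right integral on `H`. -/
def IsRightInt (f : Du k H) : Prop := ∀ x : H, lact f x = f x • (1 : H)

theorem IsLeftInt.sw_eq {Λ : H} (hΛ : IsLeftInt k Λ) (y : H) {M : Type} [AddCommGroup M]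
    [Module k M] {f : H → H → M} (hf : Bil k f) :
    sw k Λ (fun a b => f a (antipode k b * y)) = sw k Λ (fun a b => f (y * a) (antipode k b)) := by
  obtain ⟨h1, h2⟩ := hf
  have h3 : sw k y (fun u v => sw k (u * Λ) (fun a b => f a (antipode k b * v))) =
      sw k Λ (fun a b => f a (antipode k b * y)) := by
    rw [← sw_counit_left (k := k) (f := fun y => sw k Λ (fun a b => f a (antipode k b * y)))
      (by fun_prop)]
    refine sw_congr fun u v => ?_
    have h4 : Lin k (fun z => sw k z (fun a b => f a (antipode k b * v))) := by fun_prop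
    rw [hΛ, h4.map_smul]
  rw [← h3]
  have h5 : ∀ u v, sw k (u * Λ) (fun a b => f a (antipode k b * v)) =
      sw k u (fun s t => sw k Λ (fun a b => f (s * a) (antipode k b * (antipode k t * v)))) := by
    intro u v
    rw [sw_mul (by constructor <;> intro <;> fun_prop)]
    simp only [antipode_mul_antidistrib, mul_assoc]
  simp only [h5]
  rw [sw_assoc (f := fun s t v => sw k Λ (fun a b => f (s * a) (antipode k b * (antipode k t * v))))]
  · rw [← sw_counit_right (k := k) (f := fun y => sw k Λ (fun a b => f (y * a) (antipode k b)))
      (by fun_prop) y]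
    refine sw_congr fun s w => ?_
    rw [sw_lin_antipode_mul (Φ := fun z => sw k Λ (fun a b => f (s * a) (antipode k b * z)))
      (by fun_prop)]
    simp only [mul_one]
  · refine ⟨?_, ?_, ?_⟩ <;> intros <;> fun_prop

/-- A left integral with nonzero counit makes the algebra semisimple. -/
theorem IsLeftInt.isSemisimpleRing {Λ : H} (hΛ : IsLeftInt k Λ) (h0 : counit (R := k) Λ ≠ 0) :
    IsSemisimpleRing H := by
  refine (isSemisimpleModule_iff H H).2 ⟨fun N => ?_⟩
  obtain ⟨q, hq⟩ := (N.restrictScalars k).subtype.exists_leftInverse_of_injective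
    (LinearMap.ker_eq_bot.2 (N.restrictScalars k).subtype_injective)
  have hq' : ∀ x ∈ N, (q x : H) = x := fun x hx => congrArg Subtype.val (LinearMap.congr_fun hq ⟨x, hx⟩)
  let π : H →ₗ[k] H := (N.restrictScalars k).subtype ∘ₗ q
  have hπ : ∀ x, π x ∈ N := fun x => (q x).2
  have hN : ∀ m, sw k Λ (fun a b => a * π (antipode k b * m)) ∈ N := fun m =>
    Submodule.sum_mem _ fun i _ => N.smul_mem _ (hπ _)
  let E : H →ₗ[H] N :=
    { toFun := fun m => ⟨(counit (R := k) Λ)⁻¹ • sw k Λ (fun a b => a * π (antipode k b * m)),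
        (N.restrictScalars k).smul_mem _ (hN m)⟩
      map_add' := fun x y => Subtype.ext (by
        have h : Lin k (fun m => (counit (R := k) Λ)⁻¹ • sw k Λ
          (fun a b => a * π (antipode k b * m))) := by fun_prop
        exact h.map_add x y)
      map_smul' := fun y m => Subtype.ext (by
        have h := hΛ.sw_eq y (f := fun a b => a * π (b * m))
          (by constructor <;> intro <;> fun_prop)
        simp only [smul_eq_mul, RingHom.id_apply, ← mul_assoc] at h ⊢
        rw [h]
        simp only [Submodule.coe_smul, smul_eq_mul, mul_smul_comm, mul_sw, mul_assoc]) }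
  have hE : ∀ x : N, E x = x := by
    intro x
    refine Subtype.ext ?_
    have : ∀ a b, a * π (antipode k b * x) = a * antipode k b * x := fun a b => by
      rw [mul_assoc]; exact congrArg _ (hq' _ (N.smul_mem _ x.2))
    change (counit (R := k) Λ)⁻¹ • sw k Λ (fun a b => a * π (antipode k b * x)) = x
    simp only [this]
    rw [← sw_mul_const, sw_mul_antipode, smul_mul_assoc, one_mul, smul_smul, inv_mul_cancel₀ h0,
      one_smul]
  exact ⟨LinearMap.ker E, LinearMap.isCompl_of_proj hE⟩

variable [FiniteDimensional k H]

/-- The trace of `x ↦ β(x₁) S²(x₂) h`. -/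
noncomputable def trF (β : Du k H) (h : H) : k :=
  LinearMap.trace k H (LinearMap.mulRight k h * (antipodeSq k H).toLinearMap * lact β)

/-- The functional `x ↦ β (y x)`. -/
noncomputable def shiftL (y : H) (β : Du k H) : Du k H :=
  toConv (β.ofConv ∘ₗ LinearMap.mulLeft k y)

omit [FiniteDimensional k H] in
theorem shiftL_apply (y : H) (β : Du k H) (x : H) : shiftL y β x = β (y * x) := rfl

theorem trace_sum_mul {ι : Type} (s : Finset ι) (F : Module.End k H) (A B : ι → Module.End k H) :
    LinearMap.trace k H (∑ i ∈ s, A i * F * B i) =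
      LinearMap.trace k H (F * ∑ i ∈ s, B i * A i) := by
  rw [Finset.mul_sum, map_sum, map_sum]
  refine Finset.sum_congr rfl fun i _ => ?_
  rw [mul_assoc, LinearMap.trace_mul_comm, mul_assoc]

theorem trF_shiftL (y : H) (β : Du k H) (h : H) :
    trF (shiftL y β) h = counit (R := k) y * trF β h := by
  let r := Coalgebra.Repr.arbitrary k y
  have h1 : LinearMap.mulRight k h * (antipodeSq k H).toLinearMap * lact (shiftL y β) =
      ∑ i ∈ r.index, LinearMap.mulLeft k (antipode k (r.right i)) *
        (LinearMap.mulRight k h * (antipodeSq k H).toLinearMap * lact β) *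
        LinearMap.mulLeft k (r.left i) := by
    ext x
    have : ∀ (β : Du k H) z, antipodeSq k H (lact β z) * h = sw k z (fun u v => β u • (antipodeSq k H v * h)) := by
      intro β z
      rw [lact_apply, map_sw (g := fun t => antipodeSq k H t * h) (by fun_prop)]
      exact sw_congr fun a b => by simp
    simp only [LinearMap.sum_apply, Module.End.mul_apply, LinearMap.mulLeft_apply,
      LinearMap.mulRight_apply, AlgHom.toLinearMap_apply]
    change _ = sw k y fun a b => antipode k b * (antipodeSq k H (lact β (a * x)) * h)
    simp only [this]
    have h2 : ∀ a b, antipode k b * (sw k (a * x) fun u v => β u • (antipodeSq k H v * h)) =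
        sw k a (fun s t => sw k x fun u v => β (s * u) •
          (antipode k (antipode k t * b) * (antipodeSq k H v * h))) := by
      intro a b
      rw [sw_mul (by constructor <;> intro <;> fun_prop), mul_sw]
      refine sw_congr fun s t => ?_
      rw [mul_sw]
      refine sw_congr fun u v => ?_
      rw [antipode_mul_antidistrib, map_mul (antipodeSq k H), antipodeSq_apply t]
      simp only [mul_smul_comm, mul_assoc]
    simp only [h2]
    rw [sw_assoc (f := fun s t b => sw k x fun u v => β (s * u) •
      (antipode k (antipode k t * b) * (antipodeSq k H v * h)))]
    · simp only [shiftL_apply]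
      rw [← sw_counit_right (k := k)
        (f := fun z => sw k x fun u v => β (z * u) • (antipodeSq k H v * h)) (by fun_prop) y]
      refine sw_congr fun s w => ?_
      rw [sw_lin_antipode_mul (Φ := fun z => sw k x fun u v => β (s * u) •
        (antipode k z * (antipodeSq k H v * h))) (by fun_prop)]
      simp only [antipode_one, one_mul]
    · refine ⟨?_, ?_, ?_⟩ <;> intros <;> fun_prop
  rw [trF, h1, trace_sum_mul]
  have h2 : ∑ i ∈ r.index, LinearMap.mulLeft k (r.left i) *
      LinearMap.mulLeft k (antipode k (r.right i)) =
      counit (R := k) y • (1 : Module.End k H) := by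
    ext x
    simp only [LinearMap.sum_apply, Module.End.mul_apply, LinearMap.mulLeft_apply, ← mul_assoc]
    rw [← Finset.sum_mul]
    change (sw k y fun a b => a * antipode k b) * x = _
    rw [sw_mul_antipode]; simp
  rw [h2, mul_smul_comm, mul_one, map_smul]; rfl

theorem sum_sw {ι : Type} (s : Finset ι) {M : Type} [AddCommGroup M] (x : H)
    (F : ι → H → H → M) : ∑ i ∈ s, sw k x (F i) = sw k x (fun a b => ∑ i ∈ s, F i a b) :=
  Finset.sum_comm

theorem sum_coord_smul {ι M : Type} [Fintype ι] [AddCommGroup M] [Module k M]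
    (b : Module.Basis ι k H) {Φ : H → M} (hΦ : Lin k Φ) (z : H) :
    ∑ i, b.coord i z • Φ (b i) = Φ z := by
  conv_rhs => rw [← b.sum_repr z, hΦ.map_sum]
  exact Finset.sum_congr rfl fun i _ => (hΦ.map_smul _ _).symm

theorem ract_antipode_mul {f : Du k H} {ι : Type} [Fintype ι] (b : Module.Basis ι k H) :
    ∑ i, ract (antiDual (toConv (b.coord i))) * ract (shiftL (b i) f) = f 1 • 1 := by
  ext x
  simp only [LinearMap.sum_apply, ← ract_mul]
  have h : ∀ i, ract (antiDual (toConv (b.coord i)) * shiftL (b i) f) x =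
      sw k x fun a c => sw k c fun u v => b.coord i (antipode k u) • f (b i * v) • a := by
    intro i
    rw [ract_apply]
    refine sw_congr fun a c => ?_
    rw [du_mul_apply, sw_smul]
    exact sw_congr fun u v => mul_smul _ _ _
  simp only [h, sum_sw]
  have h2 : ∀ a u v : H, ∑ i, b.coord i (antipode k u) • f (b i * v) • a =
      f (antipode k u * v) • a :=
    fun a u v => sum_coord_smul b (Φ := fun z => f (z * v) • a) (by fun_prop) _
  simp only [h2]
  have h3 : ∀ a c : H, (sw k c fun u v => f (antipode k u * v) • a) = counit (R := k) c • f 1 • a :=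
    fun a c => sw_lin_antipode_mul (Φ := fun z => f z • a) (by fun_prop) c
  simp only [h3]
  rw [sw_counit_right (k := k) (f := fun a => f 1 • a) (by fun_prop)]
  rfl

@[fun_prop]
theorem Lin.shiftL_apply {M : Type} [AddCommGroup M] [Module k M] (f : Du k H) {g : M → H}
    (hg : Lin k g) : Lin k (fun z => shiftL (g z) f) :=
  ⟨fun a b => du_ext fun x => by simp [Hopf4p.shiftL_apply, hg.map_add, add_mul],
    fun c a => du_ext fun x => by simp [Hopf4p.shiftL_apply, hg.map_smul]⟩

theorem isRightInt_trF (β : Du k H) (f : Du k H) (h : H) :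
    sw k h (fun u v => trF β u * f v) = trF β h * f 1 := by
  let b := Module.finBasis k H
  let r := Coalgebra.Repr.arbitrary k h
  have h1 : ∑ i ∈ r.index, f (r.right i) •
      (LinearMap.mulRight k (r.left i) * (antipodeSq k H).toLinearMap * lact β) =
      ∑ i, ract (shiftL (b i) f) *
        (LinearMap.mulRight k h * (antipodeSq k H).toLinearMap * lact β) *
        ract (antiDual (toConv (b.coord i))) := by
    ext x
    simp only [LinearMap.sum_apply, Module.End.mul_apply, LinearMap.mulRight_apply,
      AlgHom.toLinearMap_apply, LinearMap.smul_apply]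
    change (sw k h fun u v => f v • (antipodeSq k H (lact β x) * u)) = _
    have e1 : ∀ i, ract (shiftL (b i) f) (antipodeSq k H (lact β
        (ract (antiDual (toConv (b.coord i))) x)) * h) = sw k x fun a c =>
        b.coord i (antipode k c) • ract (shiftL (b i) f) (antipodeSq k H (lact β a) * h) := by
      intro i
      rw [ract_apply (antiDual _), map_sw (g := fun z => ract (shiftL (b i) f)
        (antipodeSq k H (lact β z) * h)) (by fun_prop)]
      refine sw_congr fun a c => ?_
      simp only [map_smul, smul_mul_assoc]
      rfl
    simp only [e1, sum_sw]
    have e2 : ∀ a c, ∑ i, b.coord i (antipode k c) • ract (shiftL (b i) f)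
        (antipodeSq k H (lact β a) * h) =
        sw k a fun p q => sw k h fun u v => f (antipode k (antipode k q * c) * v) •
          (antipodeSq k H (lact β p) * u) := by
      intro a c
      rw [sum_coord_smul b (Φ := fun z => ract (shiftL z f) (antipodeSq k H (lact β a) * h))
        (by fun_prop), ract_apply, sw_mul (by constructor <;> intro <;> fun_prop),
        sw_antipodeSq (by constructor <;> intro <;> fun_prop),
        sw_lact' (by constructor <;> intro <;> fun_prop)]
      refine sw_congr fun p q => sw_congr fun u v => ?_
      rw [antipode_mul_antidistrib, mul_assoc, antipodeSq_apply q]; rfl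
    simp only [e2]
    rw [sw_assoc (f := fun p q c => sw k h fun u v => f (antipode k (antipode k q * c) * v) •
          (antipodeSq k H (lact β p) * u))]
    · rw [← sw_counit_right (k := k)
        (f := fun z => sw k h fun u v => f v • (antipodeSq k H (lact β z) * u)) (by fun_prop) x]
      refine sw_congr fun s w => ?_
      rw [sw_lin_antipode_mul (Φ := fun z => sw k h fun u v => f (antipode k z * v) •
          (antipodeSq k H (lact β s) * u)) (by fun_prop)]
      simp only [antipode_one, one_mul]
    · refine ⟨?_, ?_, ?_⟩ <;> intros <;> fun_prop
  have h2 := congrArg (LinearMap.trace k H) h1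
  rw [trace_sum_mul, ract_antipode_mul, mul_smul_comm, mul_one, map_smul, map_sum] at h2
  simp only [map_smul, smul_eq_mul] at h2
  change sw k h (fun u v => f v * trF β u) = f 1 * trF β h at h2
  rw [mul_comm (trF β h), ← h2]
  exact sw_congr fun _ _ => mul_comm _ _

theorem sum_trF {ι : Type} [Fintype ι] (b : Module.Basis ι k H) (f : Du k H) (y : H) :
    ∑ i, trF (f * toConv (b.coord i)) (antipode k (b i) * y) = f y := by
  have h : ∑ i, LinearMap.mulRight k (antipode k (b i) * y) * (antipodeSq k H).toLinearMap *
      lact (f * toConv (b.coord i)) = f.ofConv.smulRight y := by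
    ext x
    simp only [LinearMap.sum_apply, Module.End.mul_apply, LinearMap.mulRight_apply,
      AlgHom.toLinearMap_apply, lact_mul]
    have e1 : ∀ i, antipodeSq k H (lact (toConv (b.coord i)) (lact f x)) *
        (antipode k (b i) * y) = sw k (lact f x) fun a c =>
        b.coord i a • (antipodeSq k H c * (antipode k (b i) * y)) := by
      intro i
      rw [lact_apply _ (lact f x), map_sw (g := fun z => antipodeSq k H z *
        (antipode k (b i) * y)) (by fun_prop)]
      refine sw_congr fun a c => ?_
      simp only [map_smul, smul_mul_assoc]
    simp only [e1, sum_sw]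
    have e2 : ∀ a c, ∑ i, b.coord i a • (antipodeSq k H c * (antipode k (b i) * y)) =
        antipode k (a * antipode k c) * y := by
      intro a c
      rw [sum_coord_smul b (Φ := fun z => antipodeSq k H c * (antipode k z * y)) (by fun_prop),
        antipode_mul_antidistrib, mul_assoc]
      rfl
    simp only [e2]
    rw [sw_lin_mul_antipode (Φ := fun z => antipode k z * y) (by fun_prop), counit_lact]
    simp
  have h2 := congrArg (LinearMap.trace k H) h
  rw [map_sum, LinearMap.trace_smulRight] at h2
  exact h2

theorem trF_add (β γ : Du k H) (h : H) : trF (β + γ) h = trF β h + trF γ h := by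
  have : lact (β + γ) = lact β + lact γ := LinearMap.ext fun x =>
    (by fun_prop : Lin k fun β => lact β x).map_add β γ
  simp only [trF, this, mul_add, map_add]

theorem trF_smul (c : k) (β : Du k H) (h : H) : trF (c • β) h = c * trF β h := by
  have : lact (c • β) = c • lact β := LinearMap.ext fun x =>
    (by fun_prop : Lin k fun β => lact β x).map_smul c β
  simp only [trF, this, mul_smul_comm, map_smul, smul_eq_mul]

theorem lin_trF (β : Du k H) : Lin k (fun h => trF β h) := by
  refine ⟨fun x y => ?_, fun c x => ?_⟩
  · have : LinearMap.mulRight k (x + y) = LinearMap.mulRight k x + LinearMap.mulRight k y := by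
      ext; simp [mul_add]
    simp only [trF, this, add_mul, map_add]
  · have : LinearMap.mulRight k (c • x) = c • LinearMap.mulRight k x := by
      ext; simp
    simp only [trF, this, smul_mul_assoc, map_smul]

omit [FiniteDimensional k H] in
theorem eq_of_dual {x y : H} (h : ∀ f : Du k H, f x = f y) : x = y := by
  rw [← sub_eq_zero, ← Module.forall_dual_apply_eq_zero_iff k]
  intro f
  rw [map_sub, sub_eq_zero]
  exact h (toConv f)

theorem exists_trF_repr (h : H) : ∃ Λ : H, IsLeftInt k Λ ∧ ∀ β : Du k H, trF β h = β Λ := by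
  let φ : Module.Dual k (Module.Dual k H) :=
    ⟨⟨fun β => trF (toConv β) h, fun β γ => trF_add _ _ h⟩, fun c β => trF_smul _ _ h⟩
  have h1 : ∀ β : Du k H, trF β h = β ((Module.evalEquiv k H).symm φ) := by
    intro β
    exact (Module.apply_evalEquiv_symm_apply k H β.ofConv φ).symm
  refine ⟨_, fun y => ?_, h1⟩
  refine eq_of_dual (k := k) fun f => ?_
  have := trF_shiftL y f h
  rw [h1, h1] at this
  rw [map_smul]
  exact this

theorem isRightInt_trF' (β : Du k H) : IsRightInt (toConv (lin_trF β).toMap) := by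
  intro x
  refine eq_of_dual (k := k) fun f => ?_
  rw [lact_apply, linearMap_sw]
  simp only [map_smul, smul_eq_mul]
  exact isRightInt_trF β f x

/-- There are a left integral `Λ` in `H` and a right integral `f` on `H` with `f Λ = 1`. -/
theorem exists_integrals (k H : Type) [Field k] [Ring H] [HopfAlgebra k H]
    [FiniteDimensional k H] : ∃ (Λ : H) (f : Du k H), IsLeftInt k Λ ∧ IsRightInt f ∧ f Λ = 1 := by
  let b := Module.finBasis k H
  obtain ⟨β, h, hβ⟩ : ∃ (β : Du k H) (h : H), trF β h ≠ 0 := by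
    by_contra! h0
    have := sum_trF b (1 : Du k H) 1
    simp [h0] at this
  obtain ⟨Λ, hΛ, h1⟩ := exists_trF_repr (k := k) h
  have h2 : Λ ≠ 0 := by
    rintro rfl
    simp [h1] at hβ
  obtain ⟨f, hf⟩ := Module.Projective.exists_dual_eq_one k h2
  refine ⟨Λ, toConv (lin_trF (toConv f)).toMap, hΛ, isRightInt_trF' _, ?_⟩
  change trF (toConv f) Λ = 1
  obtain ⟨Λ', -, h3⟩ := exists_trF_repr (k := k) Λ
  rw [← hf]
  refine Eq.trans ?_ (sum_trF b (toConv f) Λ)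
  have h4 : ∀ i, trF (toConv f * toConv (b.coord i)) (antipode k (b i) * Λ) =
      sw k Λ' fun u v => b.coord i v • (counit (R := k) (b i) * f u) := by
    intro i
    rw [hΛ, (lin_trF _).map_smul, h3, du_mul_apply, counit_antipode, smul_sw]
    refine sw_congr fun u v => ?_
    simp only [smul_eq_mul]
    ring
  simp only [h4, sum_sw]
  have h5 : ∀ u v : H, ∑ i, b.coord i v • (counit (R := k) (b i) * f u) =
      counit (R := k) v • f u := fun u v =>
    sum_coord_smul b (Φ := fun z => counit (R := k) z * f u) (by fun_prop) v
  simp only [h5]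
  rw [sw_counit_right (k := k) (f := fun u => f u) (by fun_prop), h3]

/-- For a non-semisimple Hopf algebra the trace functional vanishes on characters. -/
theorem trF_eq_zero_of_isChar (hns : ¬ IsSemisimpleRing H) {β : Du k H} (hβ : IsChar β) (h : H) :
    trF β h = 0 := by
  obtain ⟨Λ, hΛ, h1⟩ := exists_trF_repr (k := k) h
  by_cases hε : β = 1
  · rw [h1, hε]
    by_contra h0
    exact hns (hΛ.isSemisimpleRing h0)
  · by_contra h0
    refine hε (du_ext fun y => mul_right_cancel₀ h0 ?_)
    rw [du_one_apply, ← trF_shiftL, h1, h1, shiftL_apply, hβ.2]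

end Integrals

section Radford

variable {k : Type} [Field k] {H : Type} [Ring H] [HopfAlgebra k H]

theorem comul_eq_sw (x : H) : comul (R := k) x = sw k x (fun a b => a ⊗ₜ[k] b) :=
  (Coalgebra.Repr.arbitrary k x).eq.symm

theorem IsRightInt.sw_eq {f : Du k H} (hf : IsRightInt f) (x y : H) :
    sw k x (fun a b => f (a * y) • b) = sw k y (fun a b => f (x * a) • antipode k b) := by
  rw [← sw_counit_right (k := k) (f := fun y => sw k x (fun a b => f (a * y) • b)) (by fun_prop) y]
  have h1 : ∀ u v, counit (R := k) v • sw k x (fun a b => f (a * u) • b) =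
      sw k v (fun s t => sw k x (fun a b => f (a * u) • (b * (s * antipode k t)))) := by
    intro u v
    rw [sw_lin_mul_antipode (Φ := fun z => sw k x (fun a b => f (a * u) • (b * z))) (by fun_prop)]
    simp only [mul_one]
  simp only [h1]
  rw [← sw_assoc (f := fun u s t => sw k x (fun a b => f (a * u) • (b * (s * antipode k t))))]
  · refine sw_congr fun u t => ?_
    have h2 : ∀ z, sw k z (fun a b => f a • (b * antipode k t)) = f z • antipode k t := by
      intro z
      have := congrArg (· * antipode k t) (hf z)
      simp only [lact_apply, sw_mul_const, smul_mul_assoc, one_mul] at this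
      exact this
    rw [← h2, sw_mul (by constructor <;> intro <;> fun_prop), sw_comm]
    simp only [mul_assoc]
  · refine ⟨?_, ?_, ?_⟩ <;> intros <;> fun_prop

variable {Λ : H} {f : Du k H}

theorem IsLeftInt.recover (hΛ : IsLeftInt k Λ) (hf : IsRightInt f) (x : H) :
    sw k Λ (fun a b => f (x * a) • antipode k b) = f Λ • x := by
  rw [← hf.sw_eq]
  simp only [hΛ _, map_smul, smul_eq_mul, mul_smul]
  rw [sw_counit_left (k := k) (f := fun b => f Λ • b) (by fun_prop)]

theorem eq_zero_of_apply_mul_left (hΛ : IsLeftInt k Λ) (hf : IsRightInt f) (h1 : f Λ = 1) {x : H}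
    (hx : ∀ y, f (x * y) = 0) : x = 0 := by
  have := hΛ.recover hf x
  simpa [hx, h1, sw] using this.symm

variable [FiniteDimensional k H]

theorem antipode_bijective : Function.Bijective (antipode k : H →ₗ[k] H) := by
  obtain ⟨Λ, f, hΛ, hf, h1⟩ := exists_integrals k H
  have : Function.Surjective (antipode k : H →ₗ[k] H) := by
    intro x
    have := hΛ.recover hf x
    rw [h1, one_smul] at this
    rw [← this]
    refine ⟨sw k Λ fun a b => f (x * a) • b, ?_⟩
    rw [linearMap_sw]
    simp
  exact ⟨LinearMap.injective_iff_surjective.2 this, this⟩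

theorem finrank_du : Module.finrank k (Du k H) = Module.finrank k H := by
  rw [(WithConv.linearEquiv k (H →ₗ[k] k)).finrank_eq]
  exact Subspace.dual_finrank_eq

instance : FiniteDimensional k (Du k H) :=
  (WithConv.linearEquiv k (H →ₗ[k] k)).symm.finiteDimensional

theorem exists_shiftL_eq (hΛ : IsLeftInt k Λ) (hf : IsRightInt f) (h1 : f Λ = 1) (g : Du k H) :
    ∃ x, ∀ y, f (x * y) = g y := by
  let F : H →ₗ[k] Du k H := (by fun_prop : Lin k fun x => shiftL x f).toMap
  have hF : Function.Injective F := by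
    refine (injective_iff_map_eq_zero F).2 fun x hx => ?_
    refine eq_zero_of_apply_mul_left hΛ hf h1 fun y => ?_
    exact congrArg (fun t : Du k H => t y) hx
  obtain ⟨x, hx⟩ := (LinearMap.injective_iff_surjective_of_finrank_eq_finrank finrank_du.symm).1 hF g
  exact ⟨x, fun y => congrArg (fun t : Du k H => t y) hx⟩

theorem eq_zero_of_apply_mul_right (hΛ : IsLeftInt k Λ) (hf : IsRightInt f) (h1 : f Λ = 1) {x : H}
    (hx : ∀ y, f (y * x) = 0) : x = 0 := by
  refine eq_of_dual (k := k) fun g => ?_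
  obtain ⟨y, hy⟩ := exists_shiftL_eq hΛ hf h1 g
  rw [← hy, hx, map_zero]

theorem exists_shiftR_eq (hΛ : IsLeftInt k Λ) (hf : IsRightInt f) (h1 : f Λ = 1) (g : Du k H) :
    ∃ x, ∀ y, f (y * x) = g y := by
  let F : H →ₗ[k] Du k H :=
    { toFun := fun x => toConv (f.ofConv ∘ₗ LinearMap.mulRight k x)
      map_add' := fun x y => du_ext fun z => by simp [mul_add]
      map_smul' := fun x y => du_ext fun z => by simp }
  have hF : Function.Injective F := by
    refine (injective_iff_map_eq_zero F).2 fun x hx => ?_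
    refine eq_zero_of_apply_mul_right hΛ hf h1 fun y => ?_
    exact congrArg (fun t : Du k H => t y) hx
  obtain ⟨x, hx⟩ := (LinearMap.injective_iff_surjective_of_finrank_eq_finrank finrank_du.symm).1 hF g
  exact ⟨x, fun y => congrArg (fun t : Du k H => t y) hx⟩

theorem IsLeftInt.unique (hΛ : IsLeftInt k Λ) (hf : IsRightInt f) (h1 : f Λ = 1) {Λ' : H}
    (hΛ' : IsLeftInt k Λ') : Λ' = f Λ' • Λ := by
  rw [← sub_eq_zero]
  refine eq_zero_of_apply_mul_right hΛ hf h1 fun y => ?_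
  rw [mul_sub, map_sub, mul_smul_comm, hΛ, hΛ']
  simp [h1, mul_comm]

theorem IsRightInt.unique (hΛ : IsLeftInt k Λ) (hf : IsRightInt f) (h1 : f Λ = 1) {f' : Du k H}
    (hf' : IsRightInt f') (x : H) : f' x = f' Λ * f x := by
  obtain ⟨y, hy⟩ := exists_shiftL_eq hΛ hf h1 f'
  have e1 := hΛ.recover hf y
  have e2 := hΛ.recover hf' 1
  simp only [hy, one_mul] at e1 e2
  rw [e1, h1, one_smul] at e2
  rw [← hy, e2, smul_mul_assoc, one_mul, map_smul]; rfl

/-- The data of the distinguished character and the distinguished group-like element. -/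
theorem exists_distinguished (hΛ : IsLeftInt k Λ) (hf : IsRightInt f) (h1 : f Λ = 1) :
    ∃ (α : charGroup k H) (g : GroupLike k H), (∀ y, f (Λ * y) = α.1.val y) ∧
      ∀ x, ract f x = f x • g.val := by
  let A : Du k H := toConv (f.ofConv ∘ₗ LinearMap.mulLeft k Λ)
  have hA : ∀ y, A y = f (Λ * y) := fun _ => rfl
  have hΛy : ∀ y, Λ * y = f (Λ * y) • Λ := fun y =>
    hΛ.unique hf h1 fun z => by rw [← mul_assoc, hΛ, smul_mul_assoc]
  have hA' : IsChar A := by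
    refine ⟨by rw [hA, mul_one, h1], fun x y => ?_⟩
    rw [hA, ← mul_assoc, hΛy x, smul_mul_assoc, map_smul, hA, hA, smul_eq_mul]
  let g := ract f Λ
  have hr : ∀ x, ract f x = f x • g := by
    intro x
    refine eq_of_dual (k := k) fun h => ?_
    have : IsRightInt (h * f) := by
      intro z
      rw [lact_mul, Module.End.mul_apply, hf, ← apply_lact]
    rw [apply_ract, IsRightInt.unique hΛ hf h1 this x, map_smul, smul_eq_mul, mul_comm]
    exact congrArg _ (apply_ract h f Λ).symm
  have hg : IsGroupLikeElem k g := by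
    refine ⟨by rw [counit_ract, h1], ?_⟩
    rw [comul_eq_sw, sw_ract' (by constructor <;> intro <;> fun_prop)]
    simp only [hr, TensorProduct.tmul_smul, TensorProduct.smul_tmul']
    rw [← map_sw (f := fun a b => f b • a) (g := fun t => t ⊗ₜ[k] g) (by fun_prop)]
    rfl
  exact ⟨⟨⟨A, antiDual A, hA'.mul_antiDual, hA'.antiDual_mul⟩, hA'⟩, ⟨g, hg⟩, fun _ => rfl, hr⟩

theorem sw_smul_mul {g : GroupLike k H} (hg : ∀ x, ract f x = f x • g.val) (x y : H) :
    sw k x (fun a b => f (b * y) • (antipode k a * g.val)) = sw k y (fun a b => f (x * b) • a) := by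
  have e1 : ∀ z, ract f z = f z • g.val := hg
  rw [← sw_counit_left (k := k) (f := fun x => sw k y (fun a b => f (x * b) • a)) (by fun_prop) x]
  have e2 : ∀ u v, counit (R := k) u • sw k y (fun a b => f (v * b) • a) =
      sw k u (fun s t => sw k y (fun a b => f (v * b) • (antipode k s * t * a))) := by
    intro u v
    rw [sw_lin_antipode_mul (Φ := fun z => sw k y (fun a b => f (v * b) • (z * a))) (by fun_prop)]
    simp only [one_mul]
  simp only [e2]
  rw [sw_assoc (f := fun s t v => sw k y (fun a b => f (v * b) • (antipode k s * t * a)))]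
  · refine sw_congr fun s w => ?_
    have e3 : ∀ z, sw k z (fun a b => f b • (antipode k s * a)) = f z • (antipode k s * g.val) := by
      intro z
      have := congrArg (antipode k s * ·) (hg z)
      simp only [ract_apply, mul_sw, mul_smul_comm] at this
      exact this
    rw [← e3, sw_mul (by constructor <;> intro <;> fun_prop)]
    simp only [mul_assoc]
  · refine ⟨?_, ?_, ?_⟩ <;> intros <;> fun_prop

theorem sw_antipode_smul {g : GroupLike k H} (hg : ∀ x, ract f x = f x • g.val) (z y : H) :
    sw k z (fun a b => f (b * y) • antipode k a) =
      sw k y (fun a b => f (z * b) • (a * antipode k g.val)) := by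
  have e1 : ∀ a w, f w • (a * antipode k g.val) = sw k w (fun u v => f v • (a * antipode k u)) := by
    intro a w
    have := congrArg (fun t => a * antipode k t) (hg w)
    simp only [ract_apply, linearMap_sw, mul_sw, mul_smul_comm, map_smul] at this
    exact this.symm
  have e2 : ∀ a b, f (z * b) • (a * antipode k g.val) =
      sw k b (fun s t => sw k z (fun u v => f (v * t) • (a * antipode k s * antipode k u))) := by
    intro a b
    rw [e1, sw_mul (by constructor <;> intro <;> fun_prop), sw_comm]
    simp only [antipode_mul_antidistrib, mul_assoc]
  simp only [e2]
  rw [← sw_assoc (f := fun a s t => sw k z (fun u v => f (v * t) • (a * antipode k s * antipode k u)))]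
  · rw [← sw_counit_left (k := k) (f := fun y => sw k z (fun a b => f (b * y) • antipode k a))
      (by fun_prop) y]
    refine sw_congr fun s w => ?_
    rw [sw_lin_mul_antipode (Φ := fun q => sw k z (fun u v => f (v * w) • (q * antipode k u)))
      (by fun_prop)]
    simp only [one_mul]
  · refine ⟨?_, ?_, ?_⟩ <;> intros <;> fun_prop

theorem IsChar.apply_antipodeSq {α : Du k H} (hα : IsChar α) (y : H) :
    α (antipodeSq k H y) = α y := by
  have h3 := left_inv_eq_right_inv hα.mul_antiDual hα.antiDual.mul_antiDual
  exact congrArg (fun t : Du k H => t y) h3.symm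

theorem lact_antipodeSq {α : Du k H} (hα : IsChar α) (x : H) :
    lact α (antipodeSq k H x) = antipodeSq k H (lact α x) := by
  rw [lact_apply, lact_apply, sw_antipodeSq (by constructor <;> intro <;> fun_prop),
    map_sw (g := fun z => antipodeSq k H z) (by fun_prop)]
  exact sw_congr fun a b => by rw [hα.apply_antipodeSq, map_smul]

theorem ract_antipodeSq {α : Du k H} (hα : IsChar α) (x : H) :
    ract α (antipodeSq k H x) = antipodeSq k H (ract α x) := by
  rw [ract_apply, ract_apply, sw_antipodeSq (by constructor <;> intro <;> fun_prop),
    map_sw (g := fun z => antipodeSq k H z) (by fun_prop)]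
  exact sw_congr fun a b => by rw [hα.apply_antipodeSq, map_smul]

/-- A consequence of Radford's formula for the fourth power of the antipode. -/
theorem exists_antipodeSq_pow (k H : Type) [Field k] [Ring H] [HopfAlgebra k H]
    [FiniteDimensional k H] : ∃ (α : charGroup k H) (g : GroupLike k H),
    ∀ n, α ^ n = 1 → g ^ n = 1 → (antipodeSq k H).toLinearMap ^ (2 * n) = 1 := by
  obtain ⟨Λ, f, hΛ, hf, h1⟩ := exists_integrals k H
  obtain ⟨α, g, hα, hg⟩ := exists_distinguished hΛ hf h1
  refine ⟨α, g, fun n hn hgn => ?_⟩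
  let Q : Module.End k H := (antipodeSq k H).toLinearMap
  let C : Module.End k H := LinearMap.mulLeft k (g⁻¹).val * LinearMap.mulRight k g.val
  have hN : ∀ x, ∃ y, x = Q (lact α.1.val y) ∧ ract α.1.val y = C (Q x) := by
    intro x
    obtain ⟨y, hy⟩ := exists_shiftR_eq hΛ hf h1 (shiftL x f)
    simp only [shiftL_apply] at hy
    refine ⟨y, ?_, ?_⟩
    · have e1 := hΛ.recover hf x
      simp only [← hy] at e1
      have e2 := hf.sw_eq Λ y
      simp only [hα] at e2
      rw [h1, one_smul] at e1
      rw [← e1]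
      have e3 := congrArg (antipode k) e2
      simp only [linearMap_sw, map_smul] at e3
      rw [e3]
      simp only [Q, AlgHom.toLinearMap_apply, antipodeSq_apply, lact_apply, linearMap_sw, map_smul]
    · have e1 := sw_smul_mul hg x Λ
      have e2 := sw_antipode_smul hg Λ y
      simp only [hα, hy] at e2
      have e3 := congrArg (antipode k) e1
      simp only [linearMap_sw, map_smul] at e3
      rw [← e3] at e2
      have e4 : ∀ b, f (b * Λ) = counit (R := k) b := fun b => by rw [hΛ, map_smul, h1]; simp
      simp only [e4] at e2
      rw [sw_counit_right (k := k) (f := fun a => antipode k (antipode k a * g.val)) (by fun_prop),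
        antipode_mul_antidistrib] at e2
      have e5 := congrArg (· * g.val) e2
      have e6 : antipode k g.val * g.val = 1 := by
        rw [← GroupLike.val_inv, ← GroupLike.val_mul, inv_mul_cancel, GroupLike.val_one]
      simp only [← smul_mul_assoc, ← sw_mul_const] at e5
      simp only [mul_assoc, e6, mul_one] at e5
      rw [ract_apply, ← e5]
      simp [C, Q, antipodeSq_apply]
  have c1 : Commute Q (lact α.1.val) := LinearMap.ext fun x => (lact_antipodeSq α.2 x).symm
  have c2 : Commute Q (ract (α⁻¹).1.val) := LinearMap.ext fun x => (ract_antipodeSq (α⁻¹).2 x).symm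
  have hQg : ∀ g : GroupLike k H, antipodeSq k H g.val = g.val := fun g => by
    rw [antipodeSq_apply, ← GroupLike.val_inv, ← GroupLike.val_inv, inv_inv]
  have c3 : Commute Q C := LinearMap.ext fun x => by
    simp only [Module.End.mul_apply, Q, C, AlgHom.toLinearMap_apply, LinearMap.mulLeft_apply,
      LinearMap.mulRight_apply, map_mul, hQg]
  have c4 : Commute (lact α.1.val) (ract (α⁻¹).1.val) := lact_ract_comm _ _
  have hc : ∀ g : GroupLike k H, α.1.val (g⁻¹).val * α.1.val g.val = 1 := fun g => by
    rw [← α.2.2, ← GroupLike.val_mul, inv_mul_cancel, GroupLike.val_one, α.2.1]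
  have c5 : Commute (lact α.1.val) C := LinearMap.ext fun x => by
    simp only [Module.End.mul_apply, C, LinearMap.mulLeft_apply, LinearMap.mulRight_apply,
      lact_mul_of_isChar α.2, lact_groupLike, mul_smul_comm, smul_mul_assoc, smul_smul]
    rw [mul_comm, hc, one_smul]
  have hc' : ∀ g : GroupLike k H, (α⁻¹).1.val (g⁻¹).val * (α⁻¹).1.val g.val = 1 := fun g => by
    rw [← (α⁻¹).2.2, ← GroupLike.val_mul, inv_mul_cancel, GroupLike.val_one, (α⁻¹).2.1]
  have c6 : Commute (ract (α⁻¹).1.val) C := LinearMap.ext fun x => by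
    simp only [Module.End.mul_apply, C, LinearMap.mulLeft_apply, LinearMap.mulRight_apply,
      ract_mul_of_isChar (α⁻¹).2, ract_groupLike, mul_smul_comm, smul_mul_assoc, smul_smul]
    rw [mul_comm, hc', one_smul]
  have hC : C ^ n = 1 := by
    have h3 : Commute (LinearMap.mulLeft k (g⁻¹).val) (LinearMap.mulRight k g.val) :=
      LinearMap.ext fun x => (mul_assoc _ _ _).symm
    rw [show C ^ n = _ from h3.mul_pow n, LinearMap.pow_mulLeft, LinearMap.pow_mulRight,
      ← GroupLike.val_pow, ← GroupLike.val_pow, hgn, inv_pow, hgn]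
    ext; simp
  have hα1 : lact α.1.val ^ n = 1 := by
    rw [← lact_pow, ← Units.val_pow_eq_pow_val, ← SubmonoidClass.coe_pow, hn]
    exact lact_one
  have hα2 : ract (α⁻¹).1.val ^ n = 1 := by
    rw [← ract_pow, ← Units.val_pow_eq_pow_val, ← SubmonoidClass.coe_pow, inv_pow, hn]
    simp [ract_one]
  have key : Q ^ 2 * (lact α.1.val * ract (α⁻¹).1.val * C) = 1 := by
    ext x
    obtain ⟨y, h2, h3⟩ := hN x
    have h4 : y = ract (α⁻¹).1.val (C (Q x)) := by
      rw [← h3, ← Module.End.mul_apply, ← ract_mul]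
      simp [ract_one]
    rw [h4] at h2
    have c7 : Commute Q (lact α.1.val * ract (α⁻¹).1.val * C) := (c1.mul_right c2).mul_right c3
    rw [pow_two, mul_assoc, c7.eq]
    exact h2.symm
  have c7 : Commute (Q ^ 2) (lact α.1.val * ract (α⁻¹).1.val * C) :=
    ((c1.mul_right c2).mul_right c3).pow_left 2
  have h5 := c7.mul_pow n
  rw [key, one_pow, (c5.mul_left c6).mul_pow, c4.mul_pow, hC, hα1, hα2, mul_one, mul_one, mul_one,
    ← pow_mul] at h5
  exact h5.symm

end Radford

section Duality

variable {k : Type} [Field k] {H : Type} [Ring H] [HopfAlgebra k H]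

/-- Stability under the left and right actions of the dual algebra. -/
def Stable (C : Submodule k H) : Prop :=
  ∀ f : Du k H, ∀ x ∈ C, lact f x ∈ C ∧ ract f x ∈ C

/-- The functionals vanishing on `C`. -/
def ann (C : Submodule k H) : Submodule k (Du k H) where
  carrier := {f | ∀ x ∈ C, f x = 0}
  add_mem' hf hg x hx := by simp [hf x hx, hg x hx]
  zero_mem' x _ := by simp
  smul_mem' c f hf x hx := by simp [hf x hx]

/-- The common zeros of the functionals in `J`. -/
def perp (J : Submodule k (Du k H)) : Submodule k H where
  carrier := {x | ∀ f ∈ J, f x = 0}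
  add_mem' hx hy f hf := by
    rw [show f (_ + _) = f _ + f _ from _root_.map_add f.ofConv _ _, hx f hf, hy f hf, add_zero]
  zero_mem' f _ := _root_.map_zero f.ofConv
  smul_mem' c x hx f hf := by
    rw [show f (c • x) = c • f x from _root_.map_smul f.ofConv _ _, hx f hf, smul_zero]

theorem mem_perp {J : Submodule k (Du k H)} {x : H} : x ∈ perp J ↔ ∀ f ∈ J, f x = 0 := Iff.rfl

theorem ann_anti {C D : Submodule k H} (h : C ≤ D) : ann D ≤ ann C :=
  fun _ hf x hx => hf x (h hx)

theorem perp_anti {I J : Submodule k (Du k H)} (h : I ≤ J) : perp J ≤ perp I :=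
  fun _ hx f hf => hx f (h hf)

theorem perp_ann (C : Submodule k H) : perp (ann C) = C := by
  refine le_antisymm (fun x hx => ?_) fun x hx f hf => hf x hx
  by_contra hxC
  obtain ⟨f, hf, h⟩ := Submodule.exists_dual_map_eq_bot_of_notMem hxC inferInstance
  refine hf (hx (toConv f) fun y hy => ?_)
  have := Submodule.mem_map_of_mem (f := f) hy
  rw [h] at this
  exact (Submodule.mem_bot k).1 this

theorem ann_bot : ann (⊥ : Submodule k H) = ⊤ :=
  eq_top_iff.2 fun f _ x hx => by
    rw [(Submodule.mem_bot k).1 hx]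
    exact _root_.map_zero f.ofConv

theorem mem_range_map_iff [FiniteDimensional k H] {C : Submodule k H} {x : H} :
    comul (R := k) x ∈ LinearMap.range (TensorProduct.map C.subtype C.subtype) ↔
      ∀ f : Du k H, lact f x ∈ C ∧ ract f x ∈ C := by
  constructor
  · rintro ⟨t, ht⟩ f
    have hl : Bil k (fun a b : H => f a • b) := by constructor <;> intro <;> fun_prop
    have hr : Bil k (fun a b : H => f b • a) := by constructor <;> intro <;> fun_prop
    rw [lact_apply, ract_apply, sw_eq_lift hl, sw_eq_lift hr, ← ht]
    clear ht
    induction t with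
    | zero => simp
    | tmul a b =>
      exact ⟨C.smul_mem _ b.2, C.smul_mem _ a.2⟩
    | add a b ha hb =>
      simp only [_root_.map_add]
      exact ⟨C.add_mem ha.1 hb.1, C.add_mem ha.2 hb.2⟩
  · intro h
    obtain ⟨q, hq⟩ := LinearMap.exists_leftInverse_of_injective C.subtype C.ker_subtype
    have hP : ∀ y ∈ C, (q y : H) = y := fun y hy =>
      congrArg Subtype.val (LinearMap.congr_fun hq ⟨y, hy⟩)
    let b := Module.finBasis k H
    have h1 : comul (R := k) x = sw k x (fun a c => (q a : H) ⊗ₜ[k] (c : H)) := by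
      have e : ∀ F : H → H, Lin k F → sw k x (fun a c => F a ⊗ₜ[k] (c : H)) =
          ∑ i, F (ract (toConv (b.coord i)) x) ⊗ₜ[k] b i := by
        intro F hF
        rw [sw_congr fun a c => (sum_coord_smul b (Φ := fun c => F a ⊗ₜ[k] c)
          (by fun_prop) c).symm, ← sum_sw]
        refine Finset.sum_congr rfl fun i _ => ?_
        rw [ract_apply, map_sw (g := fun z => F z ⊗ₜ[k] b i) (by fun_prop)]
        refine sw_congr fun a c => ?_
        rw [hF.map_smul]
        exact (TensorProduct.smul_tmul' _ _ _).symm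
      rw [comul_eq_sw, e _ (by fun_prop), e (fun a => (q a : H))
        (by exact (show Lin k (fun a => C.subtype (q a)) by fun_prop))]
      exact Finset.sum_congr rfl fun i _ => by rw [hP _ (h _).2]
    have h2 : comul (R := k) x = sw k x (fun a c => (q a : H) ⊗ₜ[k] (q c : H)) := by
      have e : ∀ F : H → H, Lin k F → sw k x (fun a c => (q a : H) ⊗ₜ[k] F c) =
          ∑ i, (q (b i) : H) ⊗ₜ[k] F (lact (toConv (b.coord i)) x) := by
        intro F hF
        rw [sw_congr (f := fun a c => (q a : H) ⊗ₜ[k] F c)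
          (g := fun a c => ∑ i, b.coord i a • ((q (b i) : H) ⊗ₜ[k] F c)) fun a c =>
          (sum_coord_smul b (Φ := fun a => C.subtype (q a) ⊗ₜ[k] F c) (by fun_prop) a).symm,
          ← sum_sw]
        refine Finset.sum_congr rfl fun i _ => ?_
        rw [lact_apply, map_sw (g := fun z => (q (b i) : H) ⊗ₜ[k] F z) (by fun_prop)]
        refine sw_congr fun a c => ?_
        rw [hF.map_smul, TensorProduct.tmul_smul]
      rw [h1, e _ (by fun_prop), e (fun a => (q a : H))
        (by exact (show Lin k (fun a => C.subtype (q a)) by fun_prop))]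
      exact Finset.sum_congr rfl fun i _ => by rw [hP _ (h _).1]
    rw [h2]
    exact Submodule.sum_mem _ fun i _ => ⟨q _ ⊗ₜ[k] q _, rfl⟩

theorem isSubcoalgebraOf_iff [FiniteDimensional k H] {C : Submodule k H} :
    IsSubcoalgebraOf (comul (R := k) (A := H)) C ↔ Stable C :=
  ⟨fun h f x hx => mem_range_map_iff.1 (h x hx) f,
    fun h x hx => mem_range_map_iff.2 fun f => h f x hx⟩

theorem Stable.mul_mem_ann {C : Submodule k H} (hC : Stable C) {f : Du k H} (hf : f ∈ ann C)
    (g : Du k H) : f * g ∈ ann C := fun x hx => by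
  rw [← apply_ract]
  exact hf _ (hC g x hx).2

theorem Stable.mul_mem_ann' {C : Submodule k H} (hC : Stable C) {f : Du k H} (hf : f ∈ ann C)
    (g : Du k H) : g * f ∈ ann C := fun x hx => by
  rw [← apply_lact]
  exact hf _ (hC g x hx).1

theorem stable_perp {J : Submodule k (Du k H)} (hl : ∀ f ∈ J, ∀ g, f * g ∈ J)
    (hr : ∀ f ∈ J, ∀ g, g * f ∈ J) : Stable (perp J) := fun g x hx =>
  ⟨fun f hf => by rw [apply_lact]; exact hx _ (hr f hf g),
    fun f hf => by rw [apply_ract]; exact hx _ (hl f hf g)⟩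

theorem Stable.inf {C D : Submodule k H} (hC : Stable C) (hD : Stable D) : Stable (C ⊓ D) :=
  fun f x hx => ⟨⟨(hC f x hx.1).1, (hD f x hx.2).1⟩, ⟨(hC f x hx.1).2, (hD f x hx.2).2⟩⟩

theorem Stable.sup {C D : Submodule k H} (hC : Stable C) (hD : Stable D) : Stable (C ⊔ D) := by
  intro f x hx
  obtain ⟨y, hy, z, hz, rfl⟩ := Submodule.mem_sup.1 hx
  rw [_root_.map_add, _root_.map_add]
  exact ⟨Submodule.add_mem_sup (hC f y hy).1 (hD f z hz).1,
    Submodule.add_mem_sup (hC f y hy).2 (hD f z hz).2⟩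

theorem stable_bot : Stable (⊥ : Submodule k H) := fun f x hx => by
  rw [(Submodule.mem_bot k).1 hx]
  simp

variable [FiniteDimensional k H]

theorem ann_perp (J : Submodule k (Du k H)) : ann (perp J) = J := by
  have h := Subspace.dualCoannihilator_dualAnnihilator_eq
    (W := J.map (WithConv.linearEquiv k (H →ₗ[k] k)).toLinearMap)
  refine le_antisymm (fun f hf => ?_) fun f hf x hx => hx f hf
  have h2 : f.ofConv ∈ J.map (WithConv.linearEquiv k (H →ₗ[k] k)).toLinearMap := by
    rw [← h, Submodule.mem_dualAnnihilator]
    intro x hx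
    refine hf x fun g hg => ?_
    exact (Submodule.mem_dualCoannihilator _).1 hx _ ⟨g, hg, rfl⟩
  obtain ⟨g, hg, hgf⟩ := h2
  exact (WithConv.ext hgf : g = f) ▸ hg

theorem finrank_perp (J : Submodule k (Du k H)) :
    Module.finrank k J + Module.finrank k (perp J) = Module.finrank k H := by
  have h := Subspace.finrank_add_finrank_dualCoannihilator_eq
    (J.map (WithConv.linearEquiv k (H →ₗ[k] k)).toLinearMap)
  rw [LinearEquiv.finrank_map_eq] at h
  rw [← h]
  refine congrArg (_ + ·) (congrArg (fun W : Submodule k H => Module.finrank k W) ?_)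
  ext x
  simp only [mem_perp, Submodule.mem_dualCoannihilator, Submodule.mem_map]
  exact ⟨fun hx _ ⟨g, hg, e⟩ => e ▸ hx g hg, fun hx g hg => hx _ ⟨g, hg, rfl⟩⟩

theorem perp_bot : perp (⊥ : Submodule k (Du k H)) = ⊤ :=
  eq_top_iff.2 fun x _ f hf => by rw [(Submodule.mem_bot k).1 hf]; simp

theorem perp_top : perp (⊤ : Submodule k (Du k H)) = ⊥ := by
  rw [← ann_bot, perp_ann]

/-- The subcoalgebra attached to a quotient of the dual algebra. -/
noncomputable def kerPerp {R : Type} [Ring R] [Algebra k R] (φ : Du k H →ₐ[k] R) : Submodule k H :=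
  perp (LinearMap.ker φ.toLinearMap)

section Quot

variable {R : Type} [Ring R] [Algebra k R] {φ : Du k H →ₐ[k] R}

theorem stable_kerPerp : Stable (kerPerp φ) :=
  stable_perp (fun f hf g => by simp_all) (fun f hf g => by simp_all)

theorem ann_kerPerp : ann (kerPerp φ) = LinearMap.ker φ.toLinearMap := ann_perp _

theorem finrank_kerPerp (hφ : Function.Surjective φ) :
    Module.finrank k (kerPerp φ) = Module.finrank k R := by
  have h1 := finrank_perp (LinearMap.ker φ.toLinearMap)
  have h2 := φ.toLinearMap.finrank_range_add_finrank_ker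
  rw [LinearMap.range_eq_top.2 hφ, finrank_top, finrank_du] at h2
  unfold kerPerp
  omega

theorem isSimple_kerPerp [IsSimpleRing R] (hφ : Function.Surjective φ) :
    IsSimpleSubcoalgebraOf (comul (R := k) (A := H)) (kerPerp φ) := by
  refine ⟨isSubcoalgebraOf_iff.2 stable_kerPerp, fun h => ?_, fun D hD hle => ?_⟩
  · have h1 : (1 : Du k H) ∈ ann (kerPerp φ) := by rw [h, ann_bot]; trivial
    rw [ann_kerPerp] at h1
    simp at h1
  · rw [isSubcoalgebraOf_iff] at hD
    have hker : ∀ f, φ f = 0 → f ∈ ann D := fun f hf =>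
      ann_anti hle (by rw [ann_kerPerp]; exact hf)
    let K : TwoSidedIdeal R := TwoSidedIdeal.mk' (φ '' (ann D : Set (Du k H)))
      ⟨0, (ann D).zero_mem, by simp⟩
      (by rintro _ _ ⟨a, ha, rfl⟩ ⟨b, hb, rfl⟩; exact ⟨a + b, (ann D).add_mem ha hb, by simp⟩)
      (by rintro _ ⟨a, ha, rfl⟩; exact ⟨-a, (ann D).neg_mem ha, by simp⟩)
      (by
        rintro x _ ⟨a, ha, rfl⟩
        obtain ⟨y, rfl⟩ := hφ x
        exact ⟨y * a, hD.mul_mem_ann' ha y, by simp⟩)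
      (by
        rintro _ x ⟨a, ha, rfl⟩
        obtain ⟨y, rfl⟩ := hφ x
        exact ⟨a * y, hD.mul_mem_ann ha y, by simp⟩)
    have hK : ∀ x, x ∈ K ↔ x ∈ φ '' (ann D : Set (Du k H)) := fun x => by
      exact TwoSidedIdeal.mem_mk' _ _ _ _ _ _ _
    rcases eq_bot_or_eq_top K with h | h
    · right
      refine le_antisymm hle ?_
      rw [← perp_ann D]
      refine perp_anti fun f hf => ?_
      have : φ f ∈ K := (hK _).2 ⟨f, hf, rfl⟩
      rw [h] at this
      exact (TwoSidedIdeal.mem_bot _).1 this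
    · left
      obtain ⟨a, ha, ha1⟩ := (hK 1).1 (by rw [h]; trivial)
      have h1 : (1 : Du k H) ∈ ann D := by
        have := (ann D).add_mem ha (hker (1 - a) (by simp [ha1]))
        simpa using this
      rw [← perp_ann D, eq_bot_iff, ← perp_top]
      exact perp_anti fun f _ => by simpa using hD.mul_mem_ann h1 f

end Quot

theorem isSimple_of_kerPerp {R : Type} [Ring R] [Algebra k R] {φ : Du k H →ₐ[k] R}
    (hφ : Function.Surjective φ)
    (h : IsSimpleSubcoalgebraOf (comul (R := k) (A := H)) (kerPerp φ)) : IsSimpleRing R := by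
  obtain ⟨-, hne, hmin⟩ := h
  have : Nontrivial R := by
    by_contra hn
    rw [not_nontrivial_iff_subsingleton] at hn
    refine hne ?_
    unfold kerPerp
    rw [← perp_top]
    congr 1
    exact eq_top_iff.2 fun f _ => Subsingleton.elim _ _
  refine ⟨⟨fun K => ?_⟩⟩
  let K' : Submodule k (Du k H) :=
    { carrier := {f | φ f ∈ K}
      add_mem' := fun {a b} ha hb => by
        simp only [Set.mem_ofPred_eq, _root_.map_add] at *
        exact K.add_mem ha hb
      zero_mem' := by simp [K.zero_mem]
      smul_mem' := fun c f hf => by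
        simp only [Set.mem_ofPred_eq, _root_.map_smul] at *
        rw [Algebra.smul_def]
        exact K.mul_mem_left _ _ hf }
  have hK' : ∀ f, f ∈ K' ↔ φ f ∈ K := fun f => Iff.rfl
  have hst : Stable (perp K') := stable_perp
    (fun f hf g => by rw [hK', _root_.map_mul]; exact K.mul_mem_right _ _ hf)
    (fun f hf g => by rw [hK', _root_.map_mul]; exact K.mul_mem_left _ _ hf)
  have hle : perp K' ≤ kerPerp φ := perp_anti fun f hf => by
    rw [hK', show φ f = 0 from hf]
    exact K.zero_mem
  rcases hmin _ (isSubcoalgebraOf_iff.2 hst) hle with h | h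
  · right
    have h1 : (1 : Du k H) ∈ K' := by rw [← ann_perp K', h, ann_bot]; trivial
    rw [hK', _root_.map_one] at h1
    exact (TwoSidedIdeal.one_mem_iff _).1 h1
  · left
    rw [eq_bot_iff]
    intro x hx
    obtain ⟨f, rfl⟩ := hφ x
    have h1 : f ∈ K' := hx
    rw [← ann_perp K', h, ann_kerPerp] at h1
    exact (TwoSidedIdeal.mem_bot _).2 h1

end Duality

section Simple

variable {k : Type} [Field k] {H : Type} [Ring H] [HopfAlgebra k H]

/-- The right regular action of the dual algebra on a stable subspace. -/
noncomputable def ractHom {C : Submodule k H} (hC : Stable C) : Du k H →ₐ[k] Module.End k C :=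
  AlgHom.ofLinearMap
    { toFun := fun f => (ract f).restrict fun x hx => (hC f x hx).2
      map_add' := fun f g => by
        ext x
        exact (show Lin k (fun f : Du k H => ract f x.1) by fun_prop).map_add f g
      map_smul' := fun c f => by
        ext x
        exact (show Lin k (fun f : Du k H => ract f x.1) by fun_prop).map_smul c f }
    (by ext x; simp [ract_one])
    (fun f g => by ext x; simp [ract_mul])

theorem ractHom_apply {C : Submodule k H} (hC : Stable C) (f : Du k H) (x : C) :
    (ractHom hC f x : H) = ract f x.1 := rfl

theorem ractHom_eq_zero {C : Submodule k H} (hC : Stable C) (f : Du k H) :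
    ractHom hC f = 0 ↔ f ∈ ann C := by
  constructor
  · intro h x hx
    rw [← counit_ract, ← ractHom_apply hC f ⟨x, hx⟩, h]
    simp
  · intro h
    ext x
    rw [ractHom_apply]
    refine eq_of_dual (k := k) fun g => ?_
    rw [apply_ract, ← apply_lact, h _ (hC g _ x.2).1]
    simp

/-- The span of the group-like elements. -/
def glSpan (k H : Type) [Field k] [Ring H] [HopfAlgebra k H] : Submodule k H :=
  Submodule.span k (Set.range (GroupLike.val (R := k) (A := H)))

theorem val_mem_glSpan (g : GroupLike k H) : g.val ∈ glSpan k H := Submodule.subset_span ⟨g, rfl⟩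

theorem stable_span_groupLike (g : GroupLike k H) : Stable (Submodule.span k {g.val}) := by
  intro f x hx
  obtain ⟨c, rfl⟩ := Submodule.mem_span_singleton.1 hx
  rw [map_smul, map_smul, lact_groupLike, ract_groupLike]
  exact ⟨Submodule.smul_mem _ _ (Submodule.smul_mem _ _ (Submodule.mem_span_singleton_self _)),
    Submodule.smul_mem _ _ (Submodule.smul_mem _ _ (Submodule.mem_span_singleton_self _))⟩

theorem stable_glSpan : Stable (glSpan k H) := by
  intro f x hx
  induction hx using Submodule.span_induction with
  | mem x hx =>
    obtain ⟨g, rfl⟩ := hx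
    rw [lact_groupLike, ract_groupLike]
    exact ⟨Submodule.smul_mem _ _ (val_mem_glSpan g), Submodule.smul_mem _ _ (val_mem_glSpan g)⟩
  | zero => simp
  | add x y _ _ hx hy =>
    simp only [map_add]
    exact ⟨Submodule.add_mem _ hx.1 hy.1, Submodule.add_mem _ hx.2 hy.2⟩
  | smul c x _ hx =>
    simp only [map_smul]
    exact ⟨Submodule.smul_mem _ _ hx.1, Submodule.smul_mem _ _ hx.2⟩

theorem groupLike_val_ne_zero (g : GroupLike k H) : g.val ≠ 0 := fun h => by
  have := g.2.counit_eq_one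
  rw [h] at this
  simp at this

theorem finrank_span_groupLike (g : GroupLike k H) :
    Module.finrank k (Submodule.span k {g.val}) = 1 :=
  finrank_span_singleton (groupLike_val_ne_zero g)

theorem isGroupLikeOf_iff (a : H) :
    IsGroupLikeOf (comul (R := k) (A := H)) a ↔ IsGroupLikeElem k a := by
  constructor
  · rintro ⟨h0, h⟩
    refine ⟨?_, h⟩
    have h1 := sw_counit_left (k := k) (f := fun x : H => x) (by fun_prop) a
    rw [sw_eq_of_comul (by constructor <;> intro <;> fun_prop) h] at h1
    have h2 : (counit (R := k) a - 1) • a = 0 := by rw [sub_smul, h1, one_smul, sub_self]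
    rcases smul_eq_zero.1 h2 with h3 | h3
    · exact sub_eq_zero.1 h3
    · exact absurd h3 h0
  · intro h
    exact ⟨groupLike_val_ne_zero ⟨a, h⟩, h.comul_eq_tmul_self⟩

variable [FiniteDimensional k H]

theorem exists_groupLike_of_finrank_eq_one {C : Submodule k H} (hC : Stable C)
    (h1 : Module.finrank k C = 1) : ∃ g : GroupLike k H, C = Submodule.span k {g.val} := by
  obtain ⟨v, hv0, hv⟩ := finrank_eq_one_iff'.1 h1
  obtain ⟨t, ht⟩ := (isSubcoalgebraOf_iff.2 hC) v.1 v.2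
  have : ∃ c : k, comul (R := k) v.1 = c • (v.1 ⊗ₜ[k] v.1) := by
    rw [← ht]
    clear ht
    induction t with
    | zero => exact ⟨0, by simp⟩
    | tmul a b =>
      obtain ⟨c, rfl⟩ := hv a
      obtain ⟨d, rfl⟩ := hv b
      exact ⟨c * d, by rw [TensorProduct.smul_tmul_smul, map_smul, TensorProduct.map_tmul]; rfl⟩
    | add a b ha hb =>
      obtain ⟨c, hc⟩ := ha
      obtain ⟨d, hd⟩ := hb
      exact ⟨c + d, by rw [map_add, hc, hd, add_smul]⟩
  obtain ⟨c, hc⟩ := this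
  have hv0' : v.1 ≠ 0 := fun h => hv0 (Subtype.ext h)
  have hc0 : c ≠ 0 := by
    rintro rfl
    rw [zero_smul] at hc
    have h1 := sw_counit_left (k := k) (f := fun x : H => x) (by fun_prop) v.1
    rw [sw_eq_lift (by constructor <;> intro <;> fun_prop), hc, map_zero] at h1
    exact hv0' h1.symm
  have hg : IsGroupLikeOf (comul (R := k) (A := H)) (c • v.1) :=
    ⟨smul_ne_zero hc0 hv0', by
      rw [map_smul, hc, TensorProduct.smul_tmul_smul, smul_smul]⟩
  refine ⟨⟨c • v.1, (isGroupLikeOf_iff _).1 hg⟩, ?_⟩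
  apply le_antisymm
  · intro x hx
    obtain ⟨d, hd⟩ := hv ⟨x, hx⟩
    refine Submodule.mem_span_singleton.2 ⟨d * c⁻¹, ?_⟩
    have : d • v.1 = x := congrArg Subtype.val hd
    rw [smul_smul, mul_assoc, inv_mul_cancel₀ hc0, mul_one, this]
  · rw [Submodule.span_singleton_le_iff_mem]
    exact C.smul_mem _ v.2

theorem isSimple_span_groupLike (g : GroupLike k H) :
    IsSimpleSubcoalgebraOf (comul (R := k) (A := H)) (Submodule.span k {g.val}) := by
  refine ⟨isSubcoalgebraOf_iff.2 (stable_span_groupLike g), fun h => ?_, fun D _ hle => ?_⟩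
  · exact groupLike_val_ne_zero g (Submodule.span_singleton_eq_bot.1 h)
  · by_cases h0 : D = ⊥
    · exact Or.inl h0
    · right
      refine Submodule.eq_of_le_of_finrank_le hle ?_
      rw [finrank_span_groupLike]
      exact Submodule.one_le_finrank_iff.2 h0

theorem finrank_glSpan : Module.finrank k (glSpan k H) = Nat.card (GroupLike k H) := by
  have : Finite (GroupLike k H) := (linearIndep_groupLikeVal (R := k) (A := H)).finite
  have := Fintype.ofFinite (GroupLike k H)
  rw [Nat.card_eq_fintype_card]
  exact finrank_span_eq_card linearIndep_groupLikeVal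

theorem le_or_le_of_le_sup {C D E : Submodule k H}
    (hC : IsSimpleSubcoalgebraOf (comul (R := k) (A := H)) C) (hD : Stable D) (hE : Stable E)
    (h : C ≤ D ⊔ E) : C ≤ D ∨ C ≤ E := by
  have hCs := isSubcoalgebraOf_iff.1 hC.1
  rcases hC.2.2 _ (isSubcoalgebraOf_iff.2 (hCs.inf hD)) inf_le_left with h0 | h0
  · right
    obtain ⟨π, hπ⟩ := LinearMap.exists_leftInverse_of_injective
      (D.mkQ ∘ₗ C.subtype) (by
        rw [LinearMap.ker_eq_bot']
        intro x hx
        have hx' : x.1 ∈ D := by simpa using hx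
        have : x.1 ∈ C ⊓ D := ⟨x.2, hx'⟩
        rw [h0] at this
        exact Subtype.ext ((Submodule.mem_bot k).1 this))
    let f : Du k H := toConv (counit ∘ₗ C.subtype ∘ₗ π ∘ₗ D.mkQ)
    have hfD : f ∈ ann D := fun x hx => by
      change counit (R := k) (π (D.mkQ x) : H) = 0
      rw [(show D.mkQ x = 0 by simpa using hx)]
      simp
    have hfC : f - 1 ∈ ann C := fun x hx => by
      have : π (D.mkQ x) = ⟨x, hx⟩ := LinearMap.congr_fun hπ ⟨x, hx⟩
      rw [du_sub_apply, du_one_apply]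
      change counit (R := k) (π (D.mkQ x) : H) - _ = 0
      rw [this, sub_self]
    intro c hc
    obtain ⟨d, hd, e, he, rfl⟩ := Submodule.mem_sup.1 (h hc)
    have h1 : ract (f - 1) (d + e) = 0 :=
      congrArg Subtype.val (LinearMap.congr_fun ((ractHom_eq_zero hCs _).2 hfC) ⟨d + e, hc⟩)
    have h2 : ract f d = 0 :=
      congrArg Subtype.val (LinearMap.congr_fun ((ractHom_eq_zero hD _).2 hfD) ⟨d, hd⟩)
    rw [show ract (f - 1) (d + e) = ract f (d + e) - ract (1 : Du k H) (d + e) by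
      have hl := show Lin k (fun f : Du k H => ract f (d + e)) by fun_prop
      have := hl.map_add (f - 1) 1
      rw [sub_add_cancel] at this
      rw [this]
      simp, ract_one, Module.End.one_apply, map_add, h2, zero_add, sub_eq_zero] at h1
    rw [← h1]
    exact (hE f e he).2
  · left
    exact inf_eq_left.1 h0

theorem stable_finset_sup {ι : Type} (s : Finset ι) {F : ι → Submodule k H}
    (h : ∀ i ∈ s, Stable (F i)) : Stable (s.sup F) := by
  classical
  induction s using Finset.induction_on with
  | empty => simpa using stable_bot
  | insert a s ha ih =>
    rw [Finset.sup_insert]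
    exact (h a (by simp)).sup (ih fun i hi => h i (by simp [hi]))

theorem finrank_sup_sup {D : Submodule k H} (hD : Stable D) {N : ℕ} (s : Finset (Submodule k H))
    (hs : ∀ C ∈ s, IsSimpleSubcoalgebraOf (comul (R := k) (A := H)) C)
    (hN : ∀ C ∈ s, Module.finrank k C = N) (hsD : ∀ C ∈ s, ¬ C ≤ D) :
    Module.finrank k (D ⊔ s.sup id : Submodule k H) = Module.finrank k D + N * s.card := by
  classical
  induction s using Finset.induction_on with
  | empty => rw [Finset.sup_empty, sup_bot_eq, Finset.card_empty, mul_zero, add_zero]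
  | insert C s hCs ih =>
    have hC := hs C (by simp)
    have hst : Stable (s.sup id) := stable_finset_sup s fun E hE =>
      isSubcoalgebraOf_iff.1 (hs E (by simp [hE])).1
    have key : ∀ t ⊆ s, C ≤ t.sup id → False := by
      intro t
      induction t using Finset.induction_on with
      | empty =>
        intro _ h
        exact hC.2.1 (by simpa using h)
      | insert E t hEt iht =>
        intro hts h
        have hE := hs E (by simp [hts (Finset.mem_insert_self E t)])
        rw [Finset.sup_insert] at h
        rcases le_or_le_of_le_sup hC (isSubcoalgebraOf_iff.1 hE.1)
          (stable_finset_sup t fun F hF => isSubcoalgebraOf_iff.1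
            (hs F (by simp [hts (Finset.mem_insert_of_mem hF)])).1) h with h1 | h1
        · rcases hE.2.2 C hC.1 h1 with h2 | h2
          · exact hC.2.1 h2
          · exact hCs (h2 ▸ hts (Finset.mem_insert_self E t))
        · exact iht (fun F hF => hts (Finset.mem_insert_of_mem hF)) h1
    have hne : ¬ C ≤ D ⊔ s.sup id := fun h => by
      rcases le_or_le_of_le_sup hC hD hst h with h1 | h1
      · exact hsD C (by simp) h1
      · exact key s (fun _ h => h) h1
    have hbot : (D ⊔ s.sup id) ⊓ C = ⊥ := by
      rcases hC.2.2 _ (isSubcoalgebraOf_iff.2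
        ((hD.sup hst).inf (isSubcoalgebraOf_iff.1 hC.1))) inf_le_right with h | h
      · exact h
      · exact absurd (inf_eq_right.1 h) hne
    have h1 := Submodule.finrank_sup_add_finrank_inf_eq (D ⊔ s.sup id) C
    rw [hbot, finrank_bot, add_zero, hN C (by simp),
      ih (fun E hE => hs E (by simp [hE])) (fun E hE => hN E (by simp [hE]))
        (fun E hE => hsD E (by simp [hE]))] at h1
    rw [Finset.sup_insert, id, sup_comm C, ← sup_assoc, h1, Finset.card_insert_of_notMem hCs]
    ring

variable [IsAlgClosed k]

theorem exists_finrank_eq_sq_of_algHom {R : Type} [Ring R] [Algebra k R] (ψ : Du k H →ₐ[k] R)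
    {C : Submodule k H} (hC : IsSimpleSubcoalgebraOf (comul (R := k) (A := H)) C)
    (hψ : ∀ f, ψ f = 0 ↔ f ∈ ann C) : ∃ n, Module.finrank k C = n ^ 2 := by
  let φ : Du k H →ₐ[k] ψ.range := ψ.rangeRestrict
  have hφ : Function.Surjective φ := ψ.rangeRestrict_surjective
  have hk : kerPerp φ = C := by
    unfold kerPerp
    rw [show LinearMap.ker φ.toLinearMap = ann C by
      ext f
      rw [← hψ, LinearMap.mem_ker]
      exact Subtype.ext_iff, perp_ann]
  have := isSimple_of_kerPerp hφ (hk.symm ▸ hC)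
  have : FiniteDimensional k ψ.range := Module.Finite.of_surjective φ.toLinearMap hφ
  obtain ⟨n, _, ⟨e⟩⟩ := IsSimpleRing.exists_algEquiv_matrix_of_isAlgClosed k ψ.range
  refine ⟨n, ?_⟩
  have h2 := finrank_kerPerp hφ
  rw [hk, e.toLinearEquiv.finrank_eq] at h2
  rw [h2, Module.finrank_matrix]
  simp [sq]

theorem exists_finrank_eq_sq {C : Submodule k H}
    (hC : IsSimpleSubcoalgebraOf (comul (R := k) (A := H)) C) :
    ∃ n, Module.finrank k C = n ^ 2 :=
  exists_finrank_eq_sq_of_algHom (R := Module.End k C)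
    (ractHom (isSubcoalgebraOf_iff.1 hC.1)) hC (ractHom_eq_zero (isSubcoalgebraOf_iff.1 hC.1))

instance : IsArtinianRing (Du k H) := IsArtinianRing.of_finite k _

theorem exists_mul_eq_one_of_add_mem_jacobson {A : Type} [Ring A] {a r : A}
    (hr : r ∈ Ring.jacobson A) (h : a + r = 1) : ∃ z, z * a = 1 := by
  rw [← Ideal.jacobson_bot] at hr
  obtain ⟨z, hz⟩ := Ideal.mem_jacobson_iff.1 hr (-1)
  refine ⟨z, ?_⟩
  rw [eq_sub_of_add_eq h, mul_sub, mul_one]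
  have hz' : z * -1 * r + z - 1 = 0 := hz
  rw [mul_neg_one, neg_mul] at hz'
  rw [← sub_eq_zero, ← hz']
  abel

theorem jacobson_apply_eq_zero {C : Submodule k H}
    (hC : IsSimpleSubcoalgebraOf (comul (R := k) (A := H)) C) {f : Du k H}
    (hf : f ∈ Ring.jacobson (Du k H)) {x : H} (hx : x ∈ C) : f x = 0 := by
  let J : Submodule k (Du k H) := (Ring.jacobson (Du k H)).restrictScalars k
  have hCs := isSubcoalgebraOf_iff.1 hC.1
  have hJ : Stable (perp J) := stable_perp
    (fun f hf g => Ideal.mul_mem_right g _ (show f ∈ Ring.jacobson _ from hf))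
    (fun f hf g => Ideal.mul_mem_left _ g (show f ∈ Ring.jacobson _ from hf))
  rcases hC.2.2 _ (isSubcoalgebraOf_iff.2 (hCs.inf hJ)) inf_le_left with h | h
  · exfalso
    have h1 : perp (ann C ⊔ J) = ⊥ := by
      rw [eq_bot_iff, ← h]
      refine le_inf ?_ (perp_anti le_sup_right)
      conv_rhs => rw [← perp_ann C]
      exact perp_anti le_sup_left
    have h2 : (1 : Du k H) ∈ ann C ⊔ J := by rw [← ann_perp (ann C ⊔ J), h1, ann_bot]; trivial
    obtain ⟨a, ha, r, hr, har⟩ := Submodule.mem_sup.1 h2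
    obtain ⟨z, hza⟩ := exists_mul_eq_one_of_add_mem_jacobson hr har
    have h3 : (1 : Du k H) ∈ ann C := hza ▸ hCs.mul_mem_ann' ha z
    refine hC.2.1 ?_
    rw [← perp_ann C, eq_bot_iff, ← perp_top]
    exact perp_anti fun f _ => by simpa using hCs.mul_mem_ann h3 f
  · exact (inf_eq_left.1 h hx) f hf

theorem exists_ann_glSpan_pow_eq_bot (hp : IsPointedOf (comul (R := k) (A := H))) :
    ∃ n, ann (glSpan k H) ^ n = ⊥ := by
  obtain ⟨m, d, hd, ⟨e⟩⟩ := IsSemisimpleRing.exists_algEquiv_pi_matrix_of_isAlgClosed k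
    (Du k H ⧸ Ring.jacobson (Du k H))
  have hle : ∀ f ∈ ann (glSpan k H), f ∈ Ring.jacobson (Du k H) := by
    intro f hf
    rw [← Ideal.Quotient.eq_zero_iff_mem]
    refine e.injective ?_
    rw [map_zero]
    funext i
    have := hd i
    let φ : Du k H →ₐ[k] Matrix (Fin (d i)) (Fin (d i)) k :=
      ((Pi.evalAlgHom k (fun i => Matrix (Fin (d i)) (Fin (d i)) k) i).comp e.toAlgHom).comp
        (Ideal.Quotient.mkₐ k (Ring.jacobson (Du k H)))
    have hφ : Function.Surjective φ :=
      ((Function.surjective_eval i).comp e.surjective).comp Ideal.Quotient.mk_surjective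
    have h1 := isSimple_kerPerp hφ
    obtain ⟨g, hg⟩ := exists_groupLike_of_finrank_eq_one stable_kerPerp (hp _ h1)
    have h2 : f ∈ ann (kerPerp φ) := by
      rw [hg]
      exact ann_anti (Submodule.span_mono (by rintro _ rfl; exact ⟨g, rfl⟩)) hf
    rw [ann_kerPerp] at h2
    exact h2
  obtain ⟨n, hn⟩ := IsSemiprimaryRing.isNilpotent (R := Du k H)
  have hpow : ∀ n, ∀ f ∈ ann (glSpan k H) ^ n, f ∈ Ring.jacobson (Du k H) ^ n := by
    intro n
    induction n with
    | zero =>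
      intro f _
      rw [Submodule.pow_zero, Ideal.one_eq_top]
      trivial
    | succ n ih =>
      intro f hf
      rw [pow_succ] at hf
      rw [Submodule.pow_succ]
      induction hf using Submodule.mul_induction_on' with
      | mem_mul_mem a ha b hb => exact Submodule.mul_mem_mul (ih a ha) (hle b hb)
      | add a _ b _ ha hb => exact Ideal.add_mem _ ha hb
  refine ⟨n, eq_bot_iff.2 fun f hf => ?_⟩
  have := hpow n f hf
  rw [hn] at this
  exact this

end Simple

section Orbits

variable {k : Type} [Field k] {H : Type} [Ring H] [HopfAlgebra k H]

theorem lact_mul_groupLike (f : Du k H) (x : H) (g : GroupLike k H) :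
    lact f (x * g.val) =
      lact (toConv (f.ofConv ∘ₗ LinearMap.mulRight k g.val) : Du k H) x * g.val := by
  rw [lact_apply, sw_mul (by constructor <;> intro <;> fun_prop), lact_apply, sw_mul_const]
  refine sw_congr fun a b => ?_
  rw [sw_eq_of_comul (by constructor <;> intro <;> fun_prop) g.2.comul_eq_tmul_self,
    smul_mul_assoc]
  rfl

theorem ract_mul_groupLike (f : Du k H) (x : H) (g : GroupLike k H) :
    ract f (x * g.val) =
      ract (toConv (f.ofConv ∘ₗ LinearMap.mulRight k g.val) : Du k H) x * g.val := by
  rw [ract_apply, sw_mul (by constructor <;> intro <;> fun_prop), ract_apply, sw_mul_const]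
  refine sw_congr fun a b => ?_
  rw [sw_eq_of_comul (by constructor <;> intro <;> fun_prop) g.2.comul_eq_tmul_self,
    smul_mul_assoc]
  rfl

/-- Right translation of a subspace by a group-like element. -/
noncomputable def translate (g : GroupLike k H) (C : Submodule k H) : Submodule k H :=
  C.map (LinearMap.mulRight k g.val)

theorem mem_translate {g : GroupLike k H} {C : Submodule k H} {x : H} :
    x ∈ translate g C ↔ x * (g⁻¹).val ∈ C := by
  constructor
  · rintro ⟨y, hy, rfl⟩
    rw [LinearMap.mulRight_apply, mul_assoc, ← GroupLike.val_mul, mul_inv_cancel,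
      GroupLike.val_one, mul_one]
    exact hy
  · intro h
    refine ⟨_, h, ?_⟩
    rw [LinearMap.mulRight_apply, mul_assoc, ← GroupLike.val_mul, inv_mul_cancel,
      GroupLike.val_one, mul_one]

theorem translate_translate (g h : GroupLike k H) (C : Submodule k H) :
    translate g (translate h C) = translate (h * g) C := by
  ext x
  rw [mem_translate, mem_translate, mem_translate, mul_assoc, ← GroupLike.val_mul, mul_inv_rev]

theorem translate_one (C : Submodule k H) : translate 1 C = C := by
  ext x
  rw [mem_translate]
  simp

theorem translate_mono (g : GroupLike k H) {C D : Submodule k H} (h : C ≤ D) :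
    translate g C ≤ translate g D := Submodule.map_mono h

theorem Stable.translate {C : Submodule k H} (hC : Stable C) (g : GroupLike k H) :
    Stable (translate g C) := by
  rintro f _ ⟨x, hx, rfl⟩
  rw [LinearMap.mulRight_apply, lact_mul_groupLike, ract_mul_groupLike]
  exact ⟨⟨_, (hC _ x hx).1, rfl⟩, ⟨_, (hC _ x hx).2, rfl⟩⟩

theorem translate_bot (g : GroupLike k H) : translate g ⊥ = ⊥ := Submodule.map_bot _

theorem finrank_translate (g : GroupLike k H) (C : Submodule k H) :
    Module.finrank k (translate g C) = Module.finrank k C := by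
  refine (Submodule.equivMapOfInjective _ (fun x y h => ?_) C).finrank_eq.symm
  have h' : x * g.val = y * g.val := h
  have := congrArg (· * (g⁻¹).val) h'
  simpa only [mul_assoc, ← GroupLike.val_mul, mul_inv_cancel, GroupLike.val_one, mul_one] using this

variable [FiniteDimensional k H]

theorem isSimple_translate {C : Submodule k H}
    (hC : IsSimpleSubcoalgebraOf (comul (R := k) (A := H)) C) (g : GroupLike k H) :
    IsSimpleSubcoalgebraOf (comul (R := k) (A := H)) (translate g C) := by
  have inv : ∀ D, translate g (translate g⁻¹ D) = D := fun D => by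
    rw [translate_translate, inv_mul_cancel, translate_one]
  have inv' : ∀ D, translate g⁻¹ (translate g D) = D := fun D => by
    rw [translate_translate, mul_inv_cancel, translate_one]
  refine ⟨isSubcoalgebraOf_iff.2 ((isSubcoalgebraOf_iff.1 hC.1).translate g), fun h => hC.2.1 ?_,
    fun D hD hle => ?_⟩
  · rw [← inv' C, h, translate_bot]
  · have h1 := translate_mono g⁻¹ hle
    rw [inv'] at h1
    rcases hC.2.2 _ (isSubcoalgebraOf_iff.2 ((isSubcoalgebraOf_iff.1 hD).translate g⁻¹)) h1
      with h | h
    · left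
      rw [← inv D, h, translate_bot]
    · right
      rw [← inv D, h]

variable [IsAlgClosed k] [CharZero k]

theorem exists_orbit_bound {C : Submodule k H}
    (hC : IsSimpleSubcoalgebraOf (comul (R := k) (A := H)) C) {N : ℕ}
    (hN : Module.finrank k C = N) (hN1 : N ≠ 1) :
    ∃ s, 1 ≤ s ∧ s ≤ Nat.card (GroupLike k H) ∧ Nat.card (GroupLike k H) ∣ N * s ∧
      Nat.card (GroupLike k H) + N * s ≤ Module.finrank k H ∧
      (Nat.card (GroupLike k H) + N * s = Module.finrank k H →
        Ring.jacobson (Du k H) = ⊥) := by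
  classical
  have := Fintype.ofFinite (GroupLike k H)
  let S : Finset (Submodule k H) := Finset.univ.image fun g : GroupLike k H => translate g C
  have hS : ∀ E, E ∈ S ↔ ∃ g : GroupLike k H, translate g C = E := fun E => by simp [S]
  have hsimple : ∀ E ∈ S, IsSimpleSubcoalgebraOf (comul (R := k) (A := H)) E := fun E hE => by
    obtain ⟨g, rfl⟩ := (hS E).1 hE
    exact isSimple_translate hC g
  have hfin : ∀ E ∈ S, Module.finrank k E = N := fun E hE => by
    obtain ⟨g, rfl⟩ := (hS E).1 hE
    rw [finrank_translate, hN]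
  have hnot : ∀ E ∈ S, ¬ E ≤ glSpan k H := fun E hE hle => by
    have key : ∀ t : Finset (GroupLike k H),
        ¬ E ≤ t.sup fun g => Submodule.span k {g.val} := by
      intro t
      induction t using Finset.induction_on with
      | empty => exact fun h => (hsimple E hE).2.1 (by simpa using h)
      | insert g t hg ih =>
        intro h
        rw [Finset.sup_insert] at h
        rcases le_or_le_of_le_sup (hsimple E hE) (stable_span_groupLike g)
          (stable_finset_sup t fun g _ => stable_span_groupLike g) h with h1 | h1
        · rcases (isSimple_span_groupLike g).2.2 E (hsimple E hE).1 h1 with h2 | h2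
          · exact (hsimple E hE).2.1 h2
          · exact hN1 (by rw [← hfin E hE, h2, finrank_span_groupLike])
        · exact ih h1
    refine key Finset.univ (hle.trans ?_)
    refine Submodule.span_le.2 ?_
    rintro _ ⟨g, rfl⟩
    exact Finset.le_sup (f := fun g : GroupLike k H => Submodule.span k {g.val})
      (Finset.mem_univ g) (Submodule.mem_span_singleton_self _)
  have hst : Stable (S.sup id) := stable_finset_sup S fun E hE =>
    isSubcoalgebraOf_iff.1 (hsimple E hE).1
  have h1 := finrank_sup_sup stable_glSpan S hsimple hfin hnot
  have h2 := finrank_sup_sup stable_bot S hsimple hfin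
    fun E hE h => (hsimple E hE).2.1 (le_bot_iff.1 h)
  rw [bot_sup_eq, finrank_bot, zero_add] at h2
  rw [finrank_glSpan] at h1
  refine ⟨S.card, ?_, ?_, ?_, ?_, ?_⟩
  · exact Finset.card_pos.2 ⟨C, (hS C).2 ⟨1, translate_one C⟩⟩
  · rw [Nat.card_eq_fintype_card]
    exact Finset.card_image_le
  · rw [← h2]
    refine card_dvd_finrank _ (fun g x hx => ?_) (isSubcoalgebraOf_iff.2 hst)
    have : translate g (S.sup id) ≤ S.sup id := by
      unfold translate
      rw [Finset.sup_eq_iSup, Submodule.map_iSup]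
      refine iSup_le fun E => ?_
      rw [Submodule.map_iSup]
      refine iSup_le fun hE => ?_
      obtain ⟨h, rfl⟩ := (hS E).1 hE
      change translate g (translate h C) ≤ _
      rw [translate_translate, ← Finset.sup_eq_iSup]
      exact Finset.le_sup (f := id) ((hS _).2 ⟨_, rfl⟩)
    exact this ⟨x, hx, rfl⟩
  · rw [← h1]
    exact Submodule.finrank_le _
  · intro heq
    rw [← h1] at heq
    have htop := Submodule.eq_top_of_finrank_eq heq
    rw [eq_bot_iff]
    intro f hf
    have hf1 : glSpan k H ⊔ S.sup id ≤ LinearMap.ker f.ofConv := by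
      refine sup_le (Submodule.span_le.2 ?_) (Finset.sup_le fun E hE x hx => ?_)
      · rintro _ ⟨g, rfl⟩
        exact jacobson_apply_eq_zero (isSimple_span_groupLike g) hf
          (Submodule.mem_span_singleton_self _)
      · exact jacobson_apply_eq_zero (hsimple E hE) hf hx
    exact (Submodule.mem_bot _).2 (du_ext fun x => hf1 (htop ▸ Submodule.mem_top))

theorem exists_orbit_of_not_pointed (hp : ¬ IsPointedOf (comul (R := k) (A := H))) :
    ∃ n s, 2 ≤ n ∧ 1 ≤ s ∧ s ≤ Nat.card (GroupLike k H) ∧ Nat.card (GroupLike k H) ∣ n ^ 2 * s ∧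
      Nat.card (GroupLike k H) + n ^ 2 * s ≤ Module.finrank k H ∧
      (Nat.card (GroupLike k H) + n ^ 2 * s = Module.finrank k H →
        Ring.jacobson (Du k H) = ⊥) := by
  unfold IsPointedOf at hp
  push Not at hp
  obtain ⟨C, hC, h1⟩ := hp
  obtain ⟨n, hn⟩ := exists_finrank_eq_sq hC
  obtain ⟨s, hs⟩ := exists_orbit_bound hC hn (hn ▸ h1)
  refine ⟨n, s, ?_, hs⟩
  by_contra! hlt
  interval_cases n
  · rw [zero_pow two_ne_zero] at hn
    exact hC.2.1 (Submodule.finrank_eq_zero.1 hn)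
  · exact h1 hn

theorem card_dvd_finrank_top : Nat.card (GroupLike k H) ∣ Module.finrank k H :=
  ⟨_, finrank_eq_card_mul_fixed⟩

theorem isPointed_of_card_eq_finrank (h : Nat.card (GroupLike k H) = Module.finrank k H) :
    IsPointedOf (comul (R := k) (A := H)) := by
  by_contra hp
  obtain ⟨n, s, hn, hs, -, -, hle, -⟩ := exists_orbit_of_not_pointed hp
  have : 0 < n ^ 2 * s := by positivity
  omega

theorem isPointed_of_card_eq_two_mul {p : ℕ} (hp : p.Prime) (hodd : Odd p)
    (hdim : Module.finrank k H = 4 * p) (h : Nat.card (GroupLike k H) = 2 * p) :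
    IsPointedOf (comul (R := k) (A := H)) := by
  by_contra hnp
  obtain ⟨n, s, hn, hs, -, hdvd, hle, -⟩ := exists_orbit_of_not_pointed hnp
  have hpos : 0 < n ^ 2 * s := by positivity
  rw [h] at hdvd hle
  have heq : n ^ 2 * s = 2 * p := le_antisymm (by omega) (Nat.le_of_dvd hpos hdvd)
  have hsq : Squarefree (2 * p) := by
    rw [Nat.squarefree_mul (Nat.coprime_two_left.2 hodd)]
    exact ⟨Nat.prime_two.squarefree, hp.squarefree⟩
  have := hsq n ⟨s, by rw [← heq]; ring⟩
  rw [Nat.isUnit_iff] at this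
  omega

end Orbits

section Average

variable {k : Type} [Field k] [CharZero k] [IsAlgClosed k] {H : Type} [Ring H] [HopfAlgebra k H]
  [FiniteDimensional k H]

noncomputable instance : Fintype (GroupLike k H) := Fintype.ofFinite _

/-- The idempotent `(1 / |G|) ∑ g` attached to the group of group-like elements. -/
noncomputable def avg (k H : Type) [Field k] [CharZero k] [IsAlgClosed k] [Ring H]
    [HopfAlgebra k H] [FiniteDimensional k H] : H :=
  (Nat.card (GroupLike k H) : k)⁻¹ • ∑ g : GroupLike k H, g.val

theorem card_groupLike_ne_zero : (Nat.card (GroupLike k H) : k) ≠ 0 :=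
  Nat.cast_ne_zero.2 Nat.card_pos.ne'

theorem avg_mul (g : GroupLike k H) : avg k H * g.val = avg k H := by
  rw [avg, smul_mul_assoc, Finset.sum_mul]
  congr 1
  exact Fintype.sum_equiv (Equiv.mulRight g) _ _ fun x => by simp

theorem mul_avg (g : GroupLike k H) : g.val * avg k H = avg k H := by
  rw [avg, mul_smul_comm, Finset.mul_sum]
  congr 1
  exact Fintype.sum_equiv (Equiv.mulLeft g) _ _ fun x => by simp

theorem counit_groupLike (g : GroupLike k H) : counit (R := k) g.val = 1 := g.2.counit_eq_one

theorem counit_avg : counit (R := k) (avg k H) = 1 := by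
  simp only [avg, map_smul, map_sum, counit_groupLike]
  simp only [Finset.sum_const, Finset.card_univ, ← Nat.card_eq_fintype_card, smul_eq_mul,
    nsmul_eq_mul, mul_one]
  exact inv_mul_cancel₀ card_groupLike_ne_zero

theorem mul_avg_of_forall {x : H} (h : ∀ g : GroupLike k H, x * g.val = x) :
    x * avg k H = x := by
  simp only [avg, mul_smul_comm, Finset.mul_sum, h]
  simp only [Finset.sum_const, Finset.card_univ, ← Nat.card_eq_fintype_card]
  rw [← Nat.cast_smul_eq_nsmul k, smul_smul, inv_mul_cancel₀ card_groupLike_ne_zero, one_smul]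

theorem avg_mul_avg : avg k H * avg k H = avg k H := mul_avg_of_forall avg_mul

theorem mem_invariants_rightRep {x : H} :
    x ∈ (rightRep k H).invariants ↔ x * avg k H = x := by
  constructor
  · intro h
    refine mul_avg_of_forall fun g => ?_
    have := h g⁻¹
    rwa [rightRep_apply, inv_inv] at this
  · intro h g
    rw [rightRep_apply, ← h, mul_assoc, avg_mul]

theorem antipodeSq_groupLike (g : GroupLike k H) : antipodeSq k H g.val = g.val := by
  rw [antipodeSq_apply, ← GroupLike.val_inv, ← GroupLike.val_inv, inv_inv]

theorem antipodeSq_avg : antipodeSq k H (avg k H) = avg k H := by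
  simp only [avg, map_smul, map_sum, antipodeSq_groupLike]

/-- The operator `x ↦ S²(x) e`. -/
noncomputable def sqAvg (k H : Type) [Field k] [CharZero k] [IsAlgClosed k] [Ring H]
    [HopfAlgebra k H] [FiniteDimensional k H] : Module.End k H :=
  LinearMap.mulRight k (avg k H) * (antipodeSq k H).toLinearMap

theorem sqAvg_apply (x : H) : sqAvg k H x = antipodeSq k H x * avg k H := rfl

theorem sqAvg_mem (x : H) : sqAvg k H x ∈ (rightRep k H).invariants := by
  rw [mem_invariants_rightRep, sqAvg_apply, mul_assoc, avg_mul_avg]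

theorem sqAvg_of_mem {x : H} (hx : x ∈ (rightRep k H).invariants) :
    sqAvg k H x = antipodeSq k H x := by
  rw [mem_invariants_rightRep] at hx
  rw [sqAvg_apply, ← antipodeSq_avg, ← map_mul, hx]

/-- The square of the antipode on the right ideal fixed by the group-like elements. -/
noncomputable def sqInv (k H : Type) [Field k] [CharZero k] [IsAlgClosed k] [Ring H]
    [HopfAlgebra k H] [FiniteDimensional k H] : Module.End k (rightRep k H).invariants :=
  (sqAvg k H).restrict fun x _ => sqAvg_mem x

theorem sqInv_val (x : (rightRep k H).invariants) : (sqInv k H x : H) = antipodeSq k H x :=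
  sqAvg_of_mem x.2

theorem sqInv_pow_val (n : ℕ) (x : (rightRep k H).invariants) :
    ((sqInv k H ^ n) x : H) = ((antipodeSq k H).toLinearMap ^ n) x := by
  induction n with
  | zero => simp
  | succ n ih =>
    rw [pow_succ', pow_succ', Module.End.mul_apply, Module.End.mul_apply, sqInv_val, ih]
    rfl

theorem trace_sqInv (hns : ¬ IsSemisimpleRing H) :
    LinearMap.trace k _ (sqInv k H) = 0 := by
  rw [sqInv, LinearMap.trace_restrict_eq_of_forall_mem]
  · have := trF_eq_zero_of_isChar (k := k) hns isChar_one (avg k H)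
    rwa [trF, lact_one, mul_one] at this

theorem isChar_coe (u : charGroup k H) : IsChar u.1.val := u.2

theorem charGroup_pow_apply (u : charGroup k H) (g : GroupLike k H) (n : ℕ) :
    (u ^ n).1.val g.val = u.1.val g.val ^ n := by
  have h : ∀ n, lact (u.1.val ^ n) g.val = u.1.val g.val ^ n • g.val := by
    intro n
    rw [lact_pow]
    induction n with
    | zero => simp
    | succ n ih =>
      rw [pow_succ', Module.End.mul_apply, ih, map_smul, lact_groupLike, smul_smul, pow_succ]
  have := congrArg (counit (R := k)) (h n)
  rw [counit_lact] at this
  simp only [map_smul, counit_groupLike, smul_eq_mul, mul_one] at this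
  simpa using this

theorem card_groupLike_ne_four {p : ℕ} (hp : p.Prime) (hodd : Odd p)
    (hdim : Module.finrank k H = 4 * p) (hns : ¬ IsSemisimpleRing H) :
    Nat.card (GroupLike k H) ≠ 4 := by
  intro h4
  obtain ⟨α, g, hpow⟩ := exists_antipodeSq_pow k H
  have hdvd : orderOf α ∣ 4 * p := by
    rw [← hdim, finrank_eq_card_mul_charRep (Subgroup.zpowers α), Nat.card_zpowers]
    exact Dvd.intro _ rfl
  by_cases hpm : p ∣ orderOf α
  · let α' : charGroup k H := α ^ (orderOf α / p)
    have hα' : orderOf α' = p := orderOf_pow_orderOf_div (orderOf_pos α).ne' hpm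
    let L := Subgroup.zpowers α'
    have hL : Nat.card L = p := by rw [Nat.card_zpowers, hα']
    have hp0 : (p : k) ≠ 0 := Nat.cast_ne_zero.2 hp.ne_zero
    let _ : Fintype L := Fintype.ofFinite L
    let V := (charRep L).invariants
    have hV : Module.finrank k V = 4 := by
      have := finrank_eq_card_mul_charRep L
      rw [hdim, hL, mul_comm] at this
      exact (Nat.eq_of_mul_eq_mul_left hp.pos this).symm
    have hone : ∀ g : GroupLike k H, α'.1.val g.val = 1 := by
      intro g
      have h1 : α'.1.val g.val ^ p = 1 := by
        rw [← charGroup_pow_apply, ← hα', pow_orderOf_eq_one]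
        exact g.2.counit_eq_one
      have h2 : α'.1.val g.val ^ 4 = 1 := by
        have h3 : g ^ 4 = 1 := by rw [← h4]; exact pow_card_eq_one'
        let φ : H →* k := ⟨⟨fun x => α'.1.val x, α'.2.1⟩, α'.2.2⟩
        have : φ g.val ^ 4 = 1 := by
          rw [← map_pow, ← GroupLike.val_pow, h3, GroupLike.val_one, map_one]
        exact this
      have hc : Nat.gcd p 4 = 1 := by
        have : Nat.Coprime p (2 ^ 2) := Nat.Coprime.pow_right 2 (Nat.coprime_two_right.2 hodd)
        exact this
      have := (pow_gcd_eq_one (a := α'.1.val g.val)).2 ⟨h1, h2⟩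
      rwa [hc, pow_one] at this
    have hLone : ∀ (u : L) (g : GroupLike k H), u.1.1.val g.val = 1 := by
      rintro ⟨u, hu⟩ g
      obtain ⟨n, rfl⟩ := (Submonoid.mem_powers_iff _ _).1 (mem_powers_iff_mem_zpowers.2 hu)
      simp only [charGroup_pow_apply, hone, one_pow]
    have hGV : glSpan k H = V := by
      refine Submodule.eq_of_le_of_finrank_eq ?_ (by rw [finrank_glSpan, h4, hV])
      refine Submodule.span_le.2 ?_
      rintro _ ⟨g, rfl⟩ u
      rw [charRep_apply, lact_groupLike, hLone, one_smul]
    let β : Du k H := (p : k)⁻¹ • ∑ u : L, u.1.1.val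
    have hβV : ∀ x, lact β x ∈ V := by
      intro x u
      rw [charRep_apply, ← Module.End.mul_apply, ← lact_mul]
      congr 2
      simp only [β]
      rw [smul_mul_assoc, Finset.sum_mul]
      congr 1
      exact Fintype.sum_equiv (Equiv.mulRight u⁻¹) _ _ fun v => by simp
    have hβe : β (avg k H) = 1 := by
      have h1 : ∀ u : L, u.1.1.val (avg k H) = 1 := by
        intro u
        change u.1.1.val.ofConv (avg k H) = 1
        rw [avg, map_smul, map_sum]
        have : ∀ g : GroupLike k H, u.1.1.val.ofConv g.val = 1 := hLone u
        simp only [this, Finset.sum_const, Finset.card_univ, ← Nat.card_eq_fintype_card,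
          smul_eq_mul, nsmul_eq_mul, mul_one]
        exact inv_mul_cancel₀ card_groupLike_ne_zero
      simp only [β, du_smul_apply, du_sum_apply, h1]
      simp only [Finset.sum_const, Finset.card_univ, ← Nat.card_eq_fintype_card, hL,
        nsmul_eq_mul, mul_one]
      exact inv_mul_cancel₀ hp0
    have hgl : ∀ y ∈ glSpan k H, antipodeSq k H y * avg k H = counit (R := k) y • avg k H := by
      intro y hy
      induction hy using Submodule.span_induction with
      | mem x h =>
        obtain ⟨g, rfl⟩ := h
        rw [antipodeSq_groupLike, mul_avg, counit_groupLike, one_smul]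
      | zero => simp
      | add x y _ _ hx hy => rw [map_add, add_mul, hx, hy, map_add, add_smul]
      | smul a x _ hx => rw [map_smul, smul_mul_assoc, hx, map_smul, smul_eq_mul, mul_smul]
    have htr : trF β (avg k H) = 1 := by
      have : LinearMap.mulRight k (avg k H) * (antipodeSq k H).toLinearMap * lact β =
          β.ofConv.smulRight (avg k H) := by
        ext x
        have := hgl (lact β x) (hGV ▸ hβV x)
        rw [counit_lact] at this
        exact this
      rw [trF, this, LinearMap.trace_smulRight]
      exact hβe
    have h0 : trF β (avg k H) = 0 := by
      have hl : Lin k fun γ : Du k H => trF γ (avg k H) :=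
        ⟨fun β γ => trF_add β γ _, fun c β => trF_smul c β _⟩
      simp only [β, trF_smul, hl.map_sum]
      rw [Finset.sum_eq_zero fun u _ => trF_eq_zero_of_isChar hns (isChar_coe u.1) _, mul_zero]
    exact one_ne_zero (htr.symm.trans h0)
  · have hα : α ^ 4 = 1 := by
      rw [← orderOf_dvd_iff_pow_eq_one]
      exact Nat.Coprime.dvd_of_dvd_mul_right ((Nat.Prime.coprime_iff_not_dvd hp).2 hpm).symm hdvd
    have h8 := hpow 4 hα (by rw [← h4]; exact pow_card_eq_one')
    have hT : sqInv k H ^ 2 ^ 3 = 1 := by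
      ext x
      rw [sqInv_pow_val]
      exact LinearMap.congr_fun h8 x.1
    refine trace_ne_zero_of_odd hT ?_ (trace_sqInv hns)
    have := finrank_eq_card_mul_fixed (k := k) (H := H)
    rw [hdim, h4] at this
    rwa [← Nat.eq_of_mul_eq_mul_left (by norm_num) this]

end Average

theorem exists_mul_mul_eq_of_isSemisimpleRing {A : Type} [Ring A] [IsSemisimpleRing A] (n : A) :
    ∃ a, n * a * n = n := by
  obtain ⟨I, hI⟩ := exists_isCompl (Ideal.span {n})
  have h1 : (1 : A) ∈ Ideal.span {n} ⊔ I := by rw [hI.sup_eq_top]; trivial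
  obtain ⟨f, hf, f', hf', h⟩ := Submodule.mem_sup.1 h1
  obtain ⟨a, rfl⟩ := Ideal.mem_span_singleton'.1 hf
  have h2 : n - n * a * n = n * f' := by
    rw [← eq_sub_iff_add_eq'] at h
    rw [h, mul_sub, mul_one, mul_assoc]
  have h3 : n - n * a * n ∈ Ideal.span {n} ⊓ I := by
    refine ⟨?_, h2 ▸ I.mul_mem_left n hf'⟩
    exact sub_mem (Ideal.mem_span_singleton_self n)
      (Ideal.mul_mem_left _ _ (Ideal.mem_span_singleton_self n))
  rw [hI.inf_eq_bot] at h3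
  exact ⟨a, (sub_eq_zero.1 h3).symm⟩

theorem jacobson_eq_bot_of_average {A R : Type} [Ring A] [IsSemisimpleRing A] [Ring R]
    (ι : R →+* A) (E : A → R) (hE : ∀ b a c, E (ι b * a * ι c) = b * E a * c)
    (h1 : E 1 = 1) : Ring.jacobson R = ⊥ := by
  rw [eq_bot_iff]
  intro n hn
  obtain ⟨a, ha⟩ := exists_mul_mul_eq_of_isSemisimpleRing (ι n)
  have h2 : n * E a * n = n := by
    rw [← hE, ha]
    have := hE n 1 1
    simpa [h1] using this
  obtain ⟨z, hz⟩ := exists_mul_eq_one_of_add_mem_jacobson (a := 1 - E a * n) (r := E a * n)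
    (Ideal.mul_mem_left _ _ hn) (sub_add_cancel _ _)
  have hr : n * E a ∈ Ring.jacobson R := Ideal.mul_mem_right _ _ hn
  obtain ⟨w, hw⟩ := exists_mul_eq_one_of_add_mem_jacobson (a := 1 - n * E a) (r := n * E a)
    hr (sub_add_cancel _ _)
  have h3 : (1 - n * E a) * n = 0 := by rw [sub_mul, one_mul, h2, sub_self]
  have : w * ((1 - n * E a) * n) = n := by rw [← mul_assoc, hw, one_mul]
  rw [h3, mul_zero] at this
  exact this.symm

section Split

variable {k : Type} [Field k] [CharZero k]

theorem trace_ne_zero_of_pi {n : ℕ} (τ : (Fin n → k) →ₐ[k] (Fin n → k)) (χ : (Fin n → k) →ₐ[k] k)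
    (hχ : ∀ x, χ (τ x) = χ x) : LinearMap.trace k _ τ.toLinearMap ≠ 0 := by
  classical
  let E : Fin n → (Fin n → k) := fun i => Pi.single i 1
  have hE : ∀ i, E i * E i = E i := fun i => by simp [E, ← Pi.single_mul]
  have hx : ∀ x i, x * E i = x i • E i := by
    intro x i
    funext j
    by_cases h : j = i
    · subst h; simp [E]
    · simp [E, h]
  have h0 : ∃ i, χ (E i) ≠ 0 := by
    by_contra! h
    have : χ 1 = 0 := by
      have h1 : (1 : Fin n → k) = ∑ i, E i := by
        simp only [E]
        exact (Finset.univ_sum_single (1 : Fin n → k)).symm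
      rw [h1, map_sum, Finset.sum_eq_zero fun i _ => h i]
    simp at this
  obtain ⟨i, hi⟩ := h0
  have hval : ∀ x, χ x = x i := by
    intro x
    have := congrArg χ (hx x i)
    rw [map_mul, map_smul, smul_eq_mul] at this
    exact mul_right_cancel₀ hi this
  have h01 : ∀ j, τ (E j) j = 0 ∨ τ (E j) j = 1 := by
    intro j
    rw [← IsIdempotentElem.iff_eq_zero_or_one]
    have := congrFun (congrArg τ (hE j)) j
    rwa [map_mul] at this
  have hi1 : τ (E i) i = 1 := by
    rw [← hval (τ (E i)), hχ, hval]
    simp [E]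
  have htr : LinearMap.trace k _ τ.toLinearMap = ∑ j, τ (E j) j := by
    rw [LinearMap.trace_eq_matrix_trace k (Pi.basisFun k (Fin n)), Matrix.trace]
    simp [E]
  have hnat : ∀ j, ∃ m : ℕ, τ (E j) j = m := by
    intro j
    rcases h01 j with h | h
    · exact ⟨0, by simpa using h⟩
    · exact ⟨1, by simpa using h⟩
  choose m hm using hnat
  rw [htr, Finset.sum_congr rfl fun j _ => hm j, ← Nat.cast_sum, Nat.cast_ne_zero]
  have hmi : m i = 1 := by
    have := hm i
    rw [hi1] at this
    exact_mod_cast this.symm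
  have := Finset.single_le_sum (f := m) (fun j _ => Nat.zero_le _) (Finset.mem_univ i)
  omega

theorem trace_ne_zero_of_finrank_eq_four [IsAlgClosed k] {R : Type} [Ring R] [Algebra k R]
    [IsSemisimpleRing R] [FiniteDimensional k R] (hR : Module.finrank k R = 4) (τ : R →ₐ[k] R)
    (χ : R →ₐ[k] k) (hχ : ∀ x, χ (τ x) = χ x) : LinearMap.trace k _ τ.toLinearMap ≠ 0 := by
  classical
  obtain ⟨n, d, hd, ⟨e⟩⟩ := IsSemisimpleRing.exists_algEquiv_pi_matrix_of_isAlgClosed k R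
  have hsum : ∑ i, d i ^ 2 = 4 := by
    rw [← hR, e.toLinearEquiv.finrank_eq, Module.finrank_pi_fintype]
    simp [Module.finrank_matrix, sq]
  let χ' : ((i : Fin n) → Matrix (Fin (d i)) (Fin (d i)) k) →ₐ[k] k := χ.comp e.symm.toAlgHom
  have h0 : ∃ i, χ' (Pi.single i 1) ≠ 0 := by
    by_contra! h
    have h2 : χ' 1 = 0 := by
      rw [← Finset.univ_sum_single (1 : (i : Fin n) → Matrix (Fin (d i)) (Fin (d i)) k), map_sum]
      exact Finset.sum_eq_zero fun i _ => h i
    rw [map_one] at h2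
    exact one_ne_zero h2
  obtain ⟨i, hi⟩ := h0
  have hidem : χ' (Pi.single i 1) = 1 := by
    have : χ' (Pi.single i 1) * χ' (Pi.single i 1) = χ' (Pi.single i 1) := by
      rw [← map_mul, ← Pi.single_mul, one_mul]
    exact mul_right_cancel₀ hi (by rw [this, one_mul])
  let ψ : Matrix (Fin (d i)) (Fin (d i)) k →+* k :=
    { toFun := fun a => χ' (Pi.single i a)
      map_one' := hidem
      map_mul' := fun a b => by rw [Pi.single_mul, map_mul]
      map_zero' := by simp
      map_add' := fun a b => by rw [Pi.single_add, map_add] }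
  have hdi : d i = 1 := by
    have := hd i
    have hinj : Function.Injective ψ := ψ.injective
    let ψ' : Matrix (Fin (d i)) (Fin (d i)) k →ₗ[k] k :=
      χ'.toLinearMap ∘ₗ LinearMap.single k (fun i => Matrix (Fin (d i)) (Fin (d i)) k) i
    have h1 := LinearMap.finrank_le_finrank_of_injective (f := ψ') hinj
    rw [Module.finrank_matrix] at h1
    simp only [Fintype.card_fin, Module.finrank_self, mul_one] at h1
    have : 0 < d i := Nat.pos_of_ne_zero (hd i).ne
    nlinarith
  have hall : d = fun _ => 1 := by
    funext j
    by_contra hj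
    have hji : j ≠ i := fun h => hj (h ▸ hdi)
    have hjp : 0 < d j := Nat.pos_of_ne_zero (hd j).ne
    have := Finset.add_le_sum (f := fun i => d i ^ 2) (s := Finset.univ) (fun j _ => Nat.zero_le _)
      (Finset.mem_univ i) (Finset.mem_univ j) hji.symm
    rw [hsum, hdi] at this
    have hj2 : 2 ≤ d j := by omega
    nlinarith
  subst hall
  let u : k ≃ₐ[k] Matrix (Fin 1) (Fin 1) k :=
    AlgEquiv.ofBijective (Algebra.ofId k (Matrix (Fin 1) (Fin 1) k))
      ⟨(Algebra.ofId k (Matrix (Fin 1) (Fin 1) k)).toRingHom.injective, fun a => ⟨a 0 0, by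
        ext i j
        rw [Subsingleton.elim i 0, Subsingleton.elim j 0]
        simp [Algebra.ofId_apply, Matrix.algebraMap_matrix_apply]⟩⟩
  let e' : R ≃ₐ[k] (Fin n → k) :=
    e.trans (AlgEquiv.piCongrRight fun _ => u.symm)
  have := trace_ne_zero_of_pi ((e'.toAlgHom.comp τ).comp e'.symm.toAlgHom)
    (χ.comp e'.symm.toAlgHom) (by simp [hχ])
  rw [← LinearMap.trace_conj' τ.toLinearMap e'.toLinearEquiv]
  exact this

theorem trace_mul_ne_zero_of_projection [IsAlgClosed k] {A : Type} [Ring A] [Algebra k A]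
    [FiniteDimensional k A] [IsSemisimpleRing A] (B : Subalgebra k A) (E : Module.End k A)
    (hE : ∀ x, E x ∈ B) (hEid : ∀ x ∈ B, E x = x)
    (hEmul : ∀ b ∈ B, ∀ a, ∀ c ∈ B, E (b * a * c) = b * E a * c)
    (hEtr : LinearMap.trace k A E = (4 : ℕ)) (F : A →ₐ[k] A) (hF : ∀ x ∈ B, F x ∈ B)
    (χ : A →ₐ[k] k) (hχ : ∀ x, χ (F x) = χ x) :
    LinearMap.trace k A (F.toLinearMap * E) ≠ 0 := by
  have hB : FiniteDimensional k B :=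
    inferInstanceAs (FiniteDimensional k (Subalgebra.toSubmodule B))
  have : IsArtinianRing B := IsArtinianRing.of_finite k B
  have : IsSemisimpleRing B :=
    IsArtinianRing.isSemisimpleRing_iff_jacobson.2
      (jacobson_eq_bot_of_average B.val.toRingHom (fun f => ⟨E f, hE f⟩)
        (fun b a c => Subtype.ext (hEmul b.1 b.2 a c.1 c.2)) (Subtype.ext (hEid _ B.one_mem)))
  have hdim : Module.finrank k B = 4 := by
    have h1 := LinearMap.trace_restrict_eq_of_forall_mem (Subalgebra.toSubmodule B) E hE
    have h2 : E.restrict (p := Subalgebra.toSubmodule B) (q := Subalgebra.toSubmodule B)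
        (fun x _ => hE x) = 1 := LinearMap.ext fun f => Subtype.ext (hEid f.1 f.2)
    rw [h2, LinearMap.trace_one, hEtr, Nat.cast_inj] at h1
    exact h1
  have := trace_ne_zero_of_finrank_eq_four hdim
    ((F.comp B.val).codRestrict B fun f => hF f.1 f.2) (χ.comp B.val) fun x => hχ x.1
  rw [← LinearMap.trace_restrict_eq_of_forall_mem (Subalgebra.toSubmodule B) (F.toLinearMap * E)
    fun x => hF _ (hE x)]
  rw [← LinearMap.trace_conj' _ (Subalgebra.toSubmoduleEquiv B).symm] at this
  convert this using 2
  ext x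
  exact congrArg F (hEid x.1 x.2)

end Split

section CaseThree

variable {k : Type} [Field k] [CharZero k] [IsAlgClosed k] {H : Type} [Ring H] [HopfAlgebra k H]
  [FiniteDimensional k H]

/-- The functional `y ↦ f (y h)`. -/
noncomputable def shiftR (h : H) (f : Du k H) : Du k H :=
  toConv (f.ofConv ∘ₗ LinearMap.mulRight k h)

theorem shiftR_apply (h : H) (f : Du k H) (y : H) : shiftR h f y = f (y * h) := rfl

theorem shiftR_mul (g : GroupLike k H) (f h : Du k H) :
    shiftR g.val (f * h) = shiftR g.val f * shiftR g.val h := by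
  refine du_ext fun y => ?_
  rw [shiftR_apply, du_mul_apply, du_mul_apply, sw_mul (by constructor <;> intro <;> fun_prop)]
  refine sw_congr fun a b => ?_
  exact sw_eq_of_comul (f := fun c d => f (a * c) * h (b * d))
    (by constructor <;> intro <;> fun_prop) g.2.comul_eq_tmul_self

/-- The functionals invariant under right translation by group-like elements. -/
noncomputable def fixedDual (k H : Type) [Field k] [CharZero k] [IsAlgClosed k] [Ring H]
    [HopfAlgebra k H] [FiniteDimensional k H] : Subalgebra k (Du k H) where
  carrier := {f | ∀ g : GroupLike k H, shiftR g.val f = f}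
  mul_mem' hf hh g := by rw [shiftR_mul, hf g, hh g]
  add_mem' hf hh g := by
    refine du_ext fun y => ?_
    rw [shiftR_apply, du_add_apply, du_add_apply, ← shiftR_apply, ← shiftR_apply, hf g, hh g]
  algebraMap_mem' c g := by
    refine du_ext fun y => ?_
    rw [shiftR_apply, Algebra.algebraMap_eq_smul_one, du_smul_apply, du_smul_apply, du_one_apply,
      du_one_apply]
    simp

theorem shiftR_avg (f : Du k H) : shiftR (avg k H) f =
    (Nat.card (GroupLike k H) : k)⁻¹ • ∑ g : GroupLike k H, shiftR g.val f := by
  refine du_ext fun y => ?_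
  rw [shiftR_apply, du_smul_apply, du_sum_apply, avg, mul_smul_comm, Finset.mul_sum]
  simp only [shiftR_apply]
  change f.ofConv _ = _
  rw [map_smul, map_sum, smul_eq_mul]

theorem shiftR_avg_mem (f : Du k H) : shiftR (avg k H) f ∈ fixedDual k H := by
  intro g
  refine du_ext fun y => ?_
  rw [shiftR_apply, shiftR_apply, mul_assoc, mul_avg, shiftR_apply]

theorem shiftR_avg_of_mem {f : Du k H} (hf : f ∈ fixedDual k H) : shiftR (avg k H) f = f := by
  rw [shiftR_avg]
  simp only [hf _, Finset.sum_const, Finset.card_univ, ← Nat.card_eq_fintype_card]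
  rw [← Nat.cast_smul_eq_nsmul k, smul_smul, inv_mul_cancel₀ card_groupLike_ne_zero, one_smul]

theorem shiftR_avg_mul_mul {b c : Du k H} (hb : b ∈ fixedDual k H) (hc : c ∈ fixedDual k H)
    (a : Du k H) : shiftR (avg k H) (b * a * c) = b * shiftR (avg k H) a * c := by
  rw [shiftR_avg, shiftR_avg, mul_smul_comm, smul_mul_assoc, Finset.mul_sum, Finset.sum_mul]
  congr 1
  refine Finset.sum_congr rfl fun g _ => ?_
  rw [shiftR_mul, shiftR_mul, hb g, hc g]

/-- The transpose of the square of the antipode. -/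
noncomputable def sqDual (k H : Type) [Field k] [Ring H] [HopfAlgebra k H] :
    Du k H →ₐ[k] Du k H :=
  AlgHom.ofLinearMap
    { toFun := fun f => toConv (f.ofConv ∘ₗ (antipodeSq k H).toLinearMap)
      map_add' := fun _ _ => rfl
      map_smul' := fun _ _ => rfl }
    (du_ext fun x => counit_antipodeSq x)
    fun f g => du_ext fun x => by
      rw [du_mul_apply]
      change (f * g) (antipodeSq k H x) = _
      rw [du_mul_apply, sw_antipodeSq (by constructor <;> intro <;> fun_prop)]
      rfl

theorem sqDual_apply (f : Du k H) (x : H) : sqDual k H f x = f (antipodeSq k H x) := rfl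

theorem sqDual_mem {f : Du k H} (hf : f ∈ fixedDual k H) : sqDual k H f ∈ fixedDual k H := by
  intro g
  refine du_ext fun y => ?_
  rw [shiftR_apply, sqDual_apply, map_mul, antipodeSq_groupLike, ← shiftR_apply, hf g]
  rfl

theorem trace_dual {F : Module.End k (Du k H)} {T : Module.End k H}
    (h : ∀ f y, F f y = f (T y)) : LinearMap.trace k _ F = LinearMap.trace k _ T := by
  rw [← LinearMap.trace_transpose' T,
    ← LinearMap.trace_conj' F (WithConv.linearEquiv k (H →ₗ[k] k))]
  congr 1
  ext f y
  exact h (toConv f) y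

/-- Averaging of functionals under right translation by group-like elements. -/
noncomputable def shiftRAvg (k H : Type) [Field k] [CharZero k] [IsAlgClosed k] [Ring H]
    [HopfAlgebra k H] [FiniteDimensional k H] : Module.End k (Du k H) where
  toFun := shiftR (avg k H)
  map_add' _ _ := rfl
  map_smul' _ _ := rfl

theorem trace_shiftRAvg (h : Module.finrank k H = 4 * Nat.card (GroupLike k H)) :
    LinearMap.trace k _ (shiftRAvg k H) = (4 : ℕ) := by
  have h4 : ∀ x, LinearMap.mulRight k (avg k H) x ∈ (rightRep k H).invariants := fun x => by
    rw [mem_invariants_rightRep, LinearMap.mulRight_apply, mul_assoc, avg_mul_avg]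
  have h5 := LinearMap.trace_restrict_eq_of_forall_mem _ _ h4
  have h6 : (LinearMap.mulRight k (avg k H)).restrict
      (fun (x : H) (_ : x ∈ (rightRep k H).invariants) => h4 x) = 1 :=
    LinearMap.ext fun f => Subtype.ext (mem_invariants_rightRep.1 f.2)
  have h7 := finrank_eq_card_mul_fixed (k := k) (H := H)
  rw [h, mul_comm] at h7
  rw [trace_dual (T := LinearMap.mulRight k (avg k H)) fun f y => rfl, ← h5,
    h6, LinearMap.trace_one, ← Nat.eq_of_mul_eq_mul_left Nat.card_pos h7]

/-- Evaluation of functionals at `1`. -/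
noncomputable def evalOne (k H : Type) [Field k] [Ring H] [HopfAlgebra k H] : Du k H →ₐ[k] k :=
  AlgHom.ofLinearMap
    { toFun := fun f => f 1
      map_add' := fun _ _ => rfl
      map_smul' := fun _ _ => rfl } (by
        change (1 : Du k H) 1 = 1
        rw [du_one_apply, Bialgebra.counit_one])
      fun f g => by
        change (f * g) 1 = f 1 * g 1
        rw [du_mul_apply, sw_one (by constructor <;> intro <;> fun_prop)]

theorem isSemisimpleRing_of_jacobson_dual (hj : Ring.jacobson (Du k H) = ⊥)
    (h3 : Module.finrank k H = 4 * Nat.card (GroupLike k H)) : IsSemisimpleRing H := by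
  by_contra hns
  have : IsSemisimpleRing (Du k H) := IsArtinianRing.isSemisimpleRing_iff_jacobson.2 hj
  refine trace_mul_ne_zero_of_projection (fixedDual k H) (shiftRAvg k H) shiftR_avg_mem
    (fun f => shiftR_avg_of_mem) (fun b hb a c hc => shiftR_avg_mul_mul hb hc a)
    (trace_shiftRAvg h3) (sqDual k H) (fun f => sqDual_mem) (evalOne k H) (fun f => ?_) ?_
  · change f (antipodeSq k H 1) = f 1
    rw [map_one]
  · rw [trace_dual (T := sqAvg k H) fun f y => rfl, ← trace_sqInv hns, sqInv,
      LinearMap.trace_restrict_eq_of_forall_mem]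

end CaseThree

theorem exists_idempotents {k A G : Type} [Field k] [Ring A] [Algebra k A] [Fintype G]
    [DecidableEq G] (ev : G → A →ₐ[k] k)
    (hs : ∀ a, ∃ f, ∀ b, ev b f = if b = a then 1 else 0)
    (hn : ∀ f, (∀ b, ev b f = 0) → IsNilpotent f) :
    ∃ e : G → A, (∀ a b, e a * e b = if a = b then e a else 0) ∧ ∑ a, e a = 1 ∧
      ∀ a b, ev b (e a) = if b = a then 1 else 0 := by
  let F : A →+* (G → k) := RingHom.pi (fun b => (ev b).toRingHom)
  have hF : ∀ f b, F f b = ev b f := fun f b => rfl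
  obtain ⟨e, he, h⟩ := CompleteOrthogonalIdempotents.lift_of_isNilpotent_ker F
    (fun x hx => hn x (fun b => congrFun (RingHom.mem_ker.1 hx) b))
    (CompleteOrthogonalIdempotents.single (fun _ : G => k)) (fun a => by
      obtain ⟨f, hf⟩ := hs a
      refine ⟨f, funext fun b => ?_⟩
      rw [hF, hf, Pi.single_apply])
  refine ⟨e, he.toOrthogonalIdempotents.mul_eq, he.complete, fun a b => ?_⟩
  have := congrFun (congrFun h a) b
  rw [Pi.single_apply] at this
  exact this

/-- The part `e a * (f - ∑ c, f(c) • e c) * e b` of `f`. -/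
theorem corner_mul {k A G : Type} [Field k] [Ring A] [Algebra k A] [Fintype G]
    [DecidableEq G] (ev : G → A →ₐ[k] k) (e : G → A)
    (he : ∀ a b, e a * e b = if a = b then e a else 0) (f h : A) (a b : G) :
    e a * (f * h - ∑ c, ev c (f * h) • e c) * e b =
      e a * ((f - ∑ c, ev c f • e c) * (h - ∑ c, ev c h • e c)) * e b +
      (ev a f • (e a * (h - ∑ c, ev c h • e c) * e b) +
        ev b h • (e a * (f - ∑ c, ev c f • e c) * e b)) := by
  have h1 : ∀ f a, e a * ∑ c, ev c f • e c = ev a f • e a := by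
    intro f a; simp [Finset.mul_sum, he]
  have h2 : ∀ f a, (∑ c, ev c f • e c) * e a = ev a f • e a := by
    intro f a; simp [Finset.sum_mul, he]
  have h4 : (∑ c, ev c f • e c) * (∑ c, ev c h • e c) = ∑ c, ev c (f * h) • e c := by
    rw [Finset.mul_sum]
    refine Finset.sum_congr rfl fun c _ => ?_
    rw [mul_smul_comm, h2, smul_smul, map_mul, mul_comm]
  have h3 : f * h - ∑ c, ev c (f * h) • e c =
      (f - ∑ c, ev c f • e c) * (h - ∑ c, ev c h • e c) +
      ((∑ c, ev c f • e c) * (h - ∑ c, ev c h • e c) +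
        (f - ∑ c, ev c f • e c) * (∑ c, ev c h • e c)) := by
    rw [← h4]
    noncomm_ring
  rw [h3, mul_add, mul_add, add_mul, add_mul, ← mul_assoc (e a) (∑ c, ev c f • e c), h1,
    mul_assoc (e a) ((f - ∑ c, ev c f • e c) * (∑ c, ev c h • e c)),
    mul_assoc (f - ∑ c, ev c f • e c) (∑ c, ev c h • e c), h2]
  simp [mul_assoc]

section Skew

variable {k : Type} [Field k] {H : Type} [Ring H] [HopfAlgebra k H]

/-- `z` is `(a, b)`-skew primitive: `Δ z = a ⊗ z + z ⊗ b`. -/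
def IsSkew (k : Type) [Field k] {H : Type} [Ring H] [HopfAlgebra k H] (a b z : H) : Prop :=
  ∀ f h : Du k H, (f * h) z = f a * h z + f z * h b

theorem IsSkew.comul_eq [FiniteDimensional k H] {a b z : H} (hz : IsSkew k a b z) :
    comul (R := k) z = a ⊗ₜ[k] z + z ⊗ₜ[k] b := by
  let B := Module.finBasis k H
  refine (B.tensorProduct B).ext_elem fun ij => ?_
  have h := hz (toConv (B.coord ij.1)) (toConv (B.coord ij.2))
  rw [du_mul_apply] at h
  have hl : Lin k (fun t : H ⊗[k] H => (B.tensorProduct B).repr t ij) :=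
    ⟨fun s t => by simp, fun c t => by simp⟩
  have ht : ∀ x y : H, (B.tensorProduct B).repr (x ⊗ₜ[k] y) ij = B.coord ij.1 x * B.coord ij.2 y := by
    intro x y
    rw [Module.Basis.tensorProduct_repr_tmul_apply]
    simp [mul_comm]
  rw [comul_eq_sw, map_sw hl, hl.map_add, ht, ht]
  simp only [ht]
  exact h

theorem IsSkew.sw_eq [FiniteDimensional k H] {M : Type} [AddCommGroup M] [Module k M]
    {a b z : H} (hz : IsSkew k a b z) {F : H → H → M} (hF : Bil k F) :
    sw k z F = F a z + F z b := by
  rw [sw_eq_lift hF, hz.comul_eq, map_add]; rfl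

theorem isSkew_of_comul {a b z : H} (h : comul (R := k) z = a ⊗ₜ[k] z + z ⊗ₜ[k] b) :
    IsSkew k a b z := by
  intro f g
  rw [du_mul_apply, sw_eq_lift (by constructor <;> intro <;> fun_prop), h, map_add]; rfl

theorem IsSkew.groupLike_mul {a b z : H} (hz : IsSkew k a b z) [FiniteDimensional k H]
    (g : GroupLike k H) : IsSkew k (g.val * a) (g.val * b) (g.val * z) := by
  apply isSkew_of_comul
  rw [Bialgebra.comul_mul, hz.comul_eq, g.2.comul_eq_tmul_self, mul_add]
  simp

theorem IsSkew.mul_groupLike {a b z : H} (hz : IsSkew k a b z) [FiniteDimensional k H]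
    (g : GroupLike k H) : IsSkew k (a * g.val) (b * g.val) (z * g.val) := by
  apply isSkew_of_comul
  rw [Bialgebra.comul_mul, hz.comul_eq, g.2.comul_eq_tmul_self, add_mul]
  simp

theorem IsSkew.counit_eq {a b : GroupLike k H} {z : H} (hz : IsSkew k a.val b.val z) :
    counit (R := k) z = 0 := by
  have h := hz 1 1
  rw [mul_one, du_one_apply, du_one_apply, du_one_apply, a.2.counit_eq_one, b.2.counit_eq_one] at h
  linear_combination -h

/-- Evaluation of functionals at a group-like element. -/
noncomputable def evalGL (g : GroupLike k H) : Du k H →ₐ[k] k :=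
  AlgHom.ofLinearMap
    { toFun := fun f => f g.val
      map_add' := fun _ _ => rfl
      map_smul' := fun _ _ => rfl } (by
        change (1 : Du k H) g.val = 1
        rw [du_one_apply, g.2.counit_eq_one])
      fun f h => by
        change (f * h) g.val = f g.val * h g.val
        rw [du_mul_apply, sw_eq_of_comul (by constructor <;> intro <;> fun_prop)
          g.2.comul_eq_tmul_self]

theorem evalGL_apply (g : GroupLike k H) (f : Du k H) : evalGL g f = f g.val := rfl

theorem mem_ann_glSpan {f : Du k H} : f ∈ ann (glSpan k H) ↔ ∀ g : GroupLike k H, f g.val = 0 := by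
  refine ⟨fun h g => h _ (val_mem_glSpan g), fun h x hx => ?_⟩
  induction hx using Submodule.span_induction with
  | mem x hx => obtain ⟨g, rfl⟩ := hx; exact h g
  | zero => exact map_zero f.ofConv
  | add x y _ _ hx hy => exact (map_add f.ofConv x y).trans (by
      rw [show f.ofConv x = 0 from hx, show f.ofConv y = 0 from hy, add_zero])
  | smul c x _ hx => exact (map_smul f.ofConv c x).trans (by
      rw [show f.ofConv x = 0 from hx, smul_zero])

theorem exists_dual_groupLike [FiniteDimensional k H] (a : GroupLike k H) [DecidableEq (GroupLike k H)] :
    ∃ f : Du k H, ∀ b : GroupLike k H, f b.val = if b = a then 1 else 0 := by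
  obtain ⟨L, hL⟩ := LinearMap.exists_leftInverse_of_injective
    (Finsupp.linearCombination k (fun g : GroupLike k H => g.val))
    (LinearMap.ker_eq_bot.2 (linearIndep_groupLikeVal (R := k) (A := H)))
  refine ⟨toConv (Finsupp.lapply a ∘ₗ L), fun b => ?_⟩
  have h := LinearMap.congr_fun hL (Finsupp.single b 1)
  rw [LinearMap.comp_apply, Finsupp.linearCombination_single, one_smul] at h
  change L b.val a = _
  rw [h, LinearMap.id_apply, Finsupp.single_apply]

theorem perp_mul_le [IsAlgClosed k] [FiniteDimensional k H] (hp : IsPointedOf (comul (R := k) (A := H)))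
    {D : Submodule k H} (hG : glSpan k H ≤ D)
    (hD : ∀ (a b : GroupLike k H) z, IsSkew k a.val b.val z → z ∈ D) :
    perp (ann (glSpan k H) * ann (glSpan k H)) ≤ D := by
  classical
  intro y hy
  obtain ⟨n, hn⟩ := exists_ann_glSpan_pow_eq_bot hp
  obtain ⟨e, he, h1, hev⟩ := exists_idempotents (evalGL (k := k) (H := H))
    (fun a => exists_dual_groupLike a)
    (fun f hf => ⟨n, by
      have := Submodule.pow_mem_pow _ (mem_ann_glSpan.2 hf) n
      rwa [hn, Submodule.mem_bot] at this⟩)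
  have hJ : ∀ f : Du k H, f - ∑ c, evalGL (k := k) (H := H) c f • e c ∈ ann (glSpan k H) := by
    intro f
    rw [mem_ann_glSpan]
    intro b
    rw [← evalGL_apply, map_sub, map_sum]
    simp [hev]
  let z : GroupLike k H → GroupLike k H → H := fun a b =>
    lact (e a) (ract (e b) y) - if a = b then e a y • a.val else 0
  have hz : ∀ a b (f : Du k H), f (z a b) = (e a * (f - ∑ c, evalGL (k := k) (H := H) c f • e c) * e b) y := by
    intro a b f
    rw [mul_sub, sub_mul, Finset.mul_sum]
    simp only [mul_smul_comm, he, smul_ite, smul_zero, Finset.sum_ite_eq, Finset.mem_univ, if_true,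
      smul_mul_assoc]
    rw [du_sub_apply, ← apply_ract, ← apply_lact]
    change f.ofConv (_ - _) = _
    rw [map_sub]
    congr 1
    split_ifs with h
    · rw [map_smul, smul_eq_mul, mul_comm]; rfl
    · rw [map_zero]; rfl
  have hsk : ∀ a b, IsSkew k a.val b.val (z a b) := by
    intro a b f h
    rw [hz, hz, hz, corner_mul (evalGL (k := k) (H := H)) e he, du_add_apply, du_add_apply, du_smul_apply,
      du_smul_apply, evalGL_apply, evalGL_apply, mul_comm (h _), ← mul_assoc (e a),
      mul_assoc (e a * _), mem_perp.1 hy _ (Submodule.mul_mem_mul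
        (stable_glSpan.mul_mem_ann' (hJ f) _) (stable_glSpan.mul_mem_ann (hJ h) _)), zero_add]
  have hy' : y = ∑ a, ∑ b, (z a b + if a = b then e a y • a.val else 0) := by
    simp only [z, sub_add_cancel]
    have h2 : ∀ x : H, ∑ b, ract (e b) x = x := fun x => by
      rw [← (show Lin k (fun f : Du k H => ract f x) by fun_prop).map_sum, h1, ract_one]
      rfl
    have h3 : ∀ x : H, ∑ b, lact (e b) x = x := fun x => by
      rw [← (show Lin k (fun f : Du k H => lact f x) by fun_prop).map_sum, h1, lact_one]
      rfl
    simp only [← map_sum, h2, h3]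
  rw [hy']
  refine sum_mem fun a _ => sum_mem fun b _ => add_mem (hD a b _ (hsk a b)) ?_
  split_ifs
  · exact D.smul_mem _ (hG (val_mem_glSpan a))
  · exact D.zero_mem

theorem eq_bot_of_le_mul {A : Type} [Ring A] [Algebra k A] {J K : Submodule k A} {n : ℕ}
    (hn : J ^ n = ⊥) (h : K ≤ J * K) : K = ⊥ := by
  have h1 : ∀ m : ℕ, K ≤ J ^ m * K := by
    intro m
    induction m with
    | zero => rw [Submodule.pow_zero, one_mul]
    | succ m ih =>
      rw [Submodule.pow_succ, mul_assoc]
      exact ih.trans (Submodule.mul_le.2 fun a ha b hb => Submodule.mul_mem_mul ha (h hb))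
  have h2 := h1 n
  rwa [hn, Submodule.bot_mul, le_bot_iff] at h2

theorem glSpan_eq_top_of_skew [IsAlgClosed k] [FiniteDimensional k H]
    (hp : IsPointedOf (comul (R := k) (A := H)))
    (hD : ∀ (a b : GroupLike k H) z, IsSkew k a.val b.val z → z ∈ glSpan k H) :
    glSpan k H = ⊤ := by
  obtain ⟨n, hn⟩ := exists_ann_glSpan_pow_eq_bot hp
  have h := ann_anti (perp_mul_le hp le_rfl hD)
  rw [ann_perp] at h
  rw [← perp_ann (glSpan k H), eq_bot_of_le_mul hn h, perp_bot]

end Skew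

section QBinomial

variable {k : Type} [Field k] {H : Type} [Ring H] [Algebra k H] [FiniteDimensional k H]
  {e x g : H} {χ : k} {R : (H →ₗ[k] k) → H →ₗ[k] H}

theorem coaction_pow_mul (h0 : ∀ f, R f e = f e • e)
    (h1 : ∀ f y, R f (x * y) = x * R f y + g * R (f ∘ₗ LinearMap.mulLeft k x) y)
    (hge : g * e = e) (i : ℕ) (f : H →ₗ[k] k) (hf : ∀ j < i, f (x ^ j * e) = 0) :
    R f (x ^ i * e) = f (x ^ i * e) • e := by
  induction i generalizing f with
  | zero => rw [pow_zero, one_mul, h0]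
  | succ i ih =>
    rw [pow_succ', mul_assoc, h1, ih f (fun j hj => hf j (by omega)), hf i (by omega), zero_smul,
      mul_zero, zero_add, ih _ (fun j hj => ?_), mul_smul_comm, hge]
    · rfl
    · have := hf (j + 1) (by omega)
      rwa [pow_succ', mul_assoc] at this

theorem coaction_pow_succ_mul (h0 : ∀ f, R f e = f e • e)
    (h1 : ∀ f y, R f (x * y) = x * R f y + g * R (f ∘ₗ LinearMap.mulLeft k x) y)
    (hge : g * e = e) (hgx : g * (x * e) = χ • (x * e)) (i : ℕ) (f : H →ₗ[k] k)
    (hf : ∀ j < i, f (x ^ j * e) = 0) :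
    R f (x ^ (i + 1) * e) = f (x ^ (i + 1) * e) • e +
      ((∑ j ∈ Finset.range (i + 1), χ ^ j) * f (x ^ i * e)) • (x * e) := by
  induction i generalizing f with
  | zero =>
    rw [zero_add, pow_one, h1, h0, h0, mul_smul_comm, mul_smul_comm, hge, add_comm]
    simp
  | succ i ih =>
    have hf' : ∀ j < i, (f ∘ₗ LinearMap.mulLeft k x) (x ^ j * e) = 0 := fun j hj => by
      have := hf (j + 1) (by omega)
      rwa [pow_succ', mul_assoc] at this
    rw [pow_succ', mul_assoc, h1, coaction_pow_mul h0 h1 hge (i + 1) f hf, ih _ hf', mul_add,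
      mul_smul_comm, mul_smul_comm, mul_smul_comm, hge, hgx, geom_sum_succ (n := i + 1)]
    have h3 : (f ∘ₗ LinearMap.mulLeft k x) (x ^ i * e) = f (x ^ (i + 1) * e) := by
      rw [pow_succ', mul_assoc]; rfl
    have h4 : (f ∘ₗ LinearMap.mulLeft k x) (x ^ (i + 1) * e) = f (x * (x ^ (i + 1) * e)) := rfl
    rw [h3, h4]
    module

theorem mul_eq_zero_or_exists_geom_sum_eq_zero (he : e ≠ 0) (h0 : ∀ f, R f e = f e • e)
    (h1 : ∀ f y, R f (x * y) = x * R f y + g * R (f ∘ₗ LinearMap.mulLeft k x) y)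
    (hge : g * e = e) (hgx : g * (x * e) = χ • (x * e)) :
    x * e = 0 ∨ ∃ n, ∑ j ∈ Finset.range (n + 1), χ ^ j = 0 ∧ ∀ j ≤ n, x ^ j * e ≠ 0 := by
  classical
  let U : ℕ →o Submodule k H :=
    ⟨fun n => Submodule.span k ((fun j => x ^ j * e) '' Set.Iio n), fun m n h =>
      Submodule.span_mono (Set.image_mono (Set.Iio_subset_Iio h))⟩
  have hU : ∀ j n, j < n → x ^ j * e ∈ U n := fun j n h => Submodule.subset_span ⟨j, h, rfl⟩
  have hex : ∃ n, x ^ n * e ∈ U n := by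
    obtain ⟨n, hn⟩ := WellFoundedGT.monotone_chain_condition U
    exact ⟨n, hn (n + 1) (by omega) ▸ hU n (n + 1) (by omega)⟩
  obtain ⟨n, hn⟩ : ∃ n, Nat.find hex = n + 1 := by
    refine Nat.exists_eq_succ_of_ne_zero fun h => he ?_
    have := Nat.find_spec hex
    have h0 : U 0 = ⊥ := by
      change Submodule.span k ((fun j => x ^ j * e) '' Set.Iio 0) = ⊥
      simp
    rwa [h, pow_zero, one_mul, h0, Submodule.mem_bot] at this
  have hmin : x ^ n * e ∉ U n := Nat.find_min hex (by omega)
  have hmem : x ^ (n + 1) * e ∈ U (n + 1) := hn ▸ Nat.find_spec hex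
  obtain ⟨f, hf1, hf2⟩ := Submodule.exists_le_ker_of_notMem hmin
  have hf : ∀ j < n, f (x ^ j * e) = 0 := fun j hj => hf2 (hU j n hj)
  have key : ∀ w ∈ U (n + 1), R f w = f w • e := by
    intro w hw
    induction hw using Submodule.span_induction with
    | mem w hw =>
      obtain ⟨j, hj, rfl⟩ := hw
      exact coaction_pow_mul h0 h1 hge j f fun i hi => hf i (by
        have : j < n + 1 := hj
        omega)
    | zero => simp
    | add u v _ _ hu hv => rw [map_add, map_add, hu, hv, add_smul]
    | smul c u _ hu => rw [map_smul, map_smul, hu, smul_assoc]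
  have h2 := coaction_pow_succ_mul h0 h1 hge hgx n f hf
  rw [key _ hmem, left_eq_add, smul_eq_zero, mul_eq_zero] at h2
  rcases h2 with (h2 | h2) | h2
  · refine Or.inr ⟨n, h2, fun j hj h => hmin ?_⟩
    rw [← Nat.sub_add_cancel hj, pow_add, mul_assoc, h, mul_zero]
    exact zero_mem _
  · exact absurd h2 hf1
  · exact Or.inl h2

end QBinomial

open Polynomial in
theorem exists_eigenvector_notMem {k V : Type} [Field k] [IsAlgClosed k] [CharZero k]
    [AddCommGroup V] [Module k V] [FiniteDimensional k V] {T : Module.End k V} {m : ℕ} (hm : m ≠ 0)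
    (hT : T ^ m = 1) {W P : Submodule k V} (hW : ∀ x ∈ W, T x ∈ W) (hWP : ¬ W ≤ P) :
    ∃ χ : k, χ ^ m = 1 ∧ ∃ x ∈ W, x ∉ P ∧ T x = χ • x := by
  let T' : Module.End k W := T.restrict hW
  have hT' : ∀ n x, ((T' ^ n) x : V) = (T ^ n) x := by
    intro n x
    induction n with
    | zero => simp
    | succ n ih => rw [pow_succ', pow_succ', Module.End.mul_apply, Module.End.mul_apply, ← ih]; rfl
  have h1 : T' ^ m = 1 := by
    ext x
    rw [hT', hT]; rfl
  have h2 : T'.IsSemisimple := by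
    refine Module.End.isSemisimple_of_squarefree_aeval_eq_zero (p := X ^ m - 1) ?_ (by simp [h1])
    have : NeZero (m : k) := ⟨by exact_mod_cast hm⟩
    exact (X_pow_sub_one_separable_iff.2 (NeZero.ne _)).squarefree
  by_contra! hcon
  refine hWP fun x hx => ?_
  have h3 : (⨆ μ, T'.eigenspace μ) ≤ P.comap W.subtype := by
    refine iSup_le fun μ y hy => ?_
    rw [Module.End.mem_eigenspace_iff] at hy
    by_contra hyP
    have hy' : T y.1 = μ • y.1 := congrArg Subtype.val hy
    have hp : ∀ n : ℕ, (T ^ n) y.1 = μ ^ n • y.1 := by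
      intro n
      induction n with
      | zero => simp
      | succ n ih => rw [pow_succ', Module.End.mul_apply, ih, map_smul, hy', smul_smul, pow_succ]
    have h0 : y.1 ≠ 0 := fun h => hyP (by
      rw [Submodule.mem_comap, Submodule.subtype_apply, h]; exact P.zero_mem)
    refine hcon μ ?_ y.1 y.2 hyP hy'
    have h4 := hp m
    rw [hT, Module.End.one_apply] at h4
    exact smul_left_injective k h0 (h4.symm.trans (one_smul k y.1).symm)
  rw [h2.iSup_eigenspace_eq_top] at h3
  exact h3 (show (⟨x, hx⟩ : W) ∈ ⊤ from trivial)

section Skew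

variable {k : Type} [Field k] [IsAlgClosed k] [CharZero k] {H : Type} [Ring H] [HopfAlgebra k H] [FiniteDimensional k H]

/-- The operator `y ↦ f(y₂ e) y₁`. -/
noncomputable def ractShift (e : H) (f : H →ₗ[k] k) : H →ₗ[k] H := ract (shiftR e (toConv f))

theorem ractShift_mul {g x e : H} (hx : IsSkew k g 1 x) (f : H →ₗ[k] k) (y : H) :
    ractShift e f (x * y) =
      x * ractShift e f y + g * ractShift e (f ∘ₗ LinearMap.mulLeft k x) y := by
  have h1 : ∀ (f : H →ₗ[k] k) y, ractShift e f y = sw k y (fun a b => f (b * e) • a) :=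
    fun f y => rfl
  rw [h1, sw_mul (by constructor <;> intro <;> fun_prop),
    hx.sw_eq (F := fun a b => sw k y (fun c d => f (b * d * e) • (a * c)))
      (by constructor <;> intro <;> fun_prop), h1, h1, mul_sw, mul_sw, add_comm]
  congr 1
  · exact sw_congr fun a b => by rw [one_mul, mul_smul_comm]
  · exact sw_congr fun a b => by rw [mul_smul_comm, mul_assoc]; rfl

theorem ractShift_one (f : H →ₗ[k] k) : ractShift 1 f 1 = f 1 • (1 : H) := by
  have := ract_groupLike (shiftR 1 (toConv f)) (1 : GroupLike k H)
  rw [GroupLike.val_one, shiftR_apply, mul_one] at this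
  exact this

theorem ractShift_avg (f : H →ₗ[k] k) :
    ractShift (avg k H) f (avg k H) = f (avg k H) • avg k H := by
  have : ∀ g : GroupLike k H, ractShift (avg k H) f g.val = f (avg k H) • g.val := by
    intro g
    rw [ractShift, ract_groupLike, shiftR_apply, mul_avg]
  have h2 : ractShift (avg k H) f (avg k H) = ractShift (avg k H) f
      ((Nat.card (GroupLike k H) : k)⁻¹ • ∑ g : GroupLike k H, g.val) := rfl
  rw [h2, map_smul, map_sum, Finset.sum_congr rfl fun g _ => this g, ← Finset.smul_sum, smul_comm]
  rfl

theorem eq_zero_of_primitive {x : H} (hx : IsSkew k 1 1 x) : x = 0 := by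
  have h1 : Nontrivial H := ⟨1, 0, fun h => by
    have := Bialgebra.counit_one (R := k) (A := H)
    rw [h, map_zero] at this
    exact zero_ne_one this⟩
  rcases mul_eq_zero_or_exists_geom_sum_eq_zero (χ := 1) (e := (1 : H)) one_ne_zero ractShift_one
    (ractShift_mul hx) (one_mul 1) (by simp) with h | ⟨n, h, -⟩
  · rwa [mul_one] at h
  · simp at h
    norm_cast at h

theorem mul_avg_eq_zero_or {g : GroupLike k H} {x : H} {χ : k}
    (hx : IsSkew k g.val 1 x) (hgx : g.val * x = χ • (x * g.val)) :
    x * avg k H = 0 ∨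
      ∃ n, ∑ j ∈ Finset.range (n + 1), χ ^ j = 0 ∧ ∀ j ≤ n, x ^ j * avg k H ≠ 0 := by
  refine mul_eq_zero_or_exists_geom_sum_eq_zero ?_ ractShift_avg (ractShift_mul hx) (mul_avg g) ?_
  · intro h
    have := counit_avg (k := k) (H := H)
    rw [h, map_zero] at this
    exact zero_ne_one this
  · rw [← mul_assoc, hgx, smul_mul_assoc, mul_assoc, mul_avg]

theorem mem_glSpan_of_mul_avg_eq_zero {g : GroupLike k H} {x : H}
    (hx : IsSkew k g.val 1 x) (h : x * avg k H = 0) : x ∈ glSpan k H := by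
  classical
  obtain ⟨f, hf⟩ := exists_dual_groupLike (1 : GroupLike k H)
  have h1 : ∑ c : GroupLike k H, x * c.val = 0 := by
    rw [avg, mul_smul_comm, smul_eq_zero] at h
    rw [← Finset.mul_sum]
    exact h.resolve_left (inv_ne_zero card_groupLike_ne_zero)
  have h2 : ∀ c : GroupLike k H, ract f (x * c.val) =
      f (x * c.val) • (g * c).val + (if c = 1 then 1 else 0 : k) • (x * c.val) := by
    intro c
    have := (hx.mul_groupLike c).sw_eq (F := fun a b => f b • a)
      (by constructor <;> intro <;> fun_prop)
    rw [one_mul, hf c] at this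
    rw [ract_apply, this, GroupLike.val_mul]
  have h3 := congrArg (ract f) h1
  rw [map_sum, map_zero, Finset.sum_congr rfl fun c _ => h2 c, Finset.sum_add_distrib] at h3
  simp only [ite_smul, one_smul, zero_smul, Finset.sum_ite_eq', Finset.mem_univ, if_true,
    GroupLike.val_one, mul_one] at h3
  rw [eq_neg_of_add_eq_zero_right h3]
  exact neg_mem (sum_mem fun c _ => Submodule.smul_mem _ _ (val_mem_glSpan _))

theorem mem_glSpan_of_commute {g : GroupLike k H} {x : H}
    (hx : IsSkew k g.val 1 x) (hgx : g.val * x = x * g.val) : x ∈ glSpan k H := by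
  rcases mul_avg_eq_zero_or (χ := 1) hx (by rw [hgx, one_smul]) with h | ⟨n, h, -⟩
  · exact mem_glSpan_of_mul_avg_eq_zero hx h
  · simp at h
    norm_cast at h

theorem glSpan_mul_groupLike {x : H} (hx : x ∈ glSpan k H) (g : GroupLike k H) :
    x * g.val ∈ glSpan k H := by
  induction hx using Submodule.span_induction with
  | mem x hx =>
    obtain ⟨h, rfl⟩ := hx
    rw [← GroupLike.val_mul]
    exact val_mem_glSpan _
  | zero => rw [zero_mul]; exact zero_mem _
  | add x y _ _ hx hy => rw [add_mul]; exact add_mem hx hy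
  | smul c x _ hx => rw [smul_mul_assoc]; exact Submodule.smul_mem _ _ hx

theorem exists_skew_notMem (hp : IsPointedOf (comul (R := k) (A := H)))
    (h : glSpan k H ≠ ⊤) :
    ∃ (g : GroupLike k H) (x : H), IsSkew k g.val 1 x ∧ x ∉ glSpan k H := by
  by_contra! hcon
  refine h (glSpan_eq_top_of_skew hp fun a b z hz => ?_)
  have h1 := hz.mul_groupLike b⁻¹
  rw [← GroupLike.val_mul, ← GroupLike.val_mul, mul_inv_cancel, GroupLike.val_one] at h1
  have h2 := glSpan_mul_groupLike (hcon _ _ h1) b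
  rwa [mul_assoc, ← GroupLike.val_mul, inv_mul_cancel, GroupLike.val_one, mul_one] at h2

theorem not_isPointed_of_card_eq_one
    (h1 : Nat.card (GroupLike k H) = 1) (hd : Module.finrank k H ≠ 1) :
    ¬ IsPointedOf (comul (R := k) (A := H)) := by
  intro hp
  have hs := (Nat.card_eq_one_iff_unique.1 h1).1
  obtain ⟨g, x, hx, hxG⟩ := exists_skew_notMem hp (fun h => hd (by
    rw [← h1, ← finrank_glSpan, h, finrank_top]))
  refine hxG (mem_glSpan_of_commute hx ?_)
  rw [Subsingleton.elim g 1]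
  simp

theorem IsSkew.antipode_eq {g : GroupLike k H} {x : H} (hx : IsSkew k g.val 1 x) :
    antipode k x = -((g⁻¹).val * x) := by
  have h1 := sw_antipode_mul (k := k) x
  rw [hx.sw_eq (F := fun a b => antipode k a * b) (by constructor <;> intro <;> fun_prop),
    IsSkew.counit_eq (a := g) (b := 1) (by rwa [GroupLike.val_one]), ← GroupLike.val_inv,
    mul_one] at h1
  rw [eq_neg_iff_add_eq_zero, add_comm, h1]
  simp

theorem IsSkew.antipodeSq_eq {g : GroupLike k H} {x : H} (hx : IsSkew k g.val 1 x) :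
    antipodeSq k H x = (g⁻¹).val * x * g.val := by
  rw [antipodeSq_apply, hx.antipode_eq, map_neg, antipode_mul_antidistrib, hx.antipode_eq,
    ← GroupLike.val_inv, inv_inv, neg_mul, neg_neg]

theorem isSkew_conj {g h : GroupLike k H} {x : H} (hx : IsSkew k g.val 1 x) (hc : h * g = g * h) :
    IsSkew k g.val 1 (h.val * x * (h⁻¹).val) := by
  have := (hx.groupLike_mul h).mul_groupLike h⁻¹
  rw [← GroupLike.val_mul, ← GroupLike.val_mul, mul_one, ← GroupLike.val_mul, mul_inv_cancel, hc,
    mul_inv_cancel_right, GroupLike.val_one] at this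
  exact this

/-- The space of `(g, 1)`-skew primitive elements. -/
def skewSpace (g : GroupLike k H) : Submodule k H where
  carrier := {x | IsSkew k g.val 1 x}
  add_mem' {x y} hx hy f h := by
    rw [map_add, map_add, map_add, hx, hy]
    ring
  zero_mem' f h := by simp
  smul_mem' c x hx f h := by
    rw [map_smul, map_smul, map_smul, hx]
    simp only [smul_eq_mul]
    ring

/-- Conjugation by a group-like element. -/
noncomputable def conjGL (g : GroupLike k H) : Module.End k H :=
  LinearMap.mulLeft k g.val ∘ₗ LinearMap.mulRight k (g⁻¹).val

theorem conjGL_apply (g : GroupLike k H) (x : H) : conjGL g x = g.val * x * (g⁻¹).val :=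
  (mul_assoc _ _ _).symm

theorem conjGL_pow_apply (g : GroupLike k H) (n : ℕ) (x : H) :
    (conjGL g ^ n) x = (g ^ n).val * x * ((g ^ n)⁻¹).val := by
  induction n with
  | zero => simp
  | succ n ih =>
    rw [pow_succ', Module.End.mul_apply, ih, conjGL_apply, pow_succ' g, mul_inv_rev,
      GroupLike.val_mul, GroupLike.val_mul]
    simp only [mul_assoc]

theorem exists_skew_eigenvector (hp : IsPointedOf (comul (R := k) (A := H)))
    (h : glSpan k H ≠ ⊤) : ∃ (g : GroupLike k H) (x : H) (χ : k), IsSkew k g.val 1 x ∧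
      x ∉ glSpan k H ∧ g.val * x = χ • (x * g.val) ∧ χ ^ Nat.card (GroupLike k H) = 1 := by
  obtain ⟨g, x, hx, hxG⟩ := exists_skew_notMem hp h
  obtain ⟨χ, hχ, y, hy, hyG, hgy⟩ := exists_eigenvector_notMem (T := conjGL g)
    (m := Nat.card (GroupLike k H)) Nat.card_pos.ne'
    (LinearMap.ext fun y => by
      rw [conjGL_pow_apply, pow_card_eq_one']
      simp)
    (W := skewSpace g) (P := glSpan k H)
    (fun y hy => by rw [conjGL_apply]; exact isSkew_conj hy rfl) (fun hle => hxG (hle hx))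
  refine ⟨g, y, χ, hy, hyG, ?_, hχ⟩
  rw [← smul_mul_assoc, ← hgy, conjGL_apply, mul_assoc, ← GroupLike.val_mul, inv_mul_cancel,
    GroupLike.val_one, mul_one]

theorem antipodeSq_of_skew_eigenvector {g : GroupLike k H} {x : H} {χ : k}
    (hx : IsSkew k g.val 1 x) (hgx : g.val * x = χ • (x * g.val)) (hχ : χ ≠ 0) :
    antipodeSq k H x = χ⁻¹ • x := by
  rw [hx.antipodeSq_eq, mul_assoc, ← inv_smul_smul₀ hχ (x * g.val), ← hgx, mul_smul_comm,
    ← mul_assoc, ← GroupLike.val_mul, inv_mul_cancel, GroupLike.val_one, one_mul]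

theorem not_isPointed_of_card_eq_prime {p : ℕ} (hp : p.Prime) (hodd : Odd p)
    (hdim : Module.finrank k H = 4 * p) (hns : ¬ IsSemisimpleRing H)
    (hc : Nat.card (GroupLike k H) = p) : ¬ IsPointedOf (comul (R := k) (A := H)) := by
  intro hpt
  have hp0 := hp.pos
  obtain ⟨g, x, χ, hx, hxG, hgx, hχ⟩ := exists_skew_eigenvector hpt (fun h => by
    have := finrank_glSpan (k := k) (H := H)
    rw [h, finrank_top, hdim, hc] at this
    omega)
  rw [hc] at hχ
  have hχ1 : χ ≠ 1 := fun h => hxG (mem_glSpan_of_commute hx (by rw [hgx, h, one_smul]))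
  have hχ0 : χ ≠ 0 := fun h => by
    rw [h, zero_pow hp.ne_zero] at hχ
    exact zero_ne_one hχ
  have : Fact p.Prime := ⟨hp⟩
  have hord : orderOf χ⁻¹ = p :=
    orderOf_eq_prime (by rw [inv_pow, hχ, inv_one]) (fun h => hχ1 (inv_eq_one.1 h))
  obtain ⟨n, hn, hne⟩ := (mul_avg_eq_zero_or hx hgx).resolve_left
    fun h => hxG (mem_glSpan_of_mul_avg_eq_zero hx h)
  have hpn : p ∣ n + 1 := by
    rw [← hord, orderOf_dvd_iff_pow_eq_one, inv_pow, inv_eq_one, ← sub_eq_zero, ← mul_geom_sum, hn,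
      mul_zero]
  have hle := Nat.le_of_dvd n.succ_pos hpn
  have hd : Module.finrank k (rightRep k H).invariants = 4 := by
    have := finrank_eq_card_mul_fixed (k := k) (H := H)
    rw [hdim, hc, mul_comm] at this
    exact (Nat.eq_of_mul_eq_mul_left hp0 this).symm
  let v : Fin p → (rightRep k H).invariants := fun j =>
    ⟨x ^ j.1 * avg k H, mem_invariants_rightRep.2 (by rw [mul_assoc, avg_mul_avg])⟩
  have hv : ∀ j, (sqInv k H).HasEigenvector (χ⁻¹ ^ j.1) (v j) := by
    intro j
    refine ⟨Module.End.mem_eigenspace_iff.2 (Subtype.ext ?_), fun h => ?_⟩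
    · rw [sqInv_val, map_mul, map_pow, antipodeSq_avg, antipodeSq_of_skew_eigenvector hx hgx hχ0,
        smul_pow, smul_mul_assoc]
      rfl
    · exact hne j.1 (by have := j.2; omega) (congrArg Subtype.val h)
  have hinj : Function.Injective (fun j : Fin p => χ⁻¹ ^ j.1) := fun i j h =>
    Fin.ext (pow_injOn_Iio_orderOf (by rw [hord]; exact i.2) (by rw [hord]; exact j.2) h)
  have hli := Module.End.eigenvectors_linearIndependent' _ _ hinj v hv
  have hp4 := hli.fintype_card_le_finrank
  rw [hd, Fintype.card_fin] at hp4
  obtain rfl : p = 3 := by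
    have := hp.two_le
    obtain ⟨m, rfl⟩ := hodd
    omega
  let m : Multiset k := Finset.univ.val.map (fun j : Fin 3 => χ⁻¹ ^ j.1)
  have hm : m ≤ (sqInv k H).charpoly.roots := by
    rw [Multiset.le_iff_subset (Multiset.Nodup.map hinj Finset.univ.nodup)]
    intro μ hμ
    obtain ⟨j, -, rfl⟩ := Multiset.mem_map.1 hμ
    rw [Polynomial.mem_roots (LinearMap.charpoly_monic _).ne_zero,
      ← Module.End.hasEigenvalue_iff_isRoot_charpoly]
    exact Module.End.hasEigenvalue_of_hasEigenvector (hv j)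
  obtain ⟨t, ht⟩ := Multiset.le_iff_exists_add.1 hm
  have hcard := card_roots_charpoly (sqInv k H)
  rw [ht, Multiset.card_add, hd, Multiset.card_map] at hcard
  obtain ⟨μ, rfl⟩ := Multiset.card_eq_one.1 (show t.card = 1 by simp at hcard; omega)
  have htr := trace_sqInv (k := k) hns
  rw [Module.End.trace_eq_sum_roots_charpoly_of_splits (IsAlgClosed.splits _), ht,
    Multiset.sum_add, Multiset.sum_singleton] at htr
  have hsum : m.sum = 0 := by
    change ∑ j : Fin 3, χ⁻¹ ^ j.1 = 0
    rw [Fin.sum_univ_eq_sum_range (fun j => χ⁻¹ ^ j)]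
    have := mul_geom_sum χ⁻¹ 3
    rw [inv_pow, hχ, inv_one, sub_self, mul_eq_zero, sub_eq_zero, inv_eq_one] at this
    exact this.resolve_left hχ1
  rw [hsum, zero_add] at htr
  have h0 : (sqInv k H).HasEigenvalue 0 := by
    rw [Module.End.hasEigenvalue_iff_isRoot_charpoly,
      ← Polynomial.mem_roots (LinearMap.charpoly_monic _).ne_zero, ht, htr]
    simp
  obtain ⟨w, hw⟩ := h0.exists_hasEigenvector
  refine hw.2 (Subtype.ext ?_)
  have h1 := congrArg Subtype.val hw.apply_eq_smul
  rw [zero_smul, sqInv_val, antipodeSq_apply] at h1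
  have h2 : antipode k (antipode k w.1) = antipode k (antipode k (0 : H)) := by
    rw [h1, map_zero, map_zero]; rfl
  exact antipode_bijective.1 (antipode_bijective.1 h2)

theorem card_groupLike_ne_prime {p : ℕ} (hp : p.Prime) (hodd : Odd p)
    (hdim : Module.finrank k H = 4 * p) (hns : ¬ IsSemisimpleRing H) :
    Nat.card (GroupLike k H) ≠ p := by
  intro hc
  obtain ⟨n, s, hn, hs, hsp, hdvd, hle, hj⟩ :=
    exists_orbit_of_not_pointed (not_isPointed_of_card_eq_prime hp hodd hdim hns hc)
  rw [hc] at hsp hdvd hle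
  rw [hdim] at hle
  have hp0 := hp.pos
  have hpn : p ∣ n := by
    by_contra h
    have h1 : p ∣ s := (hp.dvd_mul.1 hdvd).resolve_left fun h' => h (hp.dvd_of_dvd_pow h')
    have h2 := Nat.le_of_dvd hs h1
    have h3 : 2 ^ 2 * p ≤ n ^ 2 * s := Nat.mul_le_mul (Nat.pow_le_pow_left hn 2) h2
    omega
  have hpn' := Nat.le_of_dvd (by omega) hpn
  obtain rfl : p = 3 := by
    have := hp.two_le
    have h3 : p ≤ 3 := by nlinarith
    obtain ⟨m, rfl⟩ := hodd
    omega
  have heq : n ^ 2 * s = 9 := by nlinarith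
  exact hns (isSemisimpleRing_of_jacobson_dual (hj (by rw [hc, heq, hdim])) (by rw [hdim, hc]))

end Skew

section SkewDerivation

variable {k A : Type} [Field k] [CharZero k] [Ring A] [Algebra k A] [FiniteDimensional k A]

/-- An involution `σ` of an algebra with a `σ`-derivation `D` of square zero. -/
structure SkewDer (k : Type) {A : Type} [Field k] [Ring A] [Algebra k A] (σ D : A →ₗ[k] A) :
    Prop where
  map_one : σ 1 = 1
  map_mul : ∀ a b, σ (a * b) = σ a * σ b
  map_map : ∀ a, σ (σ a) = a
  der_der : ∀ a, D (D a) = 0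
  map_der : ∀ a, σ (D a) = -D (σ a)
  der_mul : ∀ a b, D (a * b) = σ a * D b + D a * b

namespace SkewDer

variable {σ D : A →ₗ[k] A}

/-- The common kernel of `D` and `σ - c`. -/
def eigen (σ D : A →ₗ[k] A) (c : k) : Submodule k A :=
  LinearMap.ker D ⊓ LinearMap.ker (σ - c • LinearMap.id)

theorem mem_eigen {c : k} {a : A} : a ∈ eigen σ D c ↔ D a = 0 ∧ σ a = c • a := by
  simp [eigen, sub_eq_zero]

theorem der_one (h : SkewDer k σ D) : D 1 = 0 := by
  have := h.der_mul 1 1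
  rwa [mul_one, h.map_one, one_mul, mul_one, left_eq_add] at this

theorem mul_mem_eigen (h : SkewDer k σ D) {c d : k} {a b : A} (ha : a ∈ eigen σ D c)
    (hb : b ∈ eigen σ D d) : a * b ∈ eigen σ D (c * d) := by
  rw [mem_eigen] at *
  rw [h.der_mul, h.map_mul, ha.1, ha.2, hb.1, hb.2]
  simp [smul_smul, mul_comm]

theorem finrank_le (h : SkewDer k σ D) {c d : k} {u v : A} (hu : u ∈ eigen σ D c) (hv : v * u = 1) :
    Module.finrank k (eigen σ D d) ≤ Module.finrank k (eigen σ D (c * d)) := by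
  refine LinearMap.finrank_le_finrank_of_injective
    (f := (LinearMap.mulLeft k u).restrict fun b hb => h.mul_mem_eigen hu hb) fun a b hab => ?_
  have h1 : u * a.1 = u * b.1 := congrArg Subtype.val hab
  refine Subtype.ext ?_
  rw [← one_mul a.1, ← one_mul b.1, ← hv, mul_assoc, h1, mul_assoc]

theorem finrank_eq (h : SkewDer k σ D) {w u v : A} (hw : D w = 1) (hu : u ∈ eigen σ D (-1))
    (hv : v * u = 1) : Module.finrank k A = 4 * Module.finrank k (eigen σ D 1) := by
  have h1 : LinearMap.range D = LinearMap.ker D := by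
    refine le_antisymm ?_ fun b hb => ⟨w * b, ?_⟩
    · rintro _ ⟨a, rfl⟩
      exact h.der_der a
    · rw [h.der_mul, LinearMap.mem_ker.1 hb, mul_zero, zero_add, hw, one_mul]
  have h2 := LinearMap.finrank_range_add_finrank_ker D
  rw [h1] at h2
  have h3 : Module.finrank k (eigen σ D 1) = Module.finrank k (eigen σ D (-1)) := by
    refine le_antisymm ?_ ?_
    · have := h.finrank_le (d := 1) hu hv
      rwa [mul_one] at this
    · have := h.finrank_le (d := -1) hu hv
      rwa [neg_mul_neg, one_mul] at this
  have h4 : eigen σ D 1 ⊓ eigen σ D (-1) = ⊥ := by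
    rw [eq_bot_iff]
    rintro a ⟨ha, ha'⟩
    rw [SetLike.mem_coe, mem_eigen] at ha ha'
    have := ha.2.symm.trans ha'.2
    rw [one_smul, neg_smul, one_smul, eq_neg_iff_add_eq_zero, ← two_smul k] at this
    exact (smul_eq_zero.1 this).resolve_left two_ne_zero
  have h5 : eigen σ D 1 ⊔ eigen σ D (-1) = LinearMap.ker D := by
    refine le_antisymm (sup_le inf_le_left inf_le_left) fun a ha => ?_
    rw [LinearMap.mem_ker] at ha
    have hs : D (σ a) = 0 := by rw [← neg_eq_zero, ← h.map_der, ha, map_zero]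
    refine Submodule.mem_sup.2 ⟨(2⁻¹ : k) • (a + σ a), ?_, (2⁻¹ : k) • (a - σ a), ?_, ?_⟩
    · rw [mem_eigen]
      simp [ha, hs, h.map_map, add_comm]
    · rw [mem_eigen]
      simp [ha, hs, h.map_map, ← smul_neg]
    · rw [← smul_add, add_add_sub_cancel, ← two_smul k a, smul_smul, inv_mul_cancel₀ two_ne_zero,
        one_smul]
  have h6 := Submodule.finrank_sup_add_finrank_inf_eq (eigen σ D 1) (eigen σ D (-1))
  rw [h4, h5, finrank_bot, add_zero, ← h3] at h6
  omega

theorem isUnit_of_map_eq {ev : A →ₐ[k] k} (hn : ∀ a, ev a = 0 → ev (σ a) = 0 → IsNilpotent a)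
    (h : SkewDer k σ D) {u : A} (hu : ev u ≠ 0) (hs : ev (σ u) = ev u) : IsUnit u := by
  have h1 : IsNilpotent (1 - (ev u)⁻¹ • u) := by
    refine hn _ ?_ ?_
    · simp [hu]
    · simp [h.map_one, hs, hu]
  have h2 := h1.isUnit_one_sub
  rw [sub_sub_cancel] at h2
  have h3 := h2.smul (Units.mk0 (ev u) hu)
  rwa [Units.smul_mk0, smul_inv_smul₀ hu] at h3

theorem der_map_der (h : SkewDer k σ D) (a : A) : D (σ (D a)) = 0 := by
  rw [← neg_eq_zero, ← h.map_der, h.der_der, map_zero]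

theorem der_add_mem_eigen (h : SkewDer k σ D) (a : A) : D a + σ (D a) ∈ eigen σ D 1 := by
  rw [mem_eigen, map_add, h.der_der, h.der_map_der, add_zero, map_add, h.map_map, add_comm,
    one_smul]
  exact ⟨rfl, rfl⟩

theorem der_sub_mem_eigen (h : SkewDer k σ D) (a : A) : D a - σ (D a) ∈ eigen σ D (-1) := by
  rw [mem_eigen, map_sub, h.der_der, h.der_map_der, sub_zero, map_sub, h.map_map, neg_smul,
    one_smul, neg_sub]
  exact ⟨rfl, rfl⟩

theorem exists_der_add_eq_one {ev : A →ₐ[k] k}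
    (hn : ∀ a, ev a = 0 → ev (σ a) = 0 → IsNilpotent a) (h : SkewDer k σ D) {a : A}
    (ha : ev (D a + σ (D a)) ≠ 0) : ∃ w, D w + σ (D w) = 1 := by
  have hu := mem_eigen.1 (h.der_add_mem_eigen a)
  rw [one_smul] at hu
  obtain ⟨v, hv, hv'⟩ := isUnit_iff_exists.1 (isUnit_of_map_eq hn h ha (by rw [hu.2]))
  have hs : σ v = v := by
    have := h.map_mul v (D a + σ (D a))
    rw [hv', h.map_one, hu.2] at this
    have h1 := congrArg (· * v) this
    simp only [mul_assoc, hv, one_mul, mul_one] at h1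
    exact h1.symm
  have hD : D v = 0 := by
    have := h.der_mul (D a + σ (D a)) v
    rw [hv, h.der_one, hu.1, hu.2, zero_mul, add_zero] at this
    have h1 := congrArg (v * ·) this
    simp only [← mul_assoc, hv', one_mul, mul_zero] at h1
    exact h1.symm
  refine ⟨a * v, ?_⟩
  rw [h.der_mul, hD, mul_zero, zero_add, h.map_mul, hs, ← add_mul, hv]

/-- The map `a ↦ D (w a) + σ (D (w a))`. -/
def proj (σ D : A →ₗ[k] A) (w : A) : A →ₗ[k] A :=
  (D + σ ∘ₗ D) ∘ₗ LinearMap.mulLeft k w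

theorem proj_apply (w a : A) : proj σ D w a = D (w * a) + σ (D (w * a)) := rfl

theorem proj_of_mem (h : SkewDer k σ D) {w : A} (hw : D w + σ (D w) = 1) {a : A}
    (ha : a ∈ eigen σ D 1) : proj σ D w a = a := by
  rw [mem_eigen, one_smul] at ha
  rw [proj_apply, h.der_mul, ha.1, mul_zero, zero_add, h.map_mul, ha.2, ← add_mul, hw, one_mul]

theorem trace_mul_proj [IsAlgClosed k] (h : SkewDer k σ D) {w : A} (hw : D w + σ (D w) = 1)
    (ho : Odd (Module.finrank k (eigen σ D 1))) {F : Module.End k A}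
    (hF : ∀ a ∈ eigen σ D 1, F a ∈ eigen σ D 1) {n : ℕ} (hn : F ^ 2 ^ n = 1) :
    LinearMap.trace k A (F * proj σ D w) ≠ 0 := by
  have h1 : ∀ a, (F * proj σ D w) a ∈ eigen σ D 1 := fun a => hF _ (h.der_add_mem_eigen _)
  rw [← LinearMap.trace_restrict_eq_of_forall_mem _ _ h1]
  refine trace_ne_zero_of_odd (n := n) ?_ ho
  have h2 : ∀ (m : ℕ) (a : eigen σ D 1),
      ((((F * proj σ D w).restrict fun x _ => h1 x) ^ m) a).1 = (F ^ m) a.1 := by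
    intro m
    induction m with
    | zero => intro a; rfl
    | succ m ih =>
      intro a
      rw [pow_succ, pow_succ, Module.End.mul_apply, ih, Module.End.mul_apply]
      change (F ^ m) (F (proj σ D w a.1)) = _
      rw [h.proj_of_mem hw a.2]
  ext a
  rw [h2, hn]
  rfl

theorem exists_trace_mul_proj_ne_zero [IsAlgClosed k] {ev : A →ₐ[k] k}
    (hn : ∀ a, ev a = 0 → ev (σ a) = 0 → IsNilpotent a) (h : SkewDer k σ D) {a a' : A}
    (ha : ev (D a + σ (D a)) ≠ 0) (ha' : ev (D a' - σ (D a')) ≠ 0) {m : ℕ} (hm : Odd m)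
    (hA : Module.finrank k A = 4 * m) {F : Module.End k A}
    (hF : ∀ a ∈ eigen σ D 1, F a ∈ eigen σ D 1) {n : ℕ} (hFn : F ^ 2 ^ n = 1) :
    ∃ w, LinearMap.trace k A (F * proj σ D w) ≠ 0 := by
  obtain ⟨w, hw⟩ := h.exists_der_add_eq_one hn ha
  refine ⟨w, h.trace_mul_proj hw ?_ hF hFn⟩
  have hu := h.der_sub_mem_eigen a'
  have h1 : IsUnit ((D a' - σ (D a')) * (D a' - σ (D a'))) := by
    refine isUnit_of_map_eq hn h ?_ ?_
    · rw [_root_.map_mul]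
      exact mul_ne_zero ha' ha'
    · rw [h.map_mul, (mem_eigen.1 hu).2, neg_smul, one_smul, neg_mul_neg]
  obtain ⟨v, hv⟩ := h1.exists_left_inv
  rw [← mul_assoc] at hv
  have h2 := h.finrank_eq (w := w - σ w) (by rw [map_sub, ← hw, h.map_der, sub_eq_add_neg]) hu hv
  rw [hA] at h2
  rwa [← Nat.eq_of_mul_eq_mul_left four_pos h2]

end SkewDer
end SkewDerivation

open Polynomial in
theorem eq_one_of_isNilpotent_sub_one {k A : Type} [Field k] [CharZero k] [Ring A] [Algebra k A]
    {x : A} {m : ℕ} (hm : m ≠ 0) (hx : x ^ m = 1) (hn : IsNilpotent (x - 1)) : x = 1 := by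
  obtain ⟨n, hn⟩ := hn
  have h1 : IsCoprime ((X - C (1 : k)) ^ n) (∑ i ∈ Finset.range m, (X : k[X]) ^ i) := by
    refine IsCoprime.pow_left (((irreducible_X_sub_C (1 : k)).coprime_iff_not_dvd).2 ?_)
    rw [dvd_iff_isRoot, IsRoot, eval_finsetSum]
    simp [hm]
  obtain ⟨a, b, hab⟩ := h1
  have h2 := congrArg (fun q => aeval x (q * (X - C 1))) hab
  have h3 : (a * (X - C 1) ^ n + b * ∑ i ∈ Finset.range m, X ^ i) * (X - C (1 : k)) =
      a * (X - C 1) * (X - C 1) ^ n + b * (X ^ m - 1) := by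
    rw [← geom_sum_mul, C_1]
    ring
  simp only [h3] at h2
  simp [hx, hn] at h2
  exact (sub_eq_zero.1 h2.symm)

theorem mul_self_le_of_forall_exists {k A : Type} [Field k] [Ring A] [Algebra k A]
    {J : Submodule k A} (h : ∀ a ∈ J, ∃ b ∈ J * J, ∀ u ∈ J, b * u = a * u) :
    J * J ≤ J * (J * J) := by
  rw [← mul_assoc]
  refine Submodule.mul_le.2 fun a ha u hu => ?_
  obtain ⟨b, hb, hbu⟩ := h a ha
  rw [← hbu u hu]
  exact Submodule.mul_mem_mul hb hu

section CaseTwo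

variable {k : Type} [Field k] [CharZero k] [IsAlgClosed k] {H : Type} [Ring H] [HopfAlgebra k H]
  [FiniteDimensional k H]

/-- The functionals `y ↦ f (y h)`, as a linear function of `f`. -/
noncomputable def shiftRLin (k : Type) [Field k] [CharZero k] [IsAlgClosed k] {H : Type} [Ring H]
    [HopfAlgebra k H] [FiniteDimensional k H] (h : H) : Du k H →ₗ[k] Du k H where
  toFun := shiftR h
  map_add' _ _ := rfl
  map_smul' _ _ := rfl

theorem shiftRLin_apply (h : H) (f : Du k H) (y : H) : shiftRLin k h f y = f (y * h) := rfl

theorem eq_smul_of_groupLike_mul_eq_smul {g : GroupLike k H} (hg1 : g ≠ 1) (hgg : g * g = 1)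
    {x : H} (hx : IsSkew k g.val 1 x) {c : k} (hc : c ≠ 0) (h : g.val * x = c • x) :
    ∃ d : k, x = d • (1 - g.val) := by
  classical
  obtain ⟨f, hf⟩ := exists_dual_groupLike (1 : GroupLike k H)
  have h1 := hx.groupLike_mul g
  rw [← GroupLike.val_mul, hgg, h, mul_one] at h1
  refine ⟨f x, eq_of_dual (k := k) fun u => ?_⟩
  have h2 := h1 f u
  have h3 := hx f u
  rw [hf, if_pos rfl] at h2
  rw [hf, if_neg hg1, zero_mul, zero_add] at h3
  have h4 : ∀ (v : Du k H) y, v (c • y) = c * v y := fun v y => map_smul v.ofConv c y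
  rw [h4, h4, h4, h3] at h2
  have h5 : u (f x • (1 - g.val)) = f x * (u 1 - u g.val) := by
    change u.ofConv _ = _
    rw [map_smul, map_sub]
    rfl
  rw [h5]
  refine mul_left_cancel₀ hc ?_
  linear_combination -h2

theorem eq_zero_of_groupLike_mul_eq_smul {g : GroupLike k H} (hg1 : g ≠ 1) (hgg : g * g = 1)
    {x : H} (hx : IsSkew k g.val 1 x) (hgx : g.val * x = -(x * g.val)) {c : k} (hc : c ≠ 0)
    (h : g.val * x = c • x) : x = 0 := by
  obtain ⟨d, hd⟩ := eq_smul_of_groupLike_mul_eq_smul hg1 hgg hx hc h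
  have h1 : g.val * x = x * g.val := by
    rw [hd, mul_smul_comm, smul_mul_assoc, mul_sub, sub_mul, mul_one, one_mul]
  rw [h1, eq_neg_iff_add_eq_zero, ← two_smul k, ← h1, h, smul_smul] at hgx
  exact (smul_eq_zero.1 hgx).resolve_left (mul_ne_zero two_ne_zero hc)

theorem mul_self_eq_zero_of_skew {g : GroupLike k H} (hgg : g * g = 1)
    {x : H} (hx : IsSkew k g.val 1 x) (hgx : g.val * x = -(x * g.val)) : x * x = 0 := by
  have hg : g.val * g.val = 1 := by rw [← GroupLike.val_mul, hgg, GroupLike.val_one]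
  refine eq_zero_of_primitive (k := k) (isSkew_of_comul ?_)
  rw [Bialgebra.comul_mul, hx.comul_eq, add_mul, mul_add, mul_add]
  simp only [Algebra.TensorProduct.tmul_mul_tmul, hg, hgx, mul_one, one_mul,
    TensorProduct.neg_tmul]
  abel

theorem sw_add {M : Type} [AddCommGroup M] [Module k M] (x : H) (f g : H → H → M) :
    sw k x (fun a b => f a b + g a b) = sw k x f + sw k x g :=
  Finset.sum_add_distrib

theorem skewDer_shiftR {g : GroupLike k H} (hgg : g * g = 1)
    {x : H} (hx : IsSkew k g.val 1 x) (hgx : g.val * x = -(x * g.val)) :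
    SkewDer k (shiftRLin k g.val) (shiftRLin k x) where
  map_one := du_ext fun y => by
    rw [shiftRLin_apply, du_one_apply, du_one_apply, Bialgebra.counit_mul, counit_groupLike,
      mul_one]
  map_mul := shiftR_mul g
  map_map f := du_ext fun y => by
    rw [shiftRLin_apply, shiftRLin_apply, mul_assoc, ← GroupLike.val_mul, hgg, GroupLike.val_one,
      mul_one]
  der_der f := du_ext fun y => by
    rw [shiftRLin_apply, shiftRLin_apply, mul_assoc, mul_self_eq_zero_of_skew hgg hx hgx, mul_zero,
      du_zero_apply]
    exact map_zero f.ofConv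
  map_der f := du_ext fun y => by
    rw [shiftRLin_apply, shiftRLin_apply, du_neg_apply, shiftRLin_apply, shiftRLin_apply,
      mul_assoc, hgx, mul_neg, mul_assoc]
    exact map_neg f.ofConv _
  der_mul f h := du_ext fun y => by
    rw [du_add_apply, shiftRLin_apply, du_mul_apply, du_mul_apply, du_mul_apply,
      sw_mul (by constructor <;> intro <;> fun_prop),
      ← sw_add]
    refine sw_congr fun a b => ?_
    rw [hx.sw_eq (F := fun c d => f (a * c) * h (b * d)) (by constructor <;> intro <;> fun_prop),
      mul_one]
    rfl

theorem sqDual_pow_apply (n : ℕ) (f : Du k H) (y : H) :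
    ((sqDual k H).toLinearMap ^ n) f y = f (((antipodeSq k H).toLinearMap ^ n) y) := by
  induction n generalizing y with
  | zero => rfl
  | succ n ih =>
    rw [pow_succ', Module.End.mul_apply, pow_succ, Module.End.mul_apply]
    change sqDual k H _ _ = _
    rw [sqDual_apply, ih]
    rfl

theorem trace_sqDual_mul_proj {g : GroupLike k H} (x : H) (w : Du k H) :
    LinearMap.trace k (Du k H) ((sqDual k H).toLinearMap *
      SkewDer.proj (shiftRLin k g.val) (shiftRLin k x) w) = trF w (x + g.val * x) := by
  rw [trace_dual (T := lact w * (LinearMap.mulRight k (x + g.val * x) *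
    (antipodeSq k H).toLinearMap)), LinearMap.trace_mul_comm]
  · rfl
  · intro f y
    change sqDual k H (shiftRLin k x (w * f) + shiftRLin k g.val (shiftRLin k x (w * f))) y = _
    rw [sqDual_apply, du_add_apply, shiftRLin_apply, shiftRLin_apply, shiftRLin_apply]
    change _ = f (lact w (antipodeSq k H y * (x + g.val * x)))
    rw [apply_lact, mul_add, mul_assoc]
    exact (map_add (w * f).ofConv _ _).symm

theorem antipodeSq_pow_eight {p : ℕ} (hp : p.Prime) (hodd : Odd p)
    (hdim : Module.finrank k H = 4 * p) (hpt : IsPointedOf (comul (R := k) (A := H)))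
    (h2 : Nat.card (GroupLike k H) = 2) : (antipodeSq k H).toLinearMap ^ 2 ^ 3 = 1 := by
  obtain ⟨α, g, hpow⟩ := exists_antipodeSq_pow k H
  have hdvd : orderOf α ∣ 4 * p := by
    rw [← hdim, finrank_eq_card_mul_charRep (Subgroup.zpowers α), Nat.card_zpowers]
    exact Dvd.intro _ rfl
  have hg : ∀ g : GroupLike k H, g ^ 2 = 1 := fun g => by rw [← h2]; exact pow_card_eq_one'
  have hpm : ¬ p ∣ orderOf α := by
    intro hpm
    let β : charGroup k H := α ^ (orderOf α / p)
    have hβ : orderOf β = p := orderOf_pow_orderOf_div (orderOf_pos α).ne' hpm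
    have hβp : β ^ p = 1 := by rw [← hβ, pow_orderOf_eq_one]
    have hone : ∀ g : GroupLike k H, β.1.val g.val = 1 := by
      intro g
      have h1 : β.1.val g.val ^ p = 1 := by
        rw [← charGroup_pow_apply, hβp]
        exact g.2.counit_eq_one
      have h2 : β.1.val g.val ^ 2 = 1 := by
        let φ : H →* k := ⟨⟨fun x => β.1.val x, β.2.1⟩, β.2.2⟩
        have : φ g.val ^ 2 = 1 := by
          rw [← map_pow, ← GroupLike.val_pow, hg, GroupLike.val_one, map_one]
        exact this
      have := (pow_gcd_eq_one (a := β.1.val g.val)).2 ⟨h1, h2⟩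
      rwa [Nat.coprime_two_right.2 hodd, pow_one] at this
    obtain ⟨n, hn⟩ := exists_ann_glSpan_pow_eq_bot hpt
    have hnil : IsNilpotent (β.1.val - 1) := by
      refine ⟨n, ?_⟩
      have : β.1.val - 1 ∈ ann (glSpan k H) := mem_ann_glSpan.2 fun g => by
        rw [du_sub_apply, hone, du_one_apply, counit_groupLike, sub_self]
      have := Submodule.pow_mem_pow _ this n
      rwa [hn, Submodule.mem_bot] at this
    have h1 := eq_one_of_isNilpotent_sub_one (k := k) hp.ne_zero (x := β.1.val)
      (congrArg (fun u : charGroup k H => u.1.val) hβp) hnil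
    have h3 : β = 1 := Subtype.ext (Units.ext h1)
    rw [h3, orderOf_one] at hβ
    exact hp.one_lt.ne hβ
  have hα : α ^ 4 = 1 := by
    rw [← orderOf_dvd_iff_pow_eq_one]
    exact Nat.Coprime.dvd_of_dvd_mul_right ((Nat.Prime.coprime_iff_not_dvd hp).2 hpm).symm hdvd
  exact hpow 4 hα (by rw [show 4 = 2 * 2 from rfl, pow_mul, hg])

theorem exists_isRightInt_apply_ne_zero {p : ℕ} (hp : p.Prime) (hodd : Odd p)
    (hdim : Module.finrank k H = 4 * p) (hpt : IsPointedOf (comul (R := k) (A := H)))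
    (h2 : Nat.card (GroupLike k H) = 2) {g : GroupLike k H} (hg1 : g ≠ 1) (hgg : g * g = 1)
    (hG : ∀ c : GroupLike k H, c = 1 ∨ c = g)
    {x : H} (hx : IsSkew k g.val 1 x) (hgx : g.val * x = -(x * g.val)) (hx0 : x ≠ 0) :
    ∃ f : Du k H, IsRightInt f ∧ f (x + g.val * x) ≠ 0 := by
  obtain ⟨n, hn⟩ := exists_ann_glSpan_pow_eq_bot hpt
  have hnil : ∀ a : Du k H, evalGL (k := k) (H := H) 1 a = 0 → evalGL (k := k) (H := H) 1 (shiftRLin k g.val a) = 0 →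
      IsNilpotent a := by
    intro a h1 hg
    rw [evalGL_apply, shiftRLin_apply, GroupLike.val_one, one_mul] at hg
    refine ⟨n, ?_⟩
    have : a ∈ ann (glSpan k H) := mem_ann_glSpan.2 fun c => by
      rcases hG c with rfl | rfl
      · exact h1
      · exact hg
    have := Submodule.pow_mem_pow _ this n
    rwa [hn, Submodule.mem_bot] at this
  have hex : ∀ c : k, c ≠ 0 → ∃ a : Du k H, a (c • x + g.val * x) ≠ 0 := by
    intro c hc
    by_contra! h
    have h1 : c • x + g.val * x = 0 := eq_of_dual (k := k) fun f => by
      rw [h]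
      exact (map_zero f.ofConv).symm
    refine hx0 (eq_zero_of_groupLike_mul_eq_smul hg1 hgg hx hgx (neg_ne_zero.2 hc) ?_)
    rw [neg_smul]
    exact eq_neg_of_add_eq_zero_right h1
  obtain ⟨a, ha⟩ := hex 1 one_ne_zero
  obtain ⟨b, hb⟩ := hex (-1) (neg_ne_zero.2 one_ne_zero)
  have hS : antipodeSq k H x = -x := by
    rw [antipodeSq_of_skew_eigenvector (χ := -1) hx (by rw [hgx, neg_smul, one_smul])
      (neg_ne_zero.2 one_ne_zero), inv_neg, inv_one, neg_smul, one_smul]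
  have h1 : evalGL (k := k) (H := H) 1
      (shiftRLin k x a + shiftRLin k g.val (shiftRLin k x a)) ≠ 0 := by
    rw [map_add, evalGL_apply, evalGL_apply, shiftRLin_apply, shiftRLin_apply, shiftRLin_apply,
      GroupLike.val_one, one_mul, one_mul, ← map_add]
    rwa [one_smul] at ha
  have h3 : evalGL (k := k) (H := H) 1
      (shiftRLin k x b - shiftRLin k g.val (shiftRLin k x b)) ≠ 0 := by
    rw [map_sub, evalGL_apply, evalGL_apply, shiftRLin_apply, shiftRLin_apply, shiftRLin_apply,
      GroupLike.val_one, one_mul, one_mul, ← map_sub, ← neg_ne_zero, ← map_neg, neg_sub]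
    rwa [neg_smul, one_smul, neg_add_eq_sub] at hb
  have h4 : ∀ f ∈ SkewDer.eigen (shiftRLin k g.val) (shiftRLin k x) (1 : k),
      (sqDual k H).toLinearMap f ∈ SkewDer.eigen (shiftRLin k g.val) (shiftRLin k x) (1 : k) := by
    intro f hf
    rw [SkewDer.mem_eigen] at hf ⊢
    have h1 : ∀ y, f (y * x) = 0 := fun y => congrArg (fun u : Du k H => u y) hf.1
    have h2 : ∀ y, f (y * g.val) = f y := fun y => by
      have := congrArg (fun u : Du k H => u y) hf.2
      rwa [one_smul] at this
    refine ⟨du_ext fun y => ?_, du_ext fun y => ?_⟩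
    · rw [shiftRLin_apply, AlgHom.toLinearMap_apply, sqDual_apply, map_mul, hS, mul_neg,
        du_zero_apply]
      refine (map_neg f.ofConv _).trans ?_
      rw [h1, neg_zero]
    · rw [one_smul, shiftRLin_apply, AlgHom.toLinearMap_apply, sqDual_apply, map_mul,
        antipodeSq_groupLike, h2]
      rfl
  have h5 : (sqDual k H).toLinearMap ^ 2 ^ 3 = 1 := LinearMap.ext fun f => du_ext fun y => by
    rw [sqDual_pow_apply, antipodeSq_pow_eight hp hodd hdim hpt h2]
    rfl
  obtain ⟨w, hw⟩ := (skewDer_shiftR hgg hx hgx).exists_trace_mul_proj_ne_zero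
    hnil h1 h3 hodd (by rw [finrank_du, hdim]) h4 h5
  rw [trace_sqDual_mul_proj] at hw
  exact ⟨_, isRightInt_trF' w, hw⟩

theorem IsRightInt.apply_groupLike {f : Du k H} (hf : IsRightInt f) {g : GroupLike k H}
    (hg : g ≠ 1) : f g.val = 0 := by
  classical
  obtain ⟨u, hu⟩ := exists_dual_groupLike (1 : GroupLike k H)
  have h1 := congrArg u.ofConv (hf g.val)
  rw [lact_groupLike, map_smul, map_smul, ← GroupLike.val_one (R := k)] at h1
  have h2 : f g.val • u g.val = f g.val • u (1 : GroupLike k H).val := h1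
  rw [hu, hu, if_neg hg, if_pos rfl, smul_zero, smul_eq_mul, mul_one] at h2
  exact h2.symm

theorem notMem_glSpan_mul_groupLike {x : H} (hx : x ∉ glSpan k H) (g : GroupLike k H) :
    x * g.val ∉ glSpan k H := by
  intro h
  have := glSpan_mul_groupLike h g⁻¹
  rw [mul_assoc, ← GroupLike.val_mul, mul_inv_cancel, GroupLike.val_one, mul_one] at this
  exact hx this

theorem IsRightInt.apply_mul_groupLike {f : Du k H} (hf : IsRightInt f) {g : GroupLike k H}
    (hg1 : g ≠ 1) (hgg : g * g = 1) {x : H} (hx : IsSkew k g.val 1 x) (hxG : x ∉ glSpan k H) :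
    f 1 = 0 ∧ f (x * g.val) = 0 := by
  classical
  have h1 := hx.mul_groupLike g
  rw [← GroupLike.val_mul, hgg, GroupLike.val_one, one_mul] at h1
  have h2 : f 1 • (x * g.val) + f (x * g.val) • g.val = f (x * g.val) • (1 : H) := by
    rw [← hf, lact_apply, h1.sw_eq (F := fun a b => f a • b)
      (by constructor <;> intro <;> fun_prop)]
  have h3 : f 1 = 0 := by
    by_contra h
    refine notMem_glSpan_mul_groupLike hxG g ?_
    rw [← inv_smul_smul₀ h (x * g.val), eq_sub_of_add_eq h2]
    refine Submodule.smul_mem _ _ (sub_mem (Submodule.smul_mem _ _ ?_)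
      (Submodule.smul_mem _ _ (val_mem_glSpan g)))
    rw [← GroupLike.val_one (R := k)]
    exact val_mem_glSpan 1
  refine ⟨h3, ?_⟩
  obtain ⟨u, hu⟩ := exists_dual_groupLike g
  rw [h3, zero_smul, zero_add, ← GroupLike.val_one (R := k)] at h2
  have h4 := congrArg u.ofConv h2
  rw [map_smul, map_smul] at h4
  have h5 : f (x * g.val) • u g.val = f (x * g.val) • u (1 : GroupLike k H).val := h4
  rwa [hu, hu, if_pos rfl, if_neg hg1.symm, smul_zero, smul_eq_mul, mul_one] at h5

theorem notMem_glSpan_of_anticommute {g : GroupLike k H} (hG : ∀ c : GroupLike k H, c = 1 ∨ c = g)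
    {x : H} (hgx : g.val * x = -(x * g.val)) (hx0 : x ≠ 0) : x ∉ glSpan k H := by
  intro hx
  have h1 : g.val * x = x * g.val := by
    clear hgx hx0
    induction hx using Submodule.span_induction with
    | mem x hx =>
      obtain ⟨c, rfl⟩ := hx
      rcases hG c with rfl | rfl
      · simp
      · rfl
    | zero => simp
    | add x y _ _ hx hy => rw [add_mul, mul_add, hx, hy]
    | smul c x _ hx => rw [smul_mul_assoc, mul_smul_comm, hx]
  rw [h1, eq_neg_iff_add_eq_zero, ← two_smul k] at hgx
  have h2 := (smul_eq_zero.1 hgx).resolve_left two_ne_zero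
  refine hx0 ?_
  rw [← mul_one x, ← GroupLike.val_one (R := k), ← mul_inv_cancel g, GroupLike.val_mul,
    ← mul_assoc, h2, zero_mul]

theorem IsRightInt.apply_skew_ne_zero {p : ℕ} (hp : p.Prime) (hodd : Odd p)
    (hdim : Module.finrank k H = 4 * p) (hpt : IsPointedOf (comul (R := k) (A := H)))
    (h2 : Nat.card (GroupLike k H) = 2) {g : GroupLike k H} (hg1 : g ≠ 1) (hgg : g * g = 1)
    (hG : ∀ c : GroupLike k H, c = 1 ∨ c = g) {Λ : H} {f : Du k H} (hΛ : IsLeftInt k Λ)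
    (hf : IsRightInt f) (h1 : f Λ = 1)
    {x : H} (hx : IsSkew k g.val 1 x) (hgx : g.val * x = -(x * g.val)) (hx0 : x ≠ 0) :
    f x ≠ 0 := by
  obtain ⟨u, hu, hux⟩ := exists_isRightInt_apply_ne_zero hp hodd hdim hpt h2 hg1 hgg hG hx hgx hx0
  intro h0
  refine hux ?_
  have hxG := notMem_glSpan_of_anticommute hG hgx hx0
  have h3 : f (x + g.val * x) = f x - f (x * g.val) := by
    rw [hgx, ← sub_eq_add_neg]
    exact map_sub f.ofConv _ _
  rw [IsRightInt.unique hΛ hf h1 hu, h3, h0, (hf.apply_mul_groupLike hg1 hgg hx hxG).2, sub_zero,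
    mul_zero]

theorem mem_glSpan_sup_of_skew {g : GroupLike k H} (hgg : g * g = 1)
    (hG : ∀ c : GroupLike k H, c = 1 ∨ c = g) {x : H}
    (hW : ∀ y : H, IsSkew k g.val 1 y → g.val * y = -(y * g.val) → y ∈ Submodule.span k {x})
    (a b : GroupLike k H) (z : H) (hz : IsSkew k a.val b.val z) :
    z ∈ glSpan k H ⊔ Submodule.span k {x, x * g.val} := by
  have hinv : ∀ c : GroupLike k H, c * c = 1 := fun c => by
    rcases hG c with rfl | rfl
    · exact one_mul 1
    · exact hgg
  have hg : g.val * g.val = 1 := by rw [← GroupLike.val_mul, hgg, GroupLike.val_one]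
  have h1 := hz.mul_groupLike b
  rw [← GroupLike.val_mul, ← GroupLike.val_mul, hinv b, GroupLike.val_one] at h1
  have hy : z * b.val ∈ glSpan k H ⊔ Submodule.span k {x} := by
    generalize z * b.val = y at h1
    rcases hG (a * b) with h | h
    · rw [h, GroupLike.val_one] at h1
      rw [eq_zero_of_primitive h1]
      exact zero_mem _
    · rw [h] at h1
      have h2 : IsSkew k g.val 1 (g.val * y * g.val) := by
        have := isSkew_conj h1 (h := g) rfl
        rwa [inv_eq_of_mul_eq_one_left hgg] at this
      have h3 : y = (2⁻¹ : k) • (y + g.val * y * g.val) + (2⁻¹ : k) • (y - g.val * y * g.val) := by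
        rw [← smul_add, add_add_sub_cancel, ← two_smul k y, smul_smul,
          inv_mul_cancel₀ two_ne_zero, one_smul]
      rw [h3]
      refine Submodule.add_mem_sup (Submodule.smul_mem _ _ ?_) (Submodule.smul_mem _ _ ?_)
      · refine mem_glSpan_of_commute ((skewSpace g).add_mem h1 h2) ?_
        rw [mul_add, add_mul, ← mul_assoc, ← mul_assoc, hg, one_mul, mul_assoc (g.val * y), hg,
          mul_one, add_comm]
      · refine hW _ ((skewSpace g).sub_mem h1 h2) ?_
        rw [mul_sub, sub_mul, ← mul_assoc, ← mul_assoc, hg, one_mul, mul_assoc (g.val * y), hg,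
          mul_one, neg_sub]
  have h4 : z = z * b.val * b.val := by
    rw [mul_assoc, ← GroupLike.val_mul, hinv b, GroupLike.val_one, mul_one]
  rw [h4]
  obtain ⟨u, hu, v, hv, huv⟩ := Submodule.mem_sup.1 hy
  obtain ⟨c, rfl⟩ := Submodule.mem_span_singleton.1 hv
  rw [← huv, add_mul, smul_mul_assoc]
  refine Submodule.add_mem_sup (glSpan_mul_groupLike hu b) (Submodule.smul_mem _ _
    (Submodule.subset_span ?_))
  rcases hG b with rfl | rfl
  · simp
  · simp

theorem not_isPointed_of_card_eq_two {p : ℕ} (hp : p.Prime) (hodd : Odd p)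
    (hdim : Module.finrank k H = 4 * p) (h2 : Nat.card (GroupLike k H) = 2) :
    ¬ IsPointedOf (comul (R := k) (A := H)) := by
  intro hpt
  have hp0 := hp.pos
  obtain ⟨g, x, χ, hx, hxG, hgx, hχ⟩ := exists_skew_eigenvector hpt (fun h => by
    have := finrank_glSpan (k := k) (H := H)
    rw [h, finrank_top, hdim, h2] at this
    omega)
  rw [h2] at hχ
  obtain rfl : χ = -1 := (sq_eq_one_iff.1 hχ).resolve_left
    fun h => hxG (mem_glSpan_of_commute hx (by rw [hgx, h, one_smul]))
  rw [neg_smul, one_smul] at hgx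
  have hx0 : x ≠ 0 := fun h => hxG (h ▸ zero_mem _)
  have hg1 : g ≠ 1 := by
    rintro rfl
    rw [GroupLike.val_one] at hx
    exact hx0 (eq_zero_of_primitive hx)
  have hgg : g * g = 1 := by
    rw [← pow_two, ← h2]
    exact pow_card_eq_one'
  have hG : ∀ c : GroupLike k H, c = 1 ∨ c = g := by
    intro c
    by_contra! h
    have := (Nat.card_eq_two_iff' (1 : GroupLike k H)).1 h2
    exact h.2 (this.unique h.1 hg1)
  obtain ⟨Λ, f, hΛ, hf, h1⟩ := exists_integrals k H
  have hfx := hf.apply_skew_ne_zero hp hodd hdim hpt h2 hg1 hgg hG hΛ h1 hx hgx hx0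
  obtain ⟨hf1, hfxg⟩ := hf.apply_mul_groupLike hg1 hgg hx hxG
  have hW : ∀ y : H, IsSkew k g.val 1 y → g.val * y = -(y * g.val) →
      y ∈ Submodule.span k {x} := by
    intro y hy hgy
    rw [Submodule.mem_span_singleton]
    refine ⟨f y / f x, ?_⟩
    by_contra hne
    refine hf.apply_skew_ne_zero hp hodd hdim hpt h2 hg1 hgg hG hΛ h1 (x := y - (f y / f x) • x)
      ((skewSpace g).sub_mem hy ((skewSpace g).smul_mem _ hx)) ?_ (sub_ne_zero.2 (Ne.symm hne)) ?_
    · rw [mul_sub, sub_mul, hgy, mul_smul_comm, hgx, smul_mul_assoc, smul_neg]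
      abel
    · change f.ofConv _ = 0
      rw [map_sub, map_smul, smul_eq_mul, div_mul_cancel₀ _ hfx, sub_self]
  have hD := perp_mul_le hpt le_sup_left (mem_glSpan_sup_of_skew hgg hG hW)
  let J := ann (glSpan k H)
  have hev : ∀ (u v : Du k H) (c : k) y, (u - c • v) y = u y - c * v y := fun _ _ _ _ => rfl
  have hfg := hf.apply_groupLike hg1
  have hfJ : f ∈ J := mem_ann_glSpan.2 fun c => by
    rcases hG c with rfl | rfl
    · exact hf1
    · exact hfg
  have hsf : shiftR g.val f ∈ J := mem_ann_glSpan.2 fun c => by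
    rw [shiftR_apply, ← GroupLike.val_mul]
    exact mem_ann_glSpan.1 hfJ _
  have hfu : ∀ u : Du k H, f * u = u 1 • f := fun u => du_ext fun y => by
    rw [← apply_lact, hf, du_smul_apply, mul_comm]
    exact map_smul u.ofConv _ _
  have hfu0 : ∀ u ∈ J, f * u = 0 := fun u hu => by
    rw [hfu, ← GroupLike.val_one (R := k), mem_ann_glSpan.1 hu, zero_smul]
  have hsfu0 : ∀ u ∈ J, shiftR g.val f * u = 0 := fun u hu => by
    have h3 : shiftR g.val (shiftR g.val u) = u := du_ext fun y => by
      rw [shiftR_apply, shiftR_apply, mul_assoc, ← GroupLike.val_mul, hgg, GroupLike.val_one,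
        mul_one]
    rw [← h3, ← shiftR_mul, hfu, shiftR_apply, one_mul, mem_ann_glSpan.1 hu, zero_smul]
    rfl
  have hle : J * J ≤ J * (J * J) := by
    refine mul_self_le_of_forall_exists fun h hh =>
      ⟨h - (h x / f x) • f - (h (x * g.val) / f x) • shiftR g.val f, ?_, fun u hu => ?_⟩
    · rw [← ann_perp (J * J)]
      refine ann_anti hD fun y hy => ?_
      obtain ⟨a, ha, b, hb, rfl⟩ := Submodule.mem_sup.1 hy
      have h4 : ∀ c ∈ ({x, x * g.val} : Set H),
          (h - (h x / f x) • f - (h (x * g.val) / f x) • shiftR g.val f) c = 0 := by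
        rintro c (rfl | rfl)
        · rw [hev, hev, shiftR_apply, hfxg, div_mul_cancel₀ _ hfx]
          ring
        · rw [hev, hev, shiftR_apply, hfxg, mul_assoc, ← GroupLike.val_mul, hgg,
            GroupLike.val_one, mul_one, div_mul_cancel₀ _ hfx]
          ring
      have h5 : Submodule.span k {x, x * g.val} ≤ LinearMap.ker
          (h - (h x / f x) • f - (h (x * g.val) / f x) • shiftR g.val f).ofConv :=
        Submodule.span_le.2 h4
      refine (map_add _ a b).trans ?_
      rw [LinearMap.mem_ker.1 (h5 hb), add_zero]
      exact Submodule.sub_mem _ (Submodule.sub_mem _ hh (Submodule.smul_mem _ _ hfJ))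
        (Submodule.smul_mem _ _ hsf) a ha
    · rw [sub_mul, sub_mul, smul_mul_assoc, smul_mul_assoc, hfu0 u hu, hsfu0 u hu, smul_zero,
        smul_zero, sub_zero, sub_zero]
  obtain ⟨n, hn⟩ := exists_ann_glSpan_pow_eq_bot hpt
  change perp (J * J) ≤ _ at hD
  rw [eq_bot_of_le_mul hn hle, perp_bot, top_le_iff] at hD
  have h3 := Submodule.finrank_add_le_finrank_add_finrank (glSpan k H)
    (Submodule.span k {x, x * g.val})
  have h4 : Module.finrank k (Submodule.span k {x, x * g.val}) ≤ 2 := by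
    classical
    have := finrank_span_finset_le_card (R := k) {x, x * g.val}
    rw [Finset.coe_pair] at this
    exact this.trans Finset.card_le_two
  rw [hD, finrank_top, hdim, finrank_glSpan, h2] at h3
  have := hp.two_le
  omega

end CaseTwo

end Hopf4p

open Hopf4p

theorem nonsemisimple_dim_4p_pointed_iff_card_groupLike_gt_two
    (k : Type) [Field k] [IsAlgClosed k] [CharZero k]
    (p : ℕ) (hp : p.Prime) (hodd : Odd p)
    (H : Type) [Ring H] [HopfAlgebra k H]
    (hdim : Module.finrank k H = 4 * p)
    (hns : ¬ IsSemisimpleRing H) :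
    IsPointedOf (Coalgebra.comul (R := k) (A := H)) ↔
      2 < Nat.card {a : H // IsGroupLikeOf (Coalgebra.comul (R := k) (A := H)) a} := by
  have hp0 := hp.pos
  have hfd : FiniteDimensional k H := Module.finite_of_finrank_pos (by omega)
  have hc : Nat.card {a : H // IsGroupLikeOf (Coalgebra.comul (R := k) (A := H)) a} =
      Nat.card (GroupLike k H) :=
    Nat.card_congr ((Equiv.subtypeEquivRight fun a => isGroupLikeOf_iff a).trans
      GroupLike.valEquiv.symm)
  rw [hc]
  have hpos : 0 < Nat.card (GroupLike k H) := Nat.card_pos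
  constructor
  · intro hpt
    by_contra hle
    obtain h | h : Nat.card (GroupLike k H) = 1 ∨ Nat.card (GroupLike k H) = 2 := by omega
    · exact not_isPointed_of_card_eq_one h (by omega) hpt
    · exact not_isPointed_of_card_eq_two hp hodd hdim h hpt
  · intro hlt
    have hdvd : Nat.card (GroupLike k H) ∣ 4 * p := hdim ▸ card_dvd_finrank_top
    have h4 := card_groupLike_ne_four hp hodd hdim hns
    have h1 := card_groupLike_ne_prime hp hodd hdim hns
    by_cases hpc : p ∣ Nat.card (GroupLike k H)
    · obtain ⟨m, hm⟩ := hpc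
      rw [hm, mul_comm 4 p] at hdvd
      have hm4 := Nat.dvd_of_mul_dvd_mul_left hp0 hdvd
      have := Nat.le_of_dvd (by norm_num) hm4
      interval_cases m
      · omega
      · omega
      · exact isPointed_of_card_eq_two_mul hp hodd hdim (by omega)
      · omega
      · exact isPointed_of_card_eq_finrank (by omega)
    · have hd := Nat.Coprime.dvd_of_dvd_mul_right
        ((Nat.Prime.coprime_iff_not_dvd hp).2 hpc).symm hdvd
      have := Nat.le_of_dvd (by norm_num) hd
      interval_cases Nat.card (GroupLike k H)
      all_goals omega
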